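/- Let E denote the group under pointwise multiplication generated by all the functions [r]_l (over all integers l ≥ 1 and r with l ∤ r). A function f : ℍ → ℂ belongs to ℚ*·E (i.e. f is a nonzero rational multiple of a finite product of integral, possibly negative, powers of functions [r]_l) if and only if f is a modular unit such that, for some rational number s, f(z)·exp(−2πisz) = Σ_{n≥0} c_n·exp(2πinz) for all z ∈ ℍ with rational coefficients c_n. -/

import Mathlib

open Complex Filter Topology UpperHalfPlane Matrix MatrixGroups
open scoped Real Manifold

noncomputable section

/-- `B(x) = y² − y + 1/6` where `y` is the fractional part of `x`. -/
def bern (x : ℝ) : ℝ := Int.fract x ^ 2 - Int.fract x + 1 / 6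

/-- The modular unit `[r]_l`. -/
def rl (l r : ℤ) : UpperHalfPlane → ℂ := fun z =>
  Complex.exp (2 * (π : ℂ) * Complex.I *
      ((-((l : ℝ) * bern ((r : ℝ) / (l : ℝ)) / 2) : ℝ) : ℂ) * (z : ℂ)) *
    (∏' n : {n : ℤ // 0 < n ∧ n ≡ r [ZMOD l]},
      (1 - Complex.exp (2 * (π : ℂ) * Complex.I * ((n : ℤ) : ℂ) * (z : ℂ)))⁻¹) *
    (∏' n : {n : ℤ // 0 < n ∧ n ≡ -r [ZMOD l]},
      (1 - Complex.exp (2 * (π : ℂ) * Complex.I * ((n : ℤ) : ℂ) * (z : ℂ)))⁻¹)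

/-- A modular unit: holomorphic, nowhere vanishing on `ℍ`, invariant under some principal
congruence subgroup, and meromorphic at all cusps. -/
def IsModularUnit (f : UpperHalfPlane → ℂ) : Prop :=
  MDifferentiable 𝓘(ℂ) 𝓘(ℂ) f ∧
  (∀ z, f z ≠ 0) ∧
  (∃ N : ℕ, 0 < N ∧ ∀ A ∈ CongruenceSubgroup.Gamma N, ∀ z : UpperHalfPlane, f (A • z) = f z) ∧
  (∀ A : SL(2, ℤ), ∃ (α : ℝ) (κ : ℂ), κ ≠ 0 ∧
    Filter.Tendsto
      (fun z : UpperHalfPlane =>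
        f (A • z) * Complex.exp (-(2 * (π : ℂ) * Complex.I * (α : ℂ) * (z : ℂ))))
      UpperHalfPlane.atImInfty (nhds κ))


/-- The exponential `e(x) = exp(2πix)`. -/
def ee (x : ℂ) : ℂ := Complex.exp (2 * (π : ℂ) * Complex.I * x)

lemma ee_add (x y : ℂ) : ee (x + y) = ee x * ee y := by
  simp only [ee, mul_add, Complex.exp_add]

lemma ee_ne_zero (x : ℂ) : ee x ≠ 0 := Complex.exp_ne_zero _

lemma ee_zero : ee 0 = 1 := by simp [ee]

lemma ee_one : ee 1 = 1 := by simp [ee]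

lemma ee_neg (x : ℂ) : ee (-x) = (ee x)⁻¹ := by
  simp only [ee, mul_neg, Complex.exp_neg]

lemma ee_sub (x y : ℂ) : ee (x - y) = ee x / ee y := by
  rw [sub_eq_add_neg, ee_add, ee_neg, div_eq_mul_inv]

lemma ee_nat_mul (n : ℕ) (x : ℂ) : ee (n * x) = ee x ^ n := by
  simp only [ee]; rw [← Complex.exp_nat_mul]; congr 1; ring

lemma ee_int_mul (n : ℤ) (x : ℂ) : ee (n * x) = ee x ^ n := by
  simp only [ee]; rw [← Complex.exp_int_mul]; congr 1; ring

lemma ee_int (n : ℤ) : ee n = 1 := by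
  have := ee_int_mul n 1
  simpa [ee_one] using this

lemma ee_nat (n : ℕ) : ee n = 1 := by
  have := ee_nat_mul n 1
  simpa [ee_one] using this

lemma ee_half : ee (1 / 2) = -1 := by
  simp only [ee]
  rw [show 2 * (π : ℂ) * Complex.I * (1 / 2) = π * Complex.I by ring, Complex.exp_pi_mul_I]

lemma ee_eq_one_iff (x : ℂ) : ee x = 1 ↔ ∃ n : ℤ, x = n := by
  rw [ee, Complex.exp_eq_one_iff]
  have hp : (2 * (π : ℂ) * Complex.I) ≠ 0 := Complex.two_pi_I_ne_zero
  constructor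
  · rintro ⟨n, h⟩
    refine ⟨n, ?_⟩
    apply mul_left_cancel₀ hp
    rw [h]; ring
  · rintro ⟨n, h⟩
    exact ⟨n, by rw [h]; ring⟩

lemma norm_ee (x : ℂ) : ‖ee x‖ = Real.exp (-(2 * π * x.im)) := by
  rw [ee, Complex.norm_exp]
  congr 1
  simp [Complex.mul_re, Complex.mul_im]

lemma norm_ee_lt_one {x : ℂ} (h : 0 < x.im) : ‖ee x‖ < 1 := by
  rw [norm_ee, Real.exp_lt_one_iff]
  have := Real.pi_pos
  have : 0 < 2 * π * x.im := by positivity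
  linarith

lemma differentiable_ee : Differentiable ℂ ee := by
  unfold ee; fun_prop

@[fun_prop]
lemma differentiable_ee' {f : ℂ → ℂ} (hf : Differentiable ℂ f) :
    Differentiable ℂ (fun x => ee (f x)) := differentiable_ee.comp hf

lemma hasDerivAt_ee (x : ℂ) : HasDerivAt ee (2 * π * Complex.I * ee x) x := by
  unfold ee
  have := ((hasDerivAt_id x).const_mul (2 * (π : ℂ) * Complex.I)).cexp
  simpa [mul_comm] using this

lemma diffOn_tprod {U : Set ℂ} (hU : IsOpen U) {f : ℕ → ℂ → ℂ}
    (hf : ∀ n, DifferentiableOn ℂ (f n) U)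
    (hb : ∀ K ⊆ U, IsCompact K → ∃ u : ℕ → ℝ, Summable u ∧ ∀ n, ∀ x ∈ K, ‖f n x‖ ≤ u n) :
    DifferentiableOn ℂ (fun x => ∏' n, (1 + f n x)) U := by
  have : HasProdLocallyUniformlyOn (fun n x => 1 + f n x) (fun x => ∏' n, (1 + f n x)) U := by
    apply hasProdLocallyUniformlyOn_of_forall_compact hU
    intro K hK hcK
    obtain ⟨u, hu, h⟩ := hb K hK hcK
    exact hu.hasProdUniformlyOn_nat_one_add hcK (.of_forall h)
      (fun n => ((hf n).mono hK).continuousOn)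
  exact this.differentiableOn
    (.of_forall fun s ↦ by
      simpa [Finset.prod_fn] using DifferentiableOn.finsetProd
        (fun n _ ↦ ((hf n).const_add 1))) hU

/-- The infinite product `∏ (1 - q^n x)`. -/
def PP (q x : ℂ) : ℂ := ∏' n : ℕ, (1 - q ^ n * x)

lemma summable_PP {q : ℂ} (hq : ‖q‖ < 1) (x : ℂ) : Summable fun n : ℕ => ‖q ^ n * x‖ := by
  simp only [norm_mul, norm_pow]
  exact (summable_geometric_of_lt_one (norm_nonneg _) hq).mul_right _

lemma multipliable_PP {q : ℂ} (hq : ‖q‖ < 1) (x : ℂ) :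
    Multipliable fun n : ℕ => (1 - q ^ n * x) := by
  have := multipliable_one_add_of_summable (f := fun n : ℕ => -(q ^ n * x))
    (by simpa using summable_PP hq x)
  simpa [sub_eq_add_neg] using this

lemma PP_succ {q : ℂ} (hq : ‖q‖ < 1) (x : ℂ) : PP q x = (1 - x) * PP q (q * x) := by
  have h2 := tprod_eq_zero_mul' (f := fun n : ℕ => (1 - q ^ n * x)) (by
    have := multipliable_PP hq (q * x)
    convert this using 2
    ring)
  rw [PP, h2, PP]
  congr 1
  · simp
  · congr 1
    ext n; ring

lemma PP_eq_zero_iff {q : ℂ} (hq : ‖q‖ < 1) (x : ℂ) :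
    PP q x = 0 ↔ ∃ n : ℕ, q ^ n * x = 1 := by
  constructor
  · intro h
    by_contra hc
    push Not at hc
    have := tprod_one_add_ne_zero_of_summable (f := fun n : ℕ => -(q ^ n * x))
      (fun n => by
        rw [← sub_eq_add_neg]; exact sub_ne_zero.mpr (Ne.symm (hc n)))
      (by simpa using summable_PP hq x)
    apply this
    simpa [PP, sub_eq_add_neg] using h
  · rintro ⟨n, hn⟩
    induction n generalizing x with
    | zero => rw [PP_succ hq]; simp at hn; simp [hn]
    | succ n ih =>
      rw [PP_succ hq, ih (q * x) (by rw [← hn]; ring), mul_zero]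

lemma differentiable_PP {q : ℂ} (hq : ‖q‖ < 1) : Differentiable ℂ (PP q) := by
  rw [← differentiableOn_univ]
  have := diffOn_tprod (U := Set.univ) isOpen_univ (f := fun n x => -(q ^ n * x))
    (fun n => by fun_prop) (by
      intro K _ hK
      obtain ⟨C, hC⟩ := hK.isBounded.exists_norm_le
      refine ⟨fun n => ‖q‖ ^ n * C,
        (summable_geometric_of_lt_one (norm_nonneg _) hq).mul_right _, ?_⟩
      intro n x hx
      simp only [norm_neg, norm_mul, norm_pow]
      gcongr
      exact hC x hx)
  refine this.congr ?_
  intro x _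
  simp [PP, sub_eq_add_neg]

/-- The theta-like function. -/
def th (τ w : ℂ) : ℂ := ee (τ / 12 - w / 2) * PP (ee τ) (ee w) * PP (ee τ) (ee τ * ee (-w))


lemma th_add_one (τ w : ℂ) : th τ (w + 1) = - th τ w := by
  have h1 : ee (w + 1) = ee w := by rw [ee_add, ee_one, mul_one]
  have h2 : ee (-(w + 1)) = ee (-w) := by rw [ee_neg, h1, ee_neg]
  rw [th, h1, h2, show τ / 12 - (w + 1) / 2 = (τ / 12 - w / 2) - 1 / 2 by ring, ee_sub _ (1 / 2),
    ee_half, th]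
  ring

lemma th_add_tau {τ : ℂ} (hτ : 0 < τ.im) (w : ℂ) : th τ (w + τ) = - ee (-w - τ / 2) * th τ w := by
  have hq := norm_ee_lt_one hτ
  have h1 : ee (w + τ) = ee τ * ee w := by rw [ee_add]; ring
  have h2 : ee τ * ee (-(w + τ)) = ee (-w) := by
    rw [← ee_add]; congr 1; ring
  rw [th, h1, h2, th, PP_succ hq (ee (-w)), PP_succ hq (ee w)]
  rw [show τ / 12 - (w + τ) / 2 = (τ / 12 - w / 2) + (- τ / 2) by ring, ee_add,
    show -w - τ / 2 = -w + (-τ / 2) by ring, ee_add (-w)]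
  have h3 : 1 - ee (-w) = - ee (-w) * (1 - ee w) := by
    rw [ee_neg]; field_simp [ee_ne_zero w]; ring
  rw [h3]; ring

lemma th_sub_tau {τ : ℂ} (hτ : 0 < τ.im) (w : ℂ) : th τ (w - τ) = - ee (w - τ / 2) * th τ w := by
  have h := th_add_tau hτ (w - τ)
  rw [sub_add_cancel] at h
  rw [h, show -(w - τ) - τ / 2 = -(w - τ / 2) by ring, ee_neg]
  field_simp [ee_ne_zero]

lemma differentiable_th {τ : ℂ} (hτ : 0 < τ.im) : Differentiable ℂ (th τ) := by
  have hq := norm_ee_lt_one hτ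
  unfold th
  have h1 : Differentiable ℂ fun w => PP (ee τ) (ee w) :=
    (differentiable_PP hq).comp differentiable_ee
  have h2 : Differentiable ℂ fun w => PP (ee τ) (ee τ * ee (-w)) :=
    (differentiable_PP hq).comp (by fun_prop)
  fun_prop

lemma th_eq_zero {τ : ℂ} (hτ : 0 < τ.im) {w : ℂ} (h : th τ w = 0) : ∃ m n : ℤ, w = m + n * τ := by
  have hq := norm_ee_lt_one hτ
  rw [th, mul_eq_zero, mul_eq_zero] at h
  rcases h with (h | h) | h
  · exact absurd h (ee_ne_zero _)
  · rw [PP_eq_zero_iff hq] at h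
    obtain ⟨n, hn⟩ := h
    rw [← ee_nat_mul, ← ee_add, ee_eq_one_iff] at hn
    obtain ⟨m, hm⟩ := hn
    exact ⟨m, -n, by push_cast; linear_combination hm⟩
  · rw [PP_eq_zero_iff hq] at h
    obtain ⟨n, hn⟩ := h
    rw [← ee_nat_mul, ← ee_add, ← ee_add, ee_eq_one_iff] at hn
    obtain ⟨m, hm⟩ := hn
    exact ⟨-m, n + 1, by push_cast; linear_combination -hm⟩

lemma th_zero {τ : ℂ} (hτ : 0 < τ.im) : th τ 0 = 0 := by
  have hq := norm_ee_lt_one hτ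
  rw [th, PP_succ hq (ee 0)]; simp [ee_zero]

lemma hasDerivAt_th_zero {τ : ℂ} (hτ : 0 < τ.im) :
    HasDerivAt (th τ) (-(2 * π * Complex.I) * (ModularForm.eta τ) ^ 2) 0 := by
  have hq := norm_ee_lt_one hτ
  have hfac : th τ = fun w => (1 - ee w) *
      (ee (τ / 12 - w / 2) * PP (ee τ) (ee τ * ee w) * PP (ee τ) (ee τ * ee (-w))) := by
    ext w
    rw [th, PP_succ hq (ee w)]; ring
  have h1 : Differentiable ℂ fun w => PP (ee τ) (ee τ * ee w) :=
    (differentiable_PP hq).comp (by fun_prop)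
  have h2 : Differentiable ℂ fun w => PP (ee τ) (ee τ * ee (-w)) :=
    (differentiable_PP hq).comp (by fun_prop)
  have h3 : Differentiable ℂ fun w => (ee (τ / 12 - w / 2) * PP (ee τ) (ee τ * ee w) *
    PP (ee τ) (ee τ * ee (-w))) := by fun_prop
  have h4 := ((hasDerivAt_ee 0).const_sub 1).mul (h3 0).hasDerivAt
  rw [hfac]
  refine h4.congr_deriv ?_
  have h5 : ModularForm.eta τ = ee (τ / 24) * PP (ee τ) (ee τ) := by
    rw [ModularForm.eta, PP]
    congr 1
    · simp only [Function.Periodic.qParam, ee]; congr 1; push_cast; ring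
    · congr 1; ext n
      rw [ModularForm.eta_q_eq_pow, ee, pow_succ]
  have h6 : ee (τ / 12) = ee (τ / 24) * ee (τ / 24) := by rw [← ee_add]; congr 1; ring
  rw [h5]
  simp only [ee_zero, neg_zero, zero_div, sub_zero, mul_one, sub_self, zero_mul, add_zero, h6]
  ring

lemma im_neg_inv_pos {τ : ℂ} (hτ : 0 < τ.im) : 0 < (-1 / τ).im := by
  have h := UpperHalfPlane.im_inv_neg_coe_pos ⟨τ, hτ⟩
  have h2 : (-1 / τ) = (-τ)⁻¹ := by rw [neg_div, one_div, inv_neg]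
  rw [h2]; exact h

/-- The transformed theta function. -/
def psi (τ w : ℂ) : ℂ := ee (-(w ^ 2 / (2 * τ))) * th (-1 / τ) (w / τ)

lemma ne_zero_of_im {τ : ℂ} (hτ : 0 < τ.im) : τ ≠ 0 := by
  rintro rfl; simp at hτ

lemma psi_add_tau {τ : ℂ} (hτ : 0 < τ.im) (w : ℂ) :
    psi τ (w + τ) = - ee (-w - τ / 2) * psi τ w := by
  have h0 := ne_zero_of_im hτ
  rw [psi, psi, show (w + τ) / τ = w / τ + 1 by field_simp, th_add_one,
    show -((w + τ) ^ 2 / (2 * τ)) = (-w - τ / 2) + -(w ^ 2 / (2 * τ)) by field_simp; ring, ee_add]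
  ring

lemma psi_add_one {τ : ℂ} (hτ : 0 < τ.im) (w : ℂ) : psi τ (w + 1) = - psi τ w := by
  have h0 := ne_zero_of_im hτ
  rw [psi, psi, show (w + 1) / τ = w / τ - (-1 / τ) by field_simp; ring,
    th_sub_tau (im_neg_inv_pos hτ),
    show -((w + 1) ^ 2 / (2 * τ)) = -(w / τ - (-1 / τ) / 2) + -(w ^ 2 / (2 * τ)) by
      field_simp; ring, ee_add, ee_neg]
  field_simp [ee_ne_zero]

lemma differentiable_psi {τ : ℂ} (hτ : 0 < τ.im) : Differentiable ℂ (psi τ) := by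
  have h := differentiable_th (im_neg_inv_pos hτ)
  have h2 : Differentiable ℂ fun w => th (-1 / τ) (w / τ) := h.comp (by fun_prop)
  unfold psi
  fun_prop

lemma psi_zero {τ : ℂ} (hτ : 0 < τ.im) : psi τ 0 = 0 := by
  rw [psi, zero_div, th_zero (im_neg_inv_pos hτ), mul_zero]

lemma eta_sq_S {τ : ℂ} (hτ : 0 < τ.im) :
    ModularForm.eta (-1 / τ) ^ 2 = -Complex.I * τ * ModularForm.eta τ ^ 2 := by
  have h := ModularForm.eta_comp_eq_csqrt_I_inv (show τ ∈ upperHalfPlaneSet from hτ)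
  simp only [Function.comp_apply, Pi.smul_apply, Pi.mul_apply, smul_eq_mul] at h
  rw [h, mul_pow, mul_pow, inv_pow]
  have hs : ∀ z : ℂ, z ≠ 0 → sqrt z ^ 2 = z := by
    intro z hz
    rw [sqrt_eq_exp hz, ← Complex.exp_nat_mul]
    rw [show ((2 : ℕ) : ℂ) * (Complex.log z / 2) = Complex.log z by push_cast; ring,
      Complex.exp_log hz]
  rw [hs _ (ne_zero_of_im hτ), hs _ Complex.I_ne_zero, Complex.inv_I]
  ring

lemma hasDerivAt_psi_zero {τ : ℂ} (hτ : 0 < τ.im) :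
    HasDerivAt (psi τ) (-Complex.I * (-(2 * π * Complex.I) * (ModularForm.eta τ) ^ 2)) 0 := by
  have h0 := ne_zero_of_im hτ
  have h1 := hasDerivAt_th_zero (im_neg_inv_pos hτ)
  have h2 : HasDerivAt (fun w : ℂ => w / τ) (1 / τ) 0 := (hasDerivAt_id (0 : ℂ)).div_const τ
  have h3 : HasDerivAt (fun w => th (-1 / τ) (w / τ))
      (-(2 * π * Complex.I) * ModularForm.eta (-1 / τ) ^ 2 * (1 / τ)) 0 := by
    refine HasDerivAt.comp (0 : ℂ) (h₂ := th (-1 / τ)) (h := fun w : ℂ => w / τ) ?_ h2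
    simp only [zero_div]; exact h1
  have h4 : Differentiable ℂ (fun w : ℂ => ee (-(w ^ 2 / (2 * τ)))) := by fun_prop
  have h5 := (h4 0).hasDerivAt.mul h3
  unfold psi
  refine h5.congr_deriv ?_
  rw [zero_div, th_zero (im_neg_inv_pos hτ), eta_sq_S hτ]
  simp [ee_zero]
  field_simp

/-- The ratio of the two theta functions. -/
def thR (τ w : ℂ) : ℂ := if th τ w = 0 then -Complex.I else psi τ w / th τ w

lemma thR_add_one {τ : ℂ} (hτ : 0 < τ.im) : Function.Periodic (thR τ) 1 := by
  intro w
  simp only [thR, th_add_one, psi_add_one hτ, neg_eq_zero, neg_div_neg_eq]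

lemma thR_add_tau {τ : ℂ} (hτ : 0 < τ.im) : Function.Periodic (thR τ) τ := by
  intro w
  simp only [thR, th_add_tau hτ, psi_add_tau hτ, mul_eq_zero, neg_eq_zero, ee_ne_zero, false_or]
  rw [mul_div_mul_left _ _ (neg_ne_zero.mpr (ee_ne_zero _))]

lemma thR_add {τ : ℂ} (hτ : 0 < τ.im) (w : ℂ) (m n : ℤ) :
    thR τ (w + (m + n * τ)) = thR τ w := by
  rw [← add_assoc]
  have h1 := ((thR_add_tau hτ).int_mul n) (w + m)
  have h2 := ((thR_add_one hτ).int_mul m) w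
  rw [mul_one] at h2
  rw [h1, h2]

lemma thR_differentiableAt_zero {τ : ℂ} (hτ : 0 < τ.im) : DifferentiableAt ℂ (thR τ) 0 := by
  have hd : ∀ g : ℂ → ℂ, Differentiable ℂ g → DifferentiableAt ℂ (dslope g 0) 0 := by
    intro g hg
    have : DifferentiableOn ℂ (dslope g 0) Set.univ :=
      (Complex.differentiableOn_dslope (Filter.univ_mem)).mpr hg.differentiableOn
    exact (differentiableOn_univ.mp this) 0
  have h1 := hd _ (differentiable_th hτ)
  have h2 := hd _ (differentiable_psi hτ)
  have hne : -(2 * π * Complex.I) * (ModularForm.eta τ) ^ 2 ≠ 0 := by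
    have := ModularForm.eta_ne_zero (show τ ∈ upperHalfPlaneSet from hτ)
    have := Complex.two_pi_I_ne_zero
    simp_all
  have h3 : dslope (th τ) 0 0 ≠ 0 := by
    rw [dslope_same, (hasDerivAt_th_zero hτ).deriv]; exact hne
  have h4 := h2.div h1 h3
  refine h4.congr_of_eventuallyEq ?_
  filter_upwards [h1.continuousAt.eventually_ne h3] with w hw
  by_cases hw0 : w = 0
  · subst hw0
    simp only [Pi.div_apply]
    rw [thR, if_pos (th_zero hτ), dslope_same, dslope_same, (hasDerivAt_th_zero hτ).deriv,
      (hasDerivAt_psi_zero hτ).deriv, mul_div_assoc, div_self hne, mul_one]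
  · simp only [Pi.div_apply]
    rw [dslope_of_ne _ hw0] at hw ⊢
    rw [dslope_of_ne _ hw0]
    simp only [slope_def_field, th_zero hτ, psi_zero hτ, sub_zero] at hw ⊢
    have : th τ w ≠ 0 := by rintro h; simp [h] at hw
    rw [thR, if_neg this]
    field_simp

lemma thR_differentiable {τ : ℂ} (hτ : 0 < τ.im) : Differentiable ℂ (thR τ) := by
  intro w
  by_cases h : th τ w = 0
  · obtain ⟨m, n, rfl⟩ := th_eq_zero hτ h
    have h1 : thR τ = fun u => thR τ (u - (m + n * τ)) := by
      ext u
      conv_lhs => rw [← sub_add_cancel u (m + n * τ)]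
      rw [thR_add hτ]
    rw [h1]
    have h0 := thR_differentiableAt_zero hτ
    apply DifferentiableAt.comp (g := thR τ)
    · simpa using h0
    · fun_prop
  · have hd := ((differentiable_psi hτ) w).div ((differentiable_th hτ) w) h
    refine hd.congr_of_eventuallyEq ?_
    filter_upwards [(differentiable_th hτ).continuous.continuousAt.eventually_ne h] with u hu
    simp [thR, hu]

lemma thR_eq {τ : ℂ} (hτ : 0 < τ.im) (w : ℂ) : thR τ w = -Complex.I := by
  have h0 : thR τ 0 = -Complex.I := by rw [thR, if_pos (th_zero hτ)]
  rw [← h0]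
  apply (thR_differentiable hτ).apply_eq_apply_of_bounded
  have hcont := (thR_differentiable hτ).continuous
  have hK : IsCompact ((fun p : ℝ × ℝ => (p.1 : ℂ) + p.2 * τ) '' (Set.Icc 0 1 ×ˢ Set.Icc 0 1)) :=
    (isCompact_Icc.prod isCompact_Icc).image (by fun_prop)
  refine (hK.image hcont).isBounded.subset ?_
  rintro _ ⟨u, rfl⟩
  set y := u.im / τ.im with hy
  set x := u.re - y * τ.re with hx
  have hu : u = (x : ℂ) + y * τ := by
    apply Complex.ext
    · simp [hx]
    · simp [hy]; field_simp
  refine ⟨((Int.fract x : ℝ) : ℂ) + (Int.fract y : ℝ) * τ, ⟨(Int.fract x, Int.fract y), ?_, rfl⟩, ?_⟩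
  · exact ⟨⟨Int.fract_nonneg _, (Int.fract_lt_one _).le⟩,
      ⟨Int.fract_nonneg _, (Int.fract_lt_one _).le⟩⟩
  · rw [← thR_add hτ _ ⌊x⌋ ⌊y⌋]
    congr 1
    rw [hu]
    have e1 : ((Int.fract x : ℝ) : ℂ) + ⌊x⌋ = x := by
      exact_mod_cast congrArg (fun t : ℝ => (t : ℂ)) (Int.fract_add_floor x)
    have e2 : ((Int.fract y : ℝ) : ℂ) + ⌊y⌋ = y := by
      exact_mod_cast congrArg (fun t : ℝ => (t : ℂ)) (Int.fract_add_floor y)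
    rw [← e1, ← e2]; push_cast
    ring_nf

lemma psi_eq {τ : ℂ} (hτ : 0 < τ.im) (w : ℂ) : psi τ w = -Complex.I * th τ w := by
  by_cases h : th τ w = 0
  · have hcont : Continuous fun w => psi τ w - -Complex.I * th τ w := by
      have := (differentiable_psi hτ).continuous
      have := (differentiable_th hτ).continuous
      fun_prop
    obtain ⟨m, n, rfl⟩ := th_eq_zero hτ h
    have h1 : ∀ w, th τ w = 0 → th τ (w + 1) = 0 ∧ th τ (w - 1) = 0 := by
      intro w hw
      constructor
      · rw [th_add_one, hw, neg_zero]
      · have := th_add_one τ (w - 1)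
        rw [sub_add_cancel, hw] at this
        simpa using this.symm
    have hper : ∀ w, psi τ (w + 1) = -psi τ w := psi_add_one hτ
    have hz : psi τ (m + n * τ) = 0 := by
      have p1 : Function.Periodic (fun w => (psi τ w = 0)) 1 := by
        intro w; simp [psi_add_one hτ]
      have p2 : Function.Periodic (fun w => (psi τ w = 0)) τ := by
        intro w; simp [psi_add_tau hτ, ee_ne_zero]
      have q1 := (p2.int_mul n) m
      have q2 := (p1.int_mul m) 0
      simp only [mul_one, zero_add] at q1 q2
      rw [q1, q2]; exact psi_zero hτ
    rw [hz, h, mul_zero]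
  · have := thR_eq hτ w
    rw [thR, if_neg h, div_eq_iff h] at this
    exact this

/-- S-transformation of theta. -/
lemma th_S {τ : ℂ} (hτ : 0 < τ.im) (w : ℂ) :
    th (-1 / τ) (w / τ) = -Complex.I * ee (w ^ 2 / (2 * τ)) * th τ w := by
  have h := psi_eq hτ w
  rw [psi, ee_neg] at h
  have := ee_ne_zero (w ^ 2 / (2 * τ))
  rw [inv_mul_eq_iff_eq_mul₀ this] at h
  rw [h]; ring

/-- The Siegel function. -/
def GG (a b : ℝ) (τ : ℂ) : ℂ := ee (a * (a * τ + b) / 2) * th τ (a * τ + b)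

lemma GG_S (a b : ℝ) {τ : ℂ} (hτ : 0 < τ.im) :
    GG a b (-1 / τ) = -Complex.I * GG b (-a) τ := by
  have h0 := ne_zero_of_im hτ
  rw [GG, GG, show (a : ℂ) * (-1 / τ) + b = (b * τ + (-a)) / τ by field_simp; ring, th_S hτ]
  rw [show ((b : ℂ) * ((b : ℂ) * τ + ((-a : ℝ) : ℂ)) / 2) =
    (a : ℂ) * ((b * τ + (-a)) / τ) / 2 + (b * τ + (-a)) ^ 2 / (2 * τ) by
      push_cast; field_simp; ring, ee_add]
  push_cast; ring

lemma th_T (τ w : ℂ) : th (τ + 1) w = ee (1 / 12) * th τ w := by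
  have h1 : ee (τ + 1) = ee τ := by rw [ee_add, ee_one, mul_one]
  rw [th, th, h1, show (τ + 1) / 12 - w / 2 = 1 / 12 + (τ / 12 - w / 2) by ring, ee_add]
  ring

lemma GG_T (a b : ℝ) (τ : ℂ) : GG a b (τ + 1) = ee (1 / 12) * GG a (a + b) τ := by
  rw [GG, GG, th_T]
  push_cast
  rw [show (a : ℂ) * (τ + 1) + b = a * τ + (a + b) by ring]
  ring

lemma GG_add_one_right (a b : ℝ) (τ : ℂ) : GG a (b + 1) τ = ee ((a - 1) / 2) * GG a b τ := by
  rw [GG, GG]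
  push_cast
  rw [show (a : ℂ) * τ + (b + 1) = (a * τ + b) + 1 by ring, th_add_one,
    show (a : ℂ) * ((a * τ + b) + 1) / 2 = ((a - 1) / 2 + 1 / 2) + a * (a * τ + b) / 2 by ring,
    ee_add, ee_add, ee_half]
  ring

lemma GG_add_one_left (a b : ℝ) {τ : ℂ} (hτ : 0 < τ.im) :
    GG (a + 1) b τ = -ee (-b / 2) * GG a b τ := by
  rw [GG, GG]
  push_cast
  rw [show ((a : ℂ) + 1) * τ + b = (a * τ + b) + τ by ring, th_add_tau hτ,
    show ((a : ℂ) + 1) * ((a * τ + b) + τ) / 2 =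
      -b / 2 + a * (a * τ + b) / 2 - (-(a * τ + b) - τ / 2) by ring, ee_sub _ (_ - _), ee_add]
  field_simp [ee_ne_zero]

/-- `p` is the power series expansion of `g` on the open unit disc. -/
def HP (p : PowerSeries ℂ) (g : ℂ → ℂ) : Prop :=
  ∀ x : ℂ, ‖x‖ < 1 → HasSum (fun n => PowerSeries.coeff n p * x ^ n) (g x)

lemma HP.congr {p : PowerSeries ℂ} {g h : ℂ → ℂ} (hg : HP p g) (e : ∀ x, ‖x‖ < 1 → h x = g x) :
    HP p h := fun x hx => by rw [e x hx]; exact hg x hx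

lemma HP.add {p p' : PowerSeries ℂ} {g g' : ℂ → ℂ} (h : HP p g) (h' : HP p' g') :
    HP (p + p') (fun x => g x + g' x) := by
  intro x hx
  have := (h x hx).add (h' x hx)
  simpa [add_mul] using this

lemma HP.mul {p p' : PowerSeries ℂ} {g g' : ℂ → ℂ} (h : HP p g) (h' : HP p' g') :
    HP (p * p') (fun x => g x * g' x) := by
  intro x hx
  have h1 := h x hx
  have h2 := h' x hx
  have e := tsum_mul_tsum_eq_tsum_sum_antidiagonal_of_summable_norm
    h1.summable.norm h2.summable.norm
  have s := (summable_norm_sum_mul_antidiagonal_of_summable_norm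
    h1.summable.norm h2.summable.norm).of_norm
  rw [h1.tsum_eq, h2.tsum_eq] at e
  have key : (fun n => ∑ kl ∈ Finset.HasAntidiagonal.antidiagonal n, PowerSeries.coeff kl.1 p * x ^ kl.1 *
      (PowerSeries.coeff kl.2 p' * x ^ kl.2)) =
      fun n => PowerSeries.coeff n (p * p') * x ^ n := by
    ext n
    rw [PowerSeries.coeff_mul, Finset.sum_mul]
    refine Finset.sum_congr rfl ?_
    intro kl hkl
    rw [← Finset.HasAntidiagonal.mem_antidiagonal.mp hkl, pow_add]; ring
  rw [key] at e s
  show HasSum _ (g x * g' x)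
  rw [e]; exact s.hasSum

lemma HP.C (a : ℂ) : HP (PowerSeries.C a) (fun _ => a) := by
  intro x _
  have := hasSum_single (f := fun n => PowerSeries.coeff n (PowerSeries.C a) * x ^ n) 0
    (fun n hn => by simp [PowerSeries.coeff_C, hn])
  simpa using this

lemma HP.X : HP PowerSeries.X (fun x => x) := by
  intro x _
  have := hasSum_single (f := fun n => PowerSeries.coeff n (PowerSeries.X : PowerSeries ℂ) * x ^ n) 1
    (fun n hn => by simp [PowerSeries.coeff_X, hn])
  simpa using this

lemma HP.one : HP 1 (fun _ => 1) := by simpa using HP.C 1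

lemma HP.pow {p : PowerSeries ℂ} {g : ℂ → ℂ} (h : HP p g) (n : ℕ) :
    HP (p ^ n) (fun x => g x ^ n) := by
  induction n with
  | zero => simpa using HP.one
  | succ n ih => simpa [pow_succ] using ih.mul h

lemma HP.neg {p : PowerSeries ℂ} {g : ℂ → ℂ} (h : HP p g) : HP (-p) (fun x => -g x) := by
  have := (HP.C (-1)).mul h
  simpa using this

lemma HP.sub {p p' : PowerSeries ℂ} {g g' : ℂ → ℂ} (h : HP p g) (h' : HP p' g') :
    HP (p - p') (fun x => g x - g' x) := by
  simpa [sub_eq_add_neg] using h.add h'.neg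

lemma HP.prod {ι : Type*} (s : Finset ι) {p : ι → PowerSeries ℂ} {g : ι → ℂ → ℂ}
    (h : ∀ i ∈ s, HP (p i) (g i)) : HP (∏ i ∈ s, p i) (fun x => ∏ i ∈ s, g i x) := by
  classical
  induction s using Finset.induction_on with
  | empty => simpa using HP.one
  | insert a s ha ih =>
    simp only [Finset.prod_insert ha]
    exact (h a (Finset.mem_insert_self _ _)).mul
      (ih fun i hi => h i (Finset.mem_insert_of_mem hi))

lemma HP.sum {ι : Type*} (s : Finset ι) {p : ι → PowerSeries ℂ} {g : ι → ℂ → ℂ}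
    (h : ∀ i ∈ s, HP (p i) (g i)) : HP (∑ i ∈ s, p i) (fun x => ∑ i ∈ s, g i x) := by
  classical
  induction s using Finset.induction_on with
  | empty => simpa using HP.C 0
  | insert a s ha ih =>
    simp only [Finset.sum_insert ha]
    exact (h a (Finset.mem_insert_self _ _)).add
      (ih fun i hi => h i (Finset.mem_insert_of_mem hi))

lemma HP.apply_zero {p : PowerSeries ℂ} {g : ℂ → ℂ} (h : HP p g) :
    g 0 = PowerSeries.constantCoeff p := by
  have h1 := h 0 (by simp)
  have h2 := hasSum_single (f := fun n => PowerSeries.coeff n p * (0 : ℂ) ^ n) 0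
    (fun n hn => by simp [hn])
  have := h1.unique h2
  simpa using this

lemma HP.differentiableOn {p : PowerSeries ℂ} {g : ℂ → ℂ} (h : HP p g) :
    DifferentiableOn ℂ g (Metric.ball 0 1) := by
  intro x hx
  rw [mem_ball_zero_iff] at hx
  obtain ⟨r, hr1, hr2⟩ := exists_between hx
  have hr0 : 0 < r := (norm_nonneg x).trans_lt hr1
  have hs : Summable fun n => ‖PowerSeries.coeff n p‖ * r ^ n := by
    have := (h (r : ℂ) (by simpa [abs_of_pos hr0] using hr2)).summable.norm
    simpa [abs_of_pos hr0] using this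
  have hd : DifferentiableOn ℂ (fun w => ∑' n, PowerSeries.coeff n p * w ^ n)
      (Metric.ball 0 r) := by
    refine Complex.differentiableOn_tsum_of_summable_norm hs (fun n => by fun_prop)
      Metric.isOpen_ball ?_
    intro n w hw
    rw [mem_ball_zero_iff] at hw
    rw [norm_mul, norm_pow]
    gcongr
  have hd2 : DifferentiableOn ℂ g (Metric.ball 0 r) := by
    refine hd.congr ?_
    intro w hw
    rw [mem_ball_zero_iff] at hw
    exact ((h w (hw.trans hr2)).tsum_eq).symm
  exact (hd2.differentiableAt (Metric.isOpen_ball.mem_nhds (by simpa using hr1))).differentiableWithinAt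

lemma HP.hasFPowerSeriesAt {p : PowerSeries ℂ} {g : ℂ → ℂ} (h : HP p g) :
    HasFPowerSeriesAt g (FormalMultilinearSeries.ofScalars ℂ (fun n => PowerSeries.coeff n p)) 0 := by
  rw [hasFPowerSeriesAt_iff]
  filter_upwards [Metric.ball_mem_nhds (0 : ℂ) one_pos] with x hx
  rw [mem_ball_zero_iff] at hx
  have := h x hx
  simpa [FormalMultilinearSeries.coeff_ofScalars, mul_comm] using this

lemma HP.unique_punctured {p p' : PowerSeries ℂ} {g g' : ℂ → ℂ} (h : HP p g) (h' : HP p' g')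
    (e : ∀ x, x ≠ 0 → ‖x‖ < 1 → g x = g' x) : p = p' := by
  have e1 : ∀ᶠ x in 𝓝[≠] (0 : ℂ), g x = g' x := by
    filter_upwards [self_mem_nhdsWithin,
      mem_nhdsWithin_of_mem_nhds (Metric.ball_mem_nhds (0 : ℂ) one_pos)] with x hx hx2
    exact e x hx (by simpa using hx2)
  have a1 := h.hasFPowerSeriesAt
  have a2 := h'.hasFPowerSeriesAt
  have e2 : g =ᶠ[𝓝 0] g' :=
    (a1.continuousAt.eventuallyEq_nhds_iff_eventuallyEq_nhdsNE a2.continuousAt).mp e1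
  have e3 := HasFPowerSeriesAt.eq_formalMultilinearSeries_of_eventually a1 a2 e2
  ext n
  have := congrArg (fun q => FormalMultilinearSeries.coeff q n) e3
  simpa [FormalMultilinearSeries.coeff_ofScalars] using this

lemma HP.unique {p p' : PowerSeries ℂ} {g : ℂ → ℂ} (h : HP p g) (h' : HP p' g) : p = p' :=
  h.unique_punctured h' (fun _ _ _ => rfl)

lemma HP.exists_of_differentiableOn {g : ℂ → ℂ} (h : DifferentiableOn ℂ g (Metric.ball 0 1)) :
    ∃ p, HP p g := by
  have key : ∀ r : NNReal, 0 < r → r < 1 → HasFPowerSeriesOnBall g (cauchyPowerSeries g 0 r) 0 r := by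
    intro r h0 h1
    refine DifferentiableOn.hasFPowerSeriesOnBall ?_ h0
    exact h.mono (Metric.closedBall_subset_ball (by exact_mod_cast h1))
  have h12 : (0 : NNReal) < 1 / 2 := by norm_num
  have h12' : (1 / 2 : NNReal) < 1 := by
    rw [← NNReal.coe_lt_coe]; norm_num
  refine ⟨PowerSeries.mk fun n => (cauchyPowerSeries g 0 (1 / 2 : NNReal)).coeff n, ?_⟩
  intro x hx
  obtain ⟨r, hr1, hr2⟩ := exists_between hx
  have hr0 : 0 < r := (norm_nonneg x).trans_lt hr1
  have k := key r.toNNReal (by simpa using hr0) (by simpa using hr2)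
  have e := HasFPowerSeriesAt.eq_formalMultilinearSeries k.hasFPowerSeriesAt
    (key _ h12 h12').hasFPowerSeriesAt
  rw [e] at k
  have := k.hasSum (y := x) (by
    rw [Metric.mem_eball, edist_zero_right, enorm_eq_nnnorm]
    rw [ENNReal.coe_lt_coe, ← NNReal.coe_lt_coe, Real.coe_toNNReal _ hr0.le]
    exact hr1)
  simpa [FormalMultilinearSeries.apply_eq_pow_smul_coeff, mul_comm] using this

lemma HP.inv {p : PowerSeries ℂ} {g : ℂ → ℂ} (h : HP p g) (h0 : ∀ x, ‖x‖ < 1 → g x ≠ 0) :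
    HP p⁻¹ (fun x => (g x)⁻¹) := by
  obtain ⟨p', hp'⟩ := HP.exists_of_differentiableOn (g := fun x => (g x)⁻¹)
    (h.differentiableOn.fun_inv (fun x hx => h0 x (by simpa using hx)))
  have h1 : p * p' = 1 := by
    refine (h.mul hp').unique ((HP.one).congr ?_)
    intro x hx
    exact mul_inv_cancel₀ (h0 x hx)
  have hc : PowerSeries.constantCoeff p ≠ 0 := by
    rw [← h.apply_zero]; exact h0 0 (by simp)
  have h2 : p' = p⁻¹ := (PowerSeries.eq_inv_iff_mul_eq_one hc).mpr (by rw [mul_comm]; exact h1)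
  rw [← h2]
  exact hp'

lemma HP.of_X_pow_mul {p : PowerSeries ℂ} {g : ℂ → ℂ} (n : ℕ) (h : HP (PowerSeries.X ^ n * p) g) :
    ∃ g1, HP p g1 ∧ ∀ x, ‖x‖ < 1 → g x = x ^ n * g1 x := by
  have hs : ∀ x : ℂ, ‖x‖ < 1 → Summable fun k => PowerSeries.coeff k p * x ^ k := by
    intro x hx
    by_cases hx0 : x = 0
    · subst hx0
      exact (hasSum_single 0 (fun k hk => by simp [hk])).summable
    · have := (h x hx).summable
      rw [← summable_nat_add_iff n] at this
      have h2 := this.mul_left (x ^ n)⁻¹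
      refine h2.congr ?_
      intro k
      rw [add_comm k n, PowerSeries.coeff_X_pow_mul', if_pos (by omega), add_tsub_cancel_left, pow_add]
      field_simp
  have h1 : HP p (fun x => ∑' k, PowerSeries.coeff k p * x ^ k) := fun x hx => (hs x hx).hasSum
  refine ⟨_, h1, ?_⟩
  intro x hx
  exact (h x hx).unique ((((HP.X).pow n).mul h1) x hx)

lemma HP.coeff_eq_zero_of_bound {p : PowerSeries ℂ} {g : ℂ → ℂ} (h : HP p g) {K : ℕ} {C r : ℝ}
    (hr : 0 < r) (hb : ∀ x : ℂ, x ≠ 0 → ‖x‖ < r → ‖g x‖ ≤ C * ‖x‖ ^ K) :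
    ∀ n < K, PowerSeries.coeff n p = 0 := by
  intro n
  induction n using Nat.strong_induction_on with
  | _ n ih =>
  intro hn
  have hd : PowerSeries.X ^ n ∣ p := by
    rw [PowerSeries.X_pow_dvd_iff]
    intro m hm; exact ih m hm (hm.trans hn)
  obtain ⟨p1, rfl⟩ := hd
  obtain ⟨g1, h1, e⟩ := h.of_X_pow_mul n
  rw [PowerSeries.coeff_X_pow_mul', if_pos le_rfl, tsub_self,
    PowerSeries.coeff_zero_eq_constantCoeff_apply, ← h1.apply_zero]
  have hc : ContinuousAt g1 0 := h1.hasFPowerSeriesAt.continuousAt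
  have t1 : Tendsto g1 (𝓝[≠] 0) (𝓝 (g1 0)) := hc.tendsto.mono_left nhdsWithin_le_nhds
  have t2 : Tendsto g1 (𝓝[≠] 0) (𝓝 0) := by
    refine squeeze_zero_norm' (a := fun x : ℂ => C * ‖x‖ ^ (K - n)) ?_ ?_
    · filter_upwards [self_mem_nhdsWithin,
        mem_nhdsWithin_of_mem_nhds (Metric.ball_mem_nhds (0 : ℂ) one_pos),
        mem_nhdsWithin_of_mem_nhds (Metric.ball_mem_nhds (0 : ℂ) hr)] with x hx hx2 hx3
      rw [mem_ball_zero_iff] at hx2 hx3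
      have hx' : x ≠ 0 := hx
      have hb' := hb x hx' hx3
      rw [e x hx2, norm_mul, norm_pow] at hb'
      have hpos : 0 < ‖x‖ ^ n := by positivity
      rw [show K = n + (K - n) by omega, pow_add] at hb'
      have : ‖x‖ ^ n * ‖g1 x‖ ≤ ‖x‖ ^ n * (C * ‖x‖ ^ (K - n)) := by
        calc _ ≤ _ := hb'
          _ = _ := by ring
      exact le_of_mul_le_mul_left this hpos
    · have : Tendsto (fun x : ℂ => C * ‖x‖ ^ (K - n)) (𝓝 0) (𝓝 (C * ‖(0 : ℂ)‖ ^ (K - n))) := by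
        apply Continuous.tendsto; fun_prop
      rw [norm_zero, zero_pow (by omega), mul_zero] at this
      exact this.mono_left nhdsWithin_le_nhds
  exact tendsto_nhds_unique t1 t2

lemma HP.expand {p : PowerSeries ℂ} {g : ℂ → ℂ} (h : HP p g) {N : ℕ} (hN : N ≠ 0) :
    HP (PowerSeries.expand N hN p) (fun x => g (x ^ N)) := by
  intro x hx
  have h1 := h (x ^ N) (by rw [norm_pow]; exact pow_lt_one₀ (norm_nonneg _) hx hN)
  have hinj : Function.Injective (fun n : ℕ => N * n) :=
    fun a b hab => Nat.eq_of_mul_eq_mul_left (Nat.pos_of_ne_zero hN) hab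
  rw [← hinj.hasSum_iff]
  · convert h1 using 2 with n
    simp only [Function.comp]
    rw [PowerSeries.coeff_expand_mul, pow_mul]
  · intro n hn
    rw [PowerSeries.coeff_expand, if_neg, zero_mul]
    rintro ⟨k, rfl⟩
    exact hn ⟨k, rfl⟩

/-- finite products `∏_{1 ≤ m ≤ K} (1 - c_m X^m)`. -/
def Pq (c : ℕ → ℂ) (K : ℕ) : PowerSeries ℂ :=
  ∏ m ∈ Finset.range K, (1 - PowerSeries.C (c (m + 1)) * PowerSeries.X ^ (m + 1))

/-- the infinite product `∏_{1 ≤ m} (1 - c_m X^m)`, formally. -/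
def Ep (c : ℕ → ℂ) : PowerSeries ℂ := PowerSeries.mk fun n => PowerSeries.coeff n (Pq c n)

/-- the infinite product `∏_{1 ≤ m} (1 - c_m x^m)`, analytically. -/
def EE (c : ℕ → ℂ) (x : ℂ) : ℂ := ∏' n : ℕ, (1 - c (n + 1) * x ^ (n + 1))

lemma Pq_succ (c : ℕ → ℂ) (K : ℕ) :
    Pq c (K + 1) = Pq c K * (1 - PowerSeries.C (c (K + 1)) * PowerSeries.X ^ (K + 1)) := by
  rw [Pq, Finset.prod_range_succ, Pq]

lemma coeff_Pq (c : ℕ → ℂ) {n K : ℕ} (h : n ≤ K) :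
    PowerSeries.coeff n (Pq c K) = PowerSeries.coeff n (Ep c) := by
  induction K, h using Nat.le_induction with
  | base => simp [Ep]
  | succ K hK ih =>
    rw [Pq_succ, mul_sub, mul_one, map_sub, ih, ← mul_assoc, PowerSeries.coeff_mul_X_pow',
      if_neg (by omega), sub_zero]

lemma constantCoeff_Ep (c : ℕ → ℂ) : PowerSeries.constantCoeff (Ep c) = 1 := by
  rw [← PowerSeries.coeff_zero_eq_constantCoeff_apply, ← coeff_Pq c le_rfl]
  simp [Pq]

lemma summable_EE {c : ℕ → ℂ} (hc : ∀ m, ‖c m‖ ≤ 1) {x : ℂ} (hx : ‖x‖ < 1) :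
    Summable fun n : ℕ => ‖-(c (n + 1) * x ^ (n + 1))‖ := by
  refine Summable.of_nonneg_of_le (fun n => norm_nonneg _) (fun n => ?_)
    ((summable_nat_add_iff 1).mpr (summable_geometric_of_lt_one (norm_nonneg x) hx))
  rw [norm_neg, norm_mul, norm_pow]
  calc _ ≤ 1 * ‖x‖ ^ (n + 1) := by gcongr; exact hc _
    _ = _ := one_mul _

lemma multipliable_EE {c : ℕ → ℂ} (hc : ∀ m, ‖c m‖ ≤ 1) {x : ℂ} (hx : ‖x‖ < 1) :
    Multipliable fun n : ℕ => (1 - c (n + 1) * x ^ (n + 1)) := by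
  have := multipliable_one_add_of_summable (summable_EE hc hx)
  simpa [sub_eq_add_neg] using this

lemma EE_ne_zero {c : ℕ → ℂ} (hc : ∀ m, ‖c m‖ ≤ 1) {x : ℂ} (hx : ‖x‖ < 1) : EE c x ≠ 0 := by
  have := tprod_one_add_ne_zero_of_summable (f := fun n : ℕ => -(c (n + 1) * x ^ (n + 1)))
    (fun n => by
      rw [← sub_eq_add_neg, sub_ne_zero]
      intro h
      have h2 : ‖c (n + 1) * x ^ (n + 1)‖ < 1 := by
        rw [norm_mul, norm_pow]
        calc _ ≤ 1 * ‖x‖ ^ (n + 1) := by gcongr; exact hc _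
          _ < 1 := by rw [one_mul]; exact pow_lt_one₀ (norm_nonneg _) hx (by omega)
      rw [← h] at h2; simp at h2) (summable_EE hc hx)
  simpa [EE, sub_eq_add_neg] using this

lemma EE_differentiableOn {c : ℕ → ℂ} (hc : ∀ m, ‖c m‖ ≤ 1) :
    DifferentiableOn ℂ (EE c) (Metric.ball 0 1) := by
  have := diffOn_tprod (U := Metric.ball (0 : ℂ) 1) Metric.isOpen_ball
    (f := fun n x => -(c (n + 1) * x ^ (n + 1))) (fun n => by fun_prop) (by
      intro K hKU hK
      rcases K.eq_empty_or_nonempty with hN | hN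
      · exact ⟨fun _ => 0, summable_zero, by simp [hN]⟩
      obtain ⟨q₀, hq₀, _, HB⟩ := hK.exists_sSup_image_eq_and_ge hN
        (show ContinuousOn (fun q : ℂ ↦ ‖q‖) K by fun_prop)
      refine ⟨fun n => ‖q₀‖ ^ (n + 1), (summable_nat_add_iff 1).mpr
        (summable_geometric_of_lt_one (norm_nonneg _) (by simpa using hKU hq₀)), ?_⟩
      intro n x hx
      rw [norm_neg, norm_mul, norm_pow]
      calc _ ≤ 1 * ‖q₀‖ ^ (n + 1) := by
            gcongr
            · exact hc _
            · exact HB x hx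
        _ = _ := one_mul _)
  refine this.congr ?_
  intro x _
  simp [EE, sub_eq_add_neg]

/-- drop the first `K` factors. -/
def tailc (K : ℕ) (c : ℕ → ℂ) : ℕ → ℂ := fun m => if m ≤ K then 0 else c m

lemma tailc_norm {c : ℕ → ℂ} (hc : ∀ m, ‖c m‖ ≤ 1) (K : ℕ) : ∀ m, ‖tailc K c m‖ ≤ 1 := by
  intro m; rw [tailc]; split_ifs
  · simp
  · exact hc m

lemma EE_split {c : ℕ → ℂ} (hc : ∀ m, ‖c m‖ ≤ 1) (K : ℕ) {x : ℂ} (hx : ‖x‖ < 1) :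
    EE c x = (∏ m ∈ Finset.range K, (1 - c (m + 1) * x ^ (m + 1))) * EE (tailc K c) x := by
  have h1 : ∀ c : ℕ → ℂ, (∀ m, ‖c m‖ ≤ 1) → EE c x =
      (∏ m ∈ Finset.range K, (1 - c (m + 1) * x ^ (m + 1))) *
        ∏' n : ℕ, (1 - c (n + K + 1) * x ^ (n + K + 1)) := by
    intro c hc
    have hm : Multipliable fun n : ℕ => (1 - c (n + K + 1) * x ^ (n + K + 1)) := by
      have hs := (summable_nat_add_iff K).mpr (summable_EE hc hx)
      have := multipliable_one_add_of_summable hs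
      simpa [sub_eq_add_neg] using this
    exact (Multipliable.prod_mul_tprod_nat_mul' (f := fun n : ℕ => (1 - c (n + 1) * x ^ (n + 1)))
      (k := K) hm).symm
  rw [h1 c hc, h1 _ (tailc_norm hc K)]
  congr 1
  rw [Finset.prod_eq_one, one_mul]
  · congr 1; ext n
    rw [tailc, if_neg (by omega)]
  · intro m hm
    rw [tailc, if_pos (by simpa using hm)]; simp

lemma EE_tail_bound {c : ℕ → ℂ} (hc : ∀ m, ‖c m‖ ≤ 1) (K : ℕ) {x : ℂ} (hx : ‖x‖ < 1 / 2) :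
    ‖EE (tailc K c) x - 1‖ ≤ 4 * ‖x‖ ^ (K + 1) := by
  have hx1 : ‖x‖ < 1 := by linarith
  have ht := tailc_norm hc K
  have hs := summable_EE ht hx1
  have hm := multipliable_one_add_of_summable hs
  have hsum : ∑' n : ℕ, ‖-(tailc K c (n + 1) * x ^ (n + 1))‖ ≤ 2 * ‖x‖ ^ (K + 1) := by
    have hg : HasSum (fun n : ℕ => ‖x‖ ^ n * ‖x‖ ^ (K + 1)) ((1 - ‖x‖)⁻¹ * ‖x‖ ^ (K + 1)) :=
      (hasSum_geometric_of_lt_one (norm_nonneg x) hx1).mul_right _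
    have h2 : (1 - ‖x‖)⁻¹ ≤ 2 := by
      rw [inv_le_comm₀ (by linarith) (by norm_num)]; linarith
    rw [← hs.sum_add_tsum_nat_add K, Finset.sum_eq_zero, zero_add]
    · calc _ ≤ ∑' n : ℕ, ‖x‖ ^ n * ‖x‖ ^ (K + 1) := by
            refine ((summable_nat_add_iff K).mpr hs).tsum_le_tsum (fun n => ?_) hg.summable
            rw [norm_neg, norm_mul, norm_pow, ← pow_add, add_assoc]
            calc _ ≤ 1 * ‖x‖ ^ (n + (K + 1)) := by gcongr; exact ht _
              _ = _ := one_mul _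
        _ = (1 - ‖x‖)⁻¹ * ‖x‖ ^ (K + 1) := hg.tsum_eq
        _ ≤ _ := by gcongr
    · intro m hm
      rw [tailc, if_pos (by simpa using hm)]; simp
  have hle : ‖EE (tailc K c) x - 1‖ ≤
      Real.exp (∑' n : ℕ, ‖-(tailc K c (n + 1) * x ^ (n + 1))‖) - 1 := by
    have ht1 := (hm.hasProd.sub_const 1).norm
    have hE : EE (tailc K c) x = ∏' i : ℕ, (1 + -(tailc K c (i + 1) * x ^ (i + 1))) := by
      simp [EE, sub_eq_add_neg]
    rw [hE]
    refine le_of_tendsto ht1 (.of_forall fun s => ?_)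
    refine (Finset.norm_prod_one_add_sub_one_le s _).trans ?_
    gcongr
    exact hs.sum_le_tsum s (fun _ _ => norm_nonneg _)
  set S := ∑' n : ℕ, ‖-(tailc K c (n + 1) * x ^ (n + 1))‖ with hS
  have hS0 : 0 ≤ S := tsum_nonneg fun _ => norm_nonneg _
  have hS1 : S ≤ 1 := by
    refine hsum.trans ?_
    have : ‖x‖ ^ (K + 1) ≤ ‖x‖ ^ 1 :=
      pow_le_pow_of_le_one (norm_nonneg _) hx1.le (by omega)
    rw [pow_one] at this
    linarith
  have := Real.abs_exp_sub_one_le (x := S) (by rwa [abs_of_nonneg hS0])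
  rw [abs_of_nonneg hS0] at this
  have := (le_abs_self _).trans this
  linarith

lemma HP_Pq (c : ℕ → ℂ) (K : ℕ) :
    HP (Pq c K) (fun x => ∏ m ∈ Finset.range K, (1 - c (m + 1) * x ^ (m + 1))) := by
  apply HP.prod
  intro m _
  exact (HP.one).sub ((HP.C _).mul ((HP.X).pow _))

lemma HP_Ep {c : ℕ → ℂ} (hc : ∀ m, ‖c m‖ ≤ 1) : HP (Ep c) (EE c) := by
  obtain ⟨p, hp⟩ := HP.exists_of_differentiableOn (EE_differentiableOn hc)
  have : p = Ep c := by
    ext n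
    obtain ⟨p', hp'⟩ := HP.exists_of_differentiableOn (EE_differentiableOn (tailc_norm hc n))
    have e : p = Pq c n * p' := by
      refine (hp.congr ?_).unique ((HP_Pq c n).mul hp')
      intro x hx
      exact (EE_split hc n hx).symm
    have h1 : ∀ k < n + 1, PowerSeries.coeff k (p' - 1) = 0 := by
      refine (hp'.sub HP.one).coeff_eq_zero_of_bound (C := 4) (r := 1 / 2) (by norm_num) ?_
      intro x _ hx
      exact EE_tail_bound hc n hx
    obtain ⟨r, hr⟩ := PowerSeries.X_pow_dvd_iff.mpr h1
    have hr' : p' = 1 + PowerSeries.X ^ (n + 1) * r := by rw [← hr]; ring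
    rw [e, hr', mul_add, mul_one, map_add, coeff_Pq c le_rfl, mul_left_comm,
      PowerSeries.coeff_X_pow_mul', if_neg (by omega), add_zero]
  rw [← this]; exact hp

/-- Euler operator. -/
def thd (p : PowerSeries ℂ) : PowerSeries ℂ := PowerSeries.X * PowerSeries.derivative ℂ p

lemma coeff_thd (p : PowerSeries ℂ) (n : ℕ) :
    PowerSeries.coeff n (thd p) = n * PowerSeries.coeff n p := by
  cases n with
  | zero => simp [thd]
  | succ n =>
    rw [thd, PowerSeries.coeff_succ_X_mul, PowerSeries.coeff_derivative]; push_cast; ring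

lemma thd_mul (p q : PowerSeries ℂ) : thd (p * q) = thd p * q + p * thd q := by
  simp only [thd, Derivation.leibniz, smul_eq_mul]; ring

/-- The logarithmic derivative of `Ep c`, up to sign. -/
def Lc (c : ℕ → ℂ) : PowerSeries ℂ :=
  PowerSeries.mk fun M => ∑ m ∈ M.divisors, (m : ℂ) * c m ^ (M / m)

/-- The log derivative of a single factor. -/
def Lone (m : ℕ) (a : ℂ) : PowerSeries ℂ :=
  PowerSeries.mk fun n => if m ∣ n ∧ n ≠ 0 then (m : ℂ) * a ^ (n / m) else 0

lemma Lone_spec {m : ℕ} (hm : m ≠ 0) (a : ℂ) :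
    thd (1 - PowerSeries.C a * PowerSeries.X ^ m) =
      -((1 - PowerSeries.C a * PowerSeries.X ^ m) * Lone m a) := by
  ext n
  rw [coeff_thd, sub_mul, one_mul, map_neg, map_sub, map_sub, mul_assoc, PowerSeries.coeff_C_mul,
    PowerSeries.coeff_C_mul, PowerSeries.coeff_X_pow_mul', PowerSeries.coeff_X_pow, Lone,
    PowerSeries.coeff_mk, PowerSeries.coeff_mk, PowerSeries.coeff_one]
  by_cases h0 : n = 0
  · subst h0; simp [hm]
  by_cases hd : m ∣ n
  · obtain ⟨k, rfl⟩ := hd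
    have hk : k ≠ 0 := by rintro rfl; simp at h0
    obtain ⟨j, rfl⟩ : ∃ j, k = j + 1 := ⟨k - 1, by omega⟩
    have hle : m ≤ m * (j + 1) := Nat.le_mul_of_pos_right m (by omega)
    have hd1 : m ∣ m * (j + 1) ∧ m * (j + 1) ≠ 0 := ⟨dvd_mul_right _ _, h0⟩
    have e1 : m * (j + 1) - m = m * j := by rw [mul_add, mul_one]; omega
    rw [if_neg h0, if_pos hd1, if_pos hle, Nat.mul_div_cancel_left _ (Nat.pos_of_ne_zero hm), e1]
    by_cases hj : j = 0
    · subst hj; simp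
    · have h2 : m * j ≠ 0 := mul_ne_zero hm hj
      have h3 : ¬ (m * (j + 1) = m) := by rw [mul_add]; omega
      have hd2 : m ∣ m * j ∧ m * j ≠ 0 := ⟨dvd_mul_right _ _, h2⟩
      rw [if_neg h3, if_pos hd2, Nat.mul_div_cancel_left _ (Nat.pos_of_ne_zero hm)]
      ring
  · have h3 : ¬ n = m := by rintro rfl; simp at hd
    rw [if_neg h0, if_neg h3, if_neg (fun h => hd h.1)]
    by_cases hle : m ≤ n
    · rw [if_pos hle, if_neg]
      · ring
      · rintro ⟨h, _⟩
        exact hd ((Nat.dvd_sub_iff_left hle dvd_rfl).mp h)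
    · rw [if_neg hle]; ring

lemma thd_Pq (c : ℕ → ℂ) (K : ℕ) :
    thd (Pq c K) = -(Pq c K * ∑ m ∈ Finset.range K, Lone (m + 1) (c (m + 1))) := by
  induction K with
  | zero =>
    ext n; rw [coeff_thd]; simp [Pq, PowerSeries.coeff_one]
  | succ K ih =>
    rw [Pq_succ, thd_mul, ih, Lone_spec (by omega), Finset.sum_range_succ]; ring

lemma coeff_sum_Lone (c : ℕ → ℂ) {n K : ℕ} (h : n ≤ K) :
    PowerSeries.coeff n (∑ m ∈ Finset.range K, Lone (m + 1) (c (m + 1))) =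
      PowerSeries.coeff n (Lc c) := by
  rw [map_sum, Lc, PowerSeries.coeff_mk]
  simp only [Lone, PowerSeries.coeff_mk]
  by_cases h0 : n = 0
  · subst h0; simp
  have : ∑ x ∈ Finset.range K, (if x + 1 ∣ n ∧ n ≠ 0 then
      (((x + 1 : ℕ) : ℂ)) * c (x + 1) ^ (n / (x + 1)) else 0) =
      ∑ x ∈ Finset.Ico 1 (K + 1), if x ∣ n ∧ n ≠ 0 then ((x : ℂ)) * c x ^ (n / x) else 0 := by
    rw [Finset.sum_Ico_eq_sum_range]
    simp [add_comm]
  rw [this, ← Finset.sum_filter]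
  refine Finset.sum_congr ?_ (fun _ _ => rfl)
  ext m
  simp only [Finset.mem_filter, Finset.mem_Ico, Nat.mem_divisors]
  constructor
  · rintro ⟨_, h⟩; exact h
  · rintro ⟨h1, h2⟩
    exact ⟨⟨Nat.pos_of_dvd_of_pos h1 (Nat.pos_of_ne_zero h2),
      by have := Nat.le_of_dvd (Nat.pos_of_ne_zero h2) h1; omega⟩, h1, h2⟩

lemma thd_Ep (c : ℕ → ℂ) : thd (Ep c) = -(Ep c * Lc c) := by
  ext n
  have h := congrArg (PowerSeries.coeff n) (thd_Pq c n)
  rw [coeff_thd, coeff_Pq c le_rfl] at h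
  rw [coeff_thd, h, map_neg, map_neg, PowerSeries.coeff_mul, PowerSeries.coeff_mul]
  congr 1
  refine Finset.sum_congr rfl ?_
  intro kl hkl
  have := Finset.HasAntidiagonal.mem_antidiagonal.mp hkl
  rw [coeff_Pq c (by omega), coeff_sum_Lone c (by omega)]

lemma GG_S' (a b : ℝ) (z : ℍ) :
    GG a b ((ModularGroup.S • z : ℍ) : ℂ) = -Complex.I * GG b (-a) z := by
  have h := GG_S a b z.2
  have e : ((ModularGroup.S • z : ℍ) : ℂ) = -1 / (z : ℂ) := by
    rw [UpperHalfPlane.modular_S_smul]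
    show (-(z : ℂ))⁻¹ = _
    rw [inv_neg, neg_div, one_div]
  rw [e]; exact h

lemma GG_T' (a b : ℝ) (z : ℍ) :
    GG a b ((ModularGroup.T • z : ℍ) : ℂ) = ee (1 / 12) * GG a (a + b) z := by
  have h := GG_T a b z
  have e : ((ModularGroup.T • z : ℍ) : ℂ) = (z : ℂ) + 1 := by
    rw [UpperHalfPlane.modular_T_smul]
    simp [add_comm]
  rw [e]; exact h

/-- the mod 3 part of the character -/
def h3 (a b c d : ZMod 3) : ZMod 3 := (a + d) * c - b * d * (c ^ 2 - 1)

/-- the mod 4 part of the character -/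
def h4 (a b c d : ZMod 4) : ZMod 4 :=
  if c = 1 ∨ c = 3 then (a + d) * c - 3 * c
  else (a + d) * c - b * d * (c ^ 2 - 1) + 3 * d - 3 - 3 * c * d

lemma h3_S : ∀ a b c d : ZMod 3, a * d - b * c = 1 → h3 b (-a) d (-c) = h3 a b c d := by
  unfold h3; decide

lemma h3_T : ∀ a b c d : ZMod 3, a * d - b * c = 1 → h3 a (a + b) c (c + d) = h3 a b c d + 1 := by
  unfold h3; decide

lemma h4_S : ∀ a b c d : ZMod 4, a * d - b * c = 1 → h4 b (-a) d (-c) = h4 a b c d + 1 := by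
  unfold h4; decide

lemma h4_T : ∀ a b c d : ZMod 4, a * d - b * c = 1 → h4 a (a + b) c (c + d) = h4 a b c d + 1 := by
  unfold h4; decide

/-- The character of the Siegel functions. -/
def chi (A : SL(2, ℤ)) : ℂ :=
  ee (1 / 3) ^ (h3 (A 0 0 : ℤ) (A 0 1 : ℤ) (A 1 0 : ℤ) (A 1 1 : ℤ)).val *
    ee (-1 / 4) ^ (h4 (A 0 0 : ℤ) (A 0 1 : ℤ) (A 1 0 : ℤ) (A 1 1 : ℤ)).val

lemma pow_val_add_one {n : ℕ} [NeZero n] (ω : ℂ) (h : ω ^ n = 1) (x : ZMod n) :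
    ω ^ (x + 1).val = ω ^ x.val * ω := by
  have : (x + 1).val ≡ x.val + 1 [MOD n] := by
    rw [← ZMod.natCast_eq_natCast_iff]
    simp
  rw [pow_eq_pow_of_modEq this h, pow_succ]

lemma ee_third_pow : ee (1 / 3) ^ 3 = 1 := by
  rw [← ee_nat_mul]; norm_num [ee_one]

lemma ee_quarter_pow : ee (-1 / 4) ^ 4 = 1 := by
  rw [← ee_nat_mul]; norm_num [ee_neg, ee_one]

lemma ee_quarter : ee (-1 / 4) = -Complex.I := by
  rw [ee, show 2 * (π : ℂ) * Complex.I * (-1 / 4) = -(π / 2 * Complex.I) by ring, Complex.exp_neg,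
    Complex.exp_pi_div_two_mul_I, Complex.inv_I]

lemma SL_det (A : SL(2, ℤ)) : A 0 0 * A 1 1 - A 0 1 * A 1 0 = 1 := by
  have := A.det_coe
  rwa [Matrix.det_fin_two] at this

lemma SL_det_zmod (n : ℕ) (A : SL(2, ℤ)) :
    (A 0 0 : ZMod n) * (A 1 1 : ℤ) - (A 0 1 : ℤ) * (A 1 0 : ℤ) = 1 := by
  have := congrArg (fun t : ℤ => (t : ZMod n)) (SL_det A)
  simpa using this

lemma mulS_entries (A : SL(2, ℤ)) (i : Fin 2) :
    (A * ModularGroup.S) i 0 = A i 1 ∧ (A * ModularGroup.S) i 1 = -A i 0 := by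
  rw [Matrix.SpecialLinearGroup.coe_mul, ModularGroup.coe_S]
  simp [Matrix.mul_apply, Fin.sum_univ_two]

lemma mulT_entries (A : SL(2, ℤ)) (i : Fin 2) :
    (A * ModularGroup.T) i 0 = A i 0 ∧ (A * ModularGroup.T) i 1 = A i 0 + A i 1 := by
  rw [Matrix.SpecialLinearGroup.coe_mul, ModularGroup.coe_T]
  simp [Matrix.mul_apply, Fin.sum_univ_two]

lemma chi_mul_S (A : SL(2, ℤ)) : chi (A * ModularGroup.S) = chi A * -Complex.I := by
  have e : ∀ i, (A * ModularGroup.S) i 0 = A i 1 ∧ (A * ModularGroup.S) i 1 = -A i 0 := by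
    exact mulS_entries A
  rw [chi, chi, (e 0).1, (e 0).2, (e 1).1, (e 1).2]
  push_cast
  rw [h3_S _ _ _ _ (SL_det_zmod 3 A), h4_S _ _ _ _ (SL_det_zmod 4 A),
    pow_val_add_one _ ee_quarter_pow, ee_quarter]
  ring

lemma chi_mul_T (A : SL(2, ℤ)) : chi (A * ModularGroup.T) = chi A * ee (1 / 12) := by
  have e : ∀ i, (A * ModularGroup.T) i 0 = A i 0 ∧ (A * ModularGroup.T) i 1 = A i 0 + A i 1 := by
    exact mulT_entries A
  rw [chi, chi, (e 0).1, (e 0).2, (e 1).1, (e 1).2]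
  push_cast
  rw [h3_T _ _ _ _ (SL_det_zmod 3 A), h4_T _ _ _ _ (SL_det_zmod 4 A),
    pow_val_add_one _ ee_quarter_pow, pow_val_add_one _ ee_third_pow]
  rw [show (1 / 12 : ℂ) = 1 / 3 + -1 / 4 by norm_num, ee_add]
  ring

lemma chi_one : chi 1 = 1 := by
  have e3 : h3 1 0 0 1 = 0 := by decide
  have e4 : h4 1 0 0 1 = 0 := by decide
  simp [chi, e3, e4]

lemma chi_ne_zero (A : SL(2, ℤ)) : chi A ≠ 0 :=
  mul_ne_zero (pow_ne_zero _ (ee_ne_zero _)) (pow_ne_zero _ (ee_ne_zero _))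

lemma ST_induction {P : SL(2, ℤ) → Prop} (h1 : P 1)
    (hS : ∀ A, P (A * ModularGroup.S) ↔ P A)
    (hT : ∀ A, P (A * ModularGroup.T) ↔ P A) (A : SL(2, ℤ)) : P A := by
  have hA : A ∈ Subgroup.closure {ModularGroup.S, ModularGroup.T} := by
    rw [SpecialLinearGroup.SL2Z_generators]; trivial
  induction hA using Subgroup.closure_induction_right with
  | one => exact h1
  | mul_right x _ y hy ih =>
    rcases hy with rfl | rfl
    · exact (hS _).mpr ih
    · exact (hT _).mpr ih
  | mul_inv_cancel x _ y hy ih =>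
    rcases hy with rfl | rfl
    · exact (hS _).mp (by simpa using ih)
    · exact (hT _).mp (by simpa using ih)

/-- The general transformation law of Siegel functions. -/
lemma GG_smul (A : SL(2, ℤ)) : ∀ (a b : ℝ) (z : ℍ), GG a b ((A • z : ℍ) : ℂ) =
    chi A * GG (a * A 0 0 + b * A 1 0) (a * A 0 1 + b * A 1 1) z := by
  induction A using ST_induction with
  | h1 =>
    intro a b z
    simp [chi_one]
  | hS A =>
    have e : ∀ i, (A * ModularGroup.S) i 0 = A i 1 ∧ (A * ModularGroup.S) i 1 = -A i 0 := by
      exact mulS_entries A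
    rw [chi_mul_S, (e 0).1, (e 0).2, (e 1).1, (e 1).2]
    constructor
    · intro h a b z
      have h2 := h a b (ModularGroup.S⁻¹ • z)
      rw [mul_smul, smul_inv_smul, mul_assoc] at h2
      rw [h2]
      congr 1
      have h3 := GG_S' (a * A 0 0 + b * A 1 0) (a * A 0 1 + b * A 1 1) (ModularGroup.S⁻¹ • z)
      rw [smul_inv_smul] at h3
      rw [h3]
      push_cast
      congr 2
      ring
    · intro h a b z
      rw [mul_smul, h, GG_S', ← mul_assoc]
      congr 2
      push_cast; ring
  | hT A =>
    have e : ∀ i, (A * ModularGroup.T) i 0 = A i 0 ∧ (A * ModularGroup.T) i 1 = A i 0 + A i 1 := by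
      exact mulT_entries A
    rw [chi_mul_T, (e 0).1, (e 0).2, (e 1).1, (e 1).2]
    constructor
    · intro h a b z
      have h2 := h a b (ModularGroup.T⁻¹ • z)
      rw [mul_smul, smul_inv_smul, mul_assoc] at h2
      rw [h2]
      congr 1
      have h3 := GG_T' (a * A 0 0 + b * A 1 0) (a * A 0 1 + b * A 1 1) (ModularGroup.T⁻¹ • z)
      rw [smul_inv_smul] at h3
      rw [h3]
      push_cast
      congr 2
      ring
    · intro h a b z
      rw [mul_smul, h, GG_T', ← mul_assoc]
      congr 2
      push_cast; ring

lemma chi_Gamma {A : SL(2, ℤ)} (hA : A ∈ CongruenceSubgroup.Gamma 12) : chi A = 1 := by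
  rw [CongruenceSubgroup.Gamma_mem] at hA
  obtain ⟨h1, h2, h3', h4'⟩ := hA
  have key : ∀ (m : ℕ), m ∣ 12 → ∀ (x : ℤ) (y : ℤ), (x : ZMod 12) = (y : ZMod 12) →
      (x : ZMod m) = (y : ZMod m) := by
    intro m hm x y h
    rw [ZMod.intCast_eq_intCast_iff] at h ⊢
    exact h.of_dvd (by exact_mod_cast hm)
  have e3 : h3 1 0 0 1 = 0 := by decide
  have e4 : h4 1 0 0 1 = 0 := by decide
  have k := fun m (hm : m ∣ 12) => And.intro (key m hm (A 0 0) 1 (by simpa using h1))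
    (And.intro (key m hm (A 0 1) 0 (by simpa using h2))
      (And.intro (key m hm (A 1 0) 0 (by simpa using h3')) (key m hm (A 1 1) 1 (by simpa using h4'))))
  have k3 := k 3 (by norm_num)
  have k4 := k 4 (by norm_num)
  rw [chi, k3.1, k3.2.1, k3.2.2.1, k3.2.2.2, k4.1, k4.2.1, k4.2.2.1, k4.2.2.2]
  simp [e3, e4]

lemma GG_add_int_right (a b : ℝ) (n : ℤ) (τ : ℂ) :
    GG a (b + n) τ = ee (n * ((a - 1) / 2)) * GG a b τ := by
  induction n using Int.induction_on with
  | zero => simp [ee_zero]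
  | succ n ih =>
    have h := GG_add_one_right a (b + (n : ℤ)) τ
    rw [ih] at h
    push_cast at h ⊢
    rw [← add_assoc, h, ← mul_assoc, ← ee_add]
    congr 2; ring
  | pred n ih =>
    have h := GG_add_one_right a (b + ((-(n : ℤ) - 1 : ℤ) : ℝ)) τ
    rw [show b + ((-(n : ℤ) - 1 : ℤ) : ℝ) + 1 = b + ((-(n : ℤ) : ℤ) : ℝ) by push_cast; ring, ih] at h
    have h2 : GG a (b + ((-(n : ℤ) - 1 : ℤ) : ℝ)) τ = ee (-((a - 1) / 2)) *
        (ee (((-(n : ℤ) : ℤ) : ℂ) * ((a - 1) / 2)) * GG a b τ) := by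
      rw [h, ← mul_assoc, ← ee_add]; simp [ee_zero]
    rw [h2, ← mul_assoc, ← ee_add]
    congr 2; push_cast; ring

lemma GG_add_int_left (a b : ℝ) (n : ℤ) {τ : ℂ} (hτ : 0 < τ.im) :
    GG (a + n) b τ = ee (n * ((1 - b) / 2)) * GG a b τ := by
  have h1 : ∀ a, GG (a + 1) b τ = ee ((1 - b) / 2) * GG a b τ := by
    intro a
    rw [GG_add_one_left a b hτ, show ((1 : ℂ) - b) / 2 = 1 / 2 + -b / 2 by ring, ee_add, ee_half]
    ring
  induction n using Int.induction_on with
  | zero => simp [ee_zero]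
  | succ n ih =>
    have h := h1 (a + (n : ℤ))
    rw [ih] at h
    push_cast at h ⊢
    rw [← add_assoc, h, ← mul_assoc, ← ee_add]
    congr 2; ring
  | pred n ih =>
    have h := h1 (a + ((-(n : ℤ) - 1 : ℤ) : ℝ))
    rw [show a + ((-(n : ℤ) - 1 : ℤ) : ℝ) + 1 = a + ((-(n : ℤ) : ℤ) : ℝ) by push_cast; ring, ih] at h
    have h2 : GG (a + ((-(n : ℤ) - 1 : ℤ) : ℝ)) b τ = ee (-((1 - b) / 2)) *
        (ee (((-(n : ℤ) : ℤ) : ℂ) * ((1 - b) / 2)) * GG a b τ) := by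
      rw [h, ← mul_assoc, ← ee_add]; simp [ee_zero]
    rw [h2, ← mul_assoc, ← ee_add]
    congr 2; push_cast; ring

/-- indicator sequence -/
def indc (N r : ℕ) (z : ℂ) : ℕ → ℂ := fun m => if m ≡ r [MOD N] then z else 0

lemma indc_norm (N r : ℕ) {z : ℂ} (hz : ‖z‖ ≤ 1) : ∀ m, ‖indc N r z m‖ ≤ 1 := by
  intro m; rw [indc]; split_ifs
  · exact hz
  · simp

lemma PP_eq_EE {N r : ℕ} (hr : 1 ≤ r) (hrN : r ≤ N) (z x : ℂ) :
    PP (x ^ N) (z * x ^ r) = EE (indc N r z) x := by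
  have hinj : Function.Injective (fun n : ℕ => N * n + r - 1) := by
    intro a b hab
    simp only at hab
    have : N * a = N * b := by omega
    exact Nat.eq_of_mul_eq_mul_left (by omega) this
  have h := hinj.tprod_eq (f := fun n : ℕ => (1 - indc N r z (n + 1) * x ^ (n + 1))) (by
    intro n hn
    rw [Function.mem_mulSupport] at hn
    have h1 : n + 1 ≡ r [MOD N] := by
      by_contra hc
      apply hn
      rw [indc, if_neg hc]; simp
    have h2 : r ≤ n + 1 := by
      by_contra hc
      push Not at hc
      have h3 := (Nat.modEq_iff_dvd' hc.le).mp h1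
      have := Nat.le_of_dvd (by omega) h3
      omega
    obtain ⟨k, hk⟩ := (Nat.modEq_iff_dvd' h2).mp h1.symm
    exact ⟨k, by simp only; omega⟩)
  rw [EE, ← h, PP]
  congr 1
  ext n
  have e1 : N * n + r - 1 + 1 = N * n + r := by omega
  rw [e1, indc, if_pos (by simp [Nat.ModEq]), pow_add, pow_mul]
  ring

/-- leading constant of the Siegel function -/
def kap (N r : ℕ) (t : ℤ) : ℂ :=
  ee ((t / N : ℝ) * ((r / N : ℝ) - 1) / 2) * (if r = 0 then 1 - ee (t / N : ℝ) else 1)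

lemma norm_ee_real (x : ℝ) : ‖ee x‖ = 1 := by
  rw [norm_ee]; simp

/-- product expansion of Siegel functions -/
lemma GG_expansion {N r : ℕ} (hN : r < N) (t : ℤ) {τ : ℂ} (hτ : 0 < τ.im) :
    GG (r / N : ℝ) (t / N : ℝ) τ = kap N r t *
      ee ((((r / N : ℝ) ^ 2 - (r / N : ℝ) + 1 / 6) / 2 : ℝ) * τ) *
      (EE (indc N r (ee (t / N : ℝ))) (ee (τ / N)) *
        EE (indc N (N - r) (ee (-(t / N : ℝ) : ℝ))) (ee (τ / N))) := by
  have hN0 : (N : ℂ) ≠ 0 := by norm_cast; omega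
  have hq := norm_ee_lt_one hτ
  have hqN : ee τ = ee (τ / N) ^ N := by
    rw [← ee_nat_mul]; congr 1; field_simp
  set w : ℂ := ((r / N : ℝ) : ℂ) * τ + (t / N : ℝ) with hw
  have hx : ee w = ee (t / N : ℝ) * ee (τ / N) ^ r := by
    rw [← ee_nat_mul, ← ee_add, hw]; congr 1; push_cast; field_simp; ring
  have hx2 : ee τ * ee (-w) = ee (-(t / N : ℝ) : ℝ) * ee (τ / N) ^ (N - r) := by
    rw [← ee_nat_mul, ← ee_add, ← ee_add, hw]
    congr 1; push_cast [Nat.cast_sub hN.le]; field_simp; ring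
  have h2 : PP (ee τ) (ee τ * ee (-w)) =
      EE (indc N (N - r) (ee (-(t / N : ℝ) : ℝ))) (ee (τ / N)) := by
    rw [hx2, hqN, PP_eq_EE (by omega) (by omega)]
  have h1 : PP (ee τ) (ee w) = (if r = 0 then 1 - ee (t / N : ℝ) else 1) *
      EE (indc N r (ee (t / N : ℝ))) (ee (τ / N)) := by
    by_cases hr : r = 0
    · rw [if_pos hr, PP_succ hq, hx]
      subst hr
      rw [pow_zero, mul_one]
      congr 1
      rw [mul_comm, hqN, PP_eq_EE (by omega) le_rfl]
      congr 1
      ext m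
      simp [indc, Nat.ModEq]
    · rw [if_neg hr, one_mul, hx, hqN, PP_eq_EE (by omega) hN.le]
  rw [GG, th, h1, h2, kap]
  have e : ee (((r / N : ℝ) : ℂ) * w / 2) * ee (τ / 12 - w / 2) =
      ee ((t / N : ℝ) * ((r / N : ℝ) - 1) / 2) *
      ee ((((r / N : ℝ) ^ 2 - (r / N : ℝ) + 1 / 6) / 2 : ℝ) * τ) := by
    rw [← ee_add, ← ee_add, hw]; congr 1; push_cast; ring
  linear_combination ((if r = 0 then 1 - ee (t / N : ℝ) else 1) *
      EE (indc N r (ee (t / N : ℝ))) (ee (τ / N)) *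
      EE (indc N (N - r) (ee (-(t / N : ℝ) : ℝ))) (ee (τ / N))) * e

lemma kap_ne_zero {N r : ℕ} (hN : r < N) {t : ℤ} (h : ¬ (r = 0 ∧ (N : ℤ) ∣ t)) :
    kap N r t ≠ 0 := by
  have hN0 : (N : ℂ) ≠ 0 := by norm_cast; omega
  refine mul_ne_zero (ee_ne_zero _) ?_
  split_ifs with hr
  · rw [sub_ne_zero]
    intro h1
    obtain ⟨n, hn⟩ := (ee_eq_one_iff _).mp h1.symm
    apply h ⟨hr, n, ?_⟩
    push_cast at hn
    rw [div_eq_iff hN0] at hn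
    have : (t : ℂ) = ((n * N : ℤ) : ℂ) := by rw [hn]; push_cast; ring
    have := Int.cast_injective this
    rw [this]; ring
  · exact one_ne_zero

/-- exact order `α` at `i∞` -/
def HasOrd (g : ℍ → ℂ) (α : ℝ) : Prop :=
  ∃ κ : ℂ, κ ≠ 0 ∧ Tendsto (fun z : ℍ => g z * ee (-(α * (z : ℂ)))) atImInfty (𝓝 κ)

lemma HasOrd.mul {g h : ℍ → ℂ} {α β : ℝ} (hg : HasOrd g α) (hh : HasOrd h β) :
    HasOrd (fun z => g z * h z) (α + β) := by
  obtain ⟨κ, hκ, h1⟩ := hg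
  obtain ⟨μ, hμ, h2⟩ := hh
  refine ⟨κ * μ, mul_ne_zero hκ hμ, (h1.mul h2).congr fun z => ?_⟩
  push_cast
  rw [show -(((α : ℂ) + β) * (z : ℂ)) = -(α * (z : ℂ)) + -(β * (z : ℂ)) by ring, ee_add]
  ring

lemma HasOrd.inv {g : ℍ → ℂ} {α : ℝ} (hg : HasOrd g α) :
    HasOrd (fun z => (g z)⁻¹) (-α) := by
  obtain ⟨κ, hκ, h1⟩ := hg
  refine ⟨κ⁻¹, inv_ne_zero hκ, (h1.inv₀ hκ).congr fun z => ?_⟩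
  push_cast
  rw [mul_inv, ← ee_neg]
  congr 2; ring

lemma HasOrd.const {c : ℂ} (hc : c ≠ 0) : HasOrd (fun _ => c) 0 :=
  ⟨c, hc, by simp [ee_zero]⟩

lemma HasOrd.pow {g : ℍ → ℂ} {α : ℝ} (hg : HasOrd g α) (n : ℕ) :
    HasOrd (fun z => g z ^ n) (n * α) := by
  induction n with
  | zero => simpa using HasOrd.const one_ne_zero
  | succ n ih =>
    have := ih.mul hg
    simp only [pow_succ]
    convert this using 1
    push_cast; ring

lemma HasOrd.zpow {g : ℍ → ℂ} {α : ℝ} (hg : HasOrd g α) (n : ℤ) :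
    HasOrd (fun z => g z ^ n) (n * α) := by
  cases n with
  | ofNat n => simpa using hg.pow n
  | negSucc n =>
    have := (hg.pow (n + 1)).inv
    simp only [zpow_negSucc]
    convert this using 1
    push_cast; ring

lemma HasOrd.prod {ι : Type*} {g : ι → ℍ → ℂ} {α : ι → ℝ} (s : Finset ι)
    (hg : ∀ i ∈ s, HasOrd (g i) (α i)) :
    HasOrd (fun z => ∏ i ∈ s, g i z) (∑ i ∈ s, α i) := by
  classical
  induction s using Finset.induction_on with
  | empty => simpa using HasOrd.const one_ne_zero
  | insert a s ha ih =>
    simp only [Finset.prod_insert ha, Finset.sum_insert ha]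
    exact (hg a (Finset.mem_insert_self _ _)).mul
      (ih fun i hi => hg i (Finset.mem_insert_of_mem hi))

lemma tendsto_ee_zero {β : ℝ} (hβ : 0 < β) :
    Tendsto (fun z : ℍ => ee (β * (z : ℂ))) atImInfty (𝓝 0) := by
  rw [tendsto_zero_iff_norm_tendsto_zero]
  simp only [norm_ee]
  apply Real.tendsto_exp_atBot.comp
  have h : Tendsto (fun z : ℍ => z.im) atImInfty atTop := tendsto_comap
  have h2 := h.const_mul_atTop (show 0 < 2 * π * β by positivity)
  refine (tendsto_neg_atTop_atBot.comp h2).congr fun z => ?_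
  simp [Complex.mul_im]; ring

lemma HasOrd.not_pos {g : ℍ → ℂ} {α β : ℝ} (h1 : HasOrd g α) (h2 : HasOrd g β) : ¬ α < β := by
  intro hlt
  obtain ⟨κ, hκ, t1⟩ := h1
  obtain ⟨μ, hμ, t2⟩ := h2
  have t3 := t2.mul (tendsto_ee_zero (sub_pos.mpr hlt))
  rw [mul_zero] at t3
  refine hκ (tendsto_nhds_unique (t1.congr fun z => ?_) t3)
  rw [mul_assoc, ← ee_add]; congr 2; push_cast; ring

lemma HasOrd.unique {g : ℍ → ℂ} {α β : ℝ} (h1 : HasOrd g α) (h2 : HasOrd g β) : α = β :=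
  le_antisymm (not_lt.mp (h2.not_pos h1)) (not_lt.mp (h1.not_pos h2))

lemma HasOrd.congr {g h : ℍ → ℂ} {α : ℝ} (h1 : HasOrd g α) (e : ∀ z, h z = g z) : HasOrd h α := by
  have : h = g := funext e
  rwa [this]

lemma HasOrd.const_mul {g : ℍ → ℂ} {α : ℝ} (h1 : HasOrd g α) {c : ℂ} (hc : c ≠ 0) :
    HasOrd (fun z => c * g z) α := by
  simpa using (HasOrd.const hc).mul h1

lemma HasOrd.bounded {g : ℍ → ℂ} {α : ℝ} (h1 : HasOrd g α) (hα : 0 ≤ α) :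
    IsBoundedAtImInfty g := by
  obtain ⟨κ, hκ, t1⟩ := h1
  have hb := t1.isBigO_one ℝ
  rw [isBoundedAtImInfty_iff]
  obtain ⟨C, hC⟩ := hb.bound
  obtain ⟨A, hA⟩ := (atImInfty_mem _).mp hC
  refine ⟨C, A, fun z hz => ?_⟩
  have := hA z hz
  simp only [Set.mem_ofPred_eq, norm_mul, norm_ee, norm_one, mul_one] at this
  refine le_trans ?_ this
  apply le_mul_of_one_le_right (norm_nonneg _)
  apply Real.one_le_exp
  simp [Complex.mul_im]
  have := z.im_pos
  positivity

lemma tendsto_T_smul (k : ℤ) : Tendsto (fun z : ℍ => (k : ℝ) +ᵥ z) atImInfty atImInfty := by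
  rw [atImInfty, tendsto_comap_iff]
  refine (tendsto_comap).congr fun z => ?_
  simp

lemma HasOrd.shift {g : ℍ → ℂ} {α : ℝ} (h1 : HasOrd g α) (k : ℤ) :
    HasOrd (fun z => g ((k : ℝ) +ᵥ z)) α := by
  obtain ⟨κ, hκ, t1⟩ := h1
  refine ⟨κ * ee (α * k), mul_ne_zero hκ (ee_ne_zero _), ?_⟩
  refine ((t1.comp (tendsto_T_smul k)).mul_const _).congr fun z => ?_
  simp only [Function.comp]
  rw [mul_assoc, ← ee_add]
  congr 2
  simp; ring

/-- periodicity forces integrality of the order -/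
lemma HasOrd.int_of_periodic {g : ℍ → ℂ} {α : ℝ} (h1 : HasOrd g α) (k : ℤ)
    (hp : ∀ z, g ((k : ℝ) +ᵥ z) = g z) : ∃ n : ℤ, α * k = n := by
  obtain ⟨κ, hκ, t1⟩ := h1
  have t2 := ((t1.comp (tendsto_T_smul k)).mul_const (ee (α * k)))
  have t3 : Tendsto (fun z : ℍ => g z * ee (-(α * (z : ℂ)))) atImInfty (𝓝 (κ * ee (α * k))) := by
    refine t2.congr fun z => ?_
    simp only [Function.comp]
    rw [mul_assoc, ← ee_add, hp]
    congr 2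
    simp; ring
  have h := tendsto_nhds_unique t1 t3
  have h4 : ee (α * k) = 1 := by
    have : κ * ee (α * k) = κ * 1 := by rw [← h, mul_one]
    exact mul_left_cancel₀ hκ this
  obtain ⟨n, hn⟩ := (ee_eq_one_iff _).mp h4
  exact ⟨n, by exact_mod_cast hn⟩

/-! ### holomorphy -/

lemma hol_of_differentiableOn {F : ℂ → ℂ} (h : DifferentiableOn ℂ F {z | 0 < z.im}) :
    MDifferentiable 𝓘(ℂ) 𝓘(ℂ) (fun z : ℍ => F z) := by
  rw [UpperHalfPlane.mdifferentiable_iff]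
  refine h.congr fun z hz => ?_
  simp [ofComplex_apply_of_im_pos hz]

lemma hol_inv {f : ℍ → ℂ} (h : MDifferentiable 𝓘(ℂ) 𝓘(ℂ) f) (h0 : ∀ z, f z ≠ 0) :
    MDifferentiable 𝓘(ℂ) 𝓘(ℂ) (fun z => (f z)⁻¹) := by
  rw [UpperHalfPlane.mdifferentiable_iff] at h ⊢
  exact h.inv fun z hz => h0 _

lemma hol_mul {f g : ℍ → ℂ} (h : MDifferentiable 𝓘(ℂ) 𝓘(ℂ) f) (h' : MDifferentiable 𝓘(ℂ) 𝓘(ℂ) g) :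
    MDifferentiable 𝓘(ℂ) 𝓘(ℂ) (fun z => f z * g z) := by
  rw [UpperHalfPlane.mdifferentiable_iff] at h h' ⊢
  exact h.mul h'

lemma hol_add {f g : ℍ → ℂ} (h : MDifferentiable 𝓘(ℂ) 𝓘(ℂ) f) (h' : MDifferentiable 𝓘(ℂ) 𝓘(ℂ) g) :
    MDifferentiable 𝓘(ℂ) 𝓘(ℂ) (fun z => f z + g z) := by
  rw [UpperHalfPlane.mdifferentiable_iff] at h h' ⊢
  exact h.add h'

lemma hol_sub {f g : ℍ → ℂ} (h : MDifferentiable 𝓘(ℂ) 𝓘(ℂ) f) (h' : MDifferentiable 𝓘(ℂ) 𝓘(ℂ) g) :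
    MDifferentiable 𝓘(ℂ) 𝓘(ℂ) (fun z => f z - g z) := by
  rw [UpperHalfPlane.mdifferentiable_iff] at h h' ⊢
  exact h.sub h'

lemma hol_const (c : ℂ) : MDifferentiable 𝓘(ℂ) 𝓘(ℂ) (fun _ : ℍ => c) := by
  rw [UpperHalfPlane.mdifferentiable_iff]
  exact differentiableOn_const c

lemma hol_pow {f : ℍ → ℂ} (h : MDifferentiable 𝓘(ℂ) 𝓘(ℂ) f) (n : ℕ) :
    MDifferentiable 𝓘(ℂ) 𝓘(ℂ) (fun z => f z ^ n) := by
  rw [UpperHalfPlane.mdifferentiable_iff] at h ⊢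
  exact h.pow n

lemma hol_zpow {f : ℍ → ℂ} (h : MDifferentiable 𝓘(ℂ) 𝓘(ℂ) f) (h0 : ∀ z, f z ≠ 0) (n : ℤ) :
    MDifferentiable 𝓘(ℂ) 𝓘(ℂ) (fun z => f z ^ n) := by
  cases n with
  | ofNat n => simpa using hol_pow h n
  | negSucc n =>
    simp only [zpow_negSucc]
    exact hol_inv (hol_pow h (n + 1)) fun z => pow_ne_zero _ (h0 z)

lemma hol_prod {ι : Type*} {f : ι → ℍ → ℂ} (s : Finset ι)
    (h : ∀ i ∈ s, MDifferentiable 𝓘(ℂ) 𝓘(ℂ) (f i)) :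
    MDifferentiable 𝓘(ℂ) 𝓘(ℂ) (fun z => ∏ i ∈ s, f i z) := by
  classical
  induction s using Finset.induction_on with
  | empty => simpa using hol_const 1
  | insert a s ha ih =>
    simp only [Finset.prod_insert ha]
    exact hol_mul (h a (Finset.mem_insert_self _ _))
      (ih fun i hi => h i (Finset.mem_insert_of_mem hi))

lemma hol_sum {ι : Type*} {f : ι → ℍ → ℂ} (s : Finset ι)
    (h : ∀ i ∈ s, MDifferentiable 𝓘(ℂ) 𝓘(ℂ) (f i)) :
    MDifferentiable 𝓘(ℂ) 𝓘(ℂ) (fun z => ∑ i ∈ s, f i z) := by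
  classical
  induction s using Finset.induction_on with
  | empty => simpa using hol_const 0
  | insert a s ha ih =>
    simp only [Finset.sum_insert ha]
    exact hol_add (h a (Finset.mem_insert_self _ _))
      (ih fun i hi => h i (Finset.mem_insert_of_mem hi))

lemma hol_smul {f : ℍ → ℂ} (h : MDifferentiable 𝓘(ℂ) 𝓘(ℂ) f) (A : SL(2, ℤ)) :
    MDifferentiable 𝓘(ℂ) 𝓘(ℂ) (fun z => f (A • z)) := by
  have h2 : MDifferentiable 𝓘(ℂ) 𝓘(ℂ) (fun τ : ℍ ↦ ((A : GL (Fin 2) ℝ)) • τ) :=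
    mdifferentiable_smul (by simp)
  exact h.comp h2

/-! ### constants -/

open scoped ModularForm in
lemma const_of_bounded {N : ℕ} (hN : 0 < N) {g : ℍ → ℂ} (hol : MDifferentiable 𝓘(ℂ) 𝓘(ℂ) g)
    (inv : ∀ A ∈ CongruenceSubgroup.Gamma N, ∀ z : ℍ, g (A • z) = g z)
    (bd : ∀ A : SL(2, ℤ), IsBoundedAtImInfty (fun z : ℍ => g (A • z))) : ∃ c, ∀ z, g z = c := by
  have : NeZero N := ⟨hN.ne'⟩
  have hslash : ∀ (A : SL(2, ℤ)), (g ∣[(0 : ℤ)] A) = fun z => g (A • z) := by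
    intro A
    ext z
    rw [ModularForm.SL_slash_apply]
    simp
  let F : ModularForm ((CongruenceSubgroup.Gamma N : Subgroup SL(2, ℤ)) : Subgroup (GL (Fin 2) ℝ)) 0 :=
    { toFun := g
      slash_action_eq' := by
        intro γ hγ
        obtain ⟨A, hA, rfl⟩ := hγ
        have := hslash A
        rw [ModularForm.SL_slash] at this
        ext z
        have e : (g ∣[(0 : ℤ)] (A : GL (Fin 2) ℝ)) = fun z => g (A • z) := this
        show (g ∣[(0 : ℤ)] (A : GL (Fin 2) ℝ)) z = g z
        rw [e]; exact inv A hA z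
      holo' := hol
      bdd_at_cusps' := by
        intro c hc
        have hc' : IsCusp c 𝒮ℒ := by
          exact Subgroup.IsArithmetic.isCusp_iff_isCusp_SL2Z _ |>.mp hc
        rw [OnePoint.isBoundedAt_iff_forall_SL2Z hc']
        intro A hA
        rw [hslash]
        exact bd A }
  obtain ⟨c, hc⟩ := ModularForm.eq_const_of_weight_zero F
  exact ⟨c, fun z => congrFun hc z⟩

lemma GG_ne_zero {N : ℕ} (hN : 0 < N) {r t : ℤ} (h : ¬ ((N : ℤ) ∣ r ∧ (N : ℤ) ∣ t)) (z : ℍ) :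
    GG (r / N : ℝ) (t / N : ℝ) z ≠ 0 := by
  intro h0
  rw [GG] at h0
  have h1 := (mul_eq_zero.mp h0).resolve_left (ee_ne_zero _)
  obtain ⟨m, n, hw⟩ := th_eq_zero z.2 h1
  have hN' : (N : ℝ) ≠ 0 := by positivity
  have him := congrArg Complex.im hw
  have hre := congrArg Complex.re hw
  simp only [Complex.add_im, Complex.re_ofReal_mul, Complex.im_ofReal_mul, Complex.ofReal_im,
    Complex.intCast_im, Complex.add_re, Complex.ofReal_re, Complex.intCast_re, Complex.mul_im,
    Complex.mul_re, zero_mul, add_zero, zero_add, sub_zero] at him hre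
  have hz := z.im_pos
  have e1 : (r / N : ℝ) = n := mul_right_cancel₀ (ne_of_gt hz) him
  rw [e1] at hre
  have e2 : (t / N : ℝ) = m := by linarith
  apply h
  rw [div_eq_iff hN'] at e1 e2
  constructor
  · exact ⟨n, by have : (r : ℝ) = ((N * n : ℤ) : ℝ) := by rw [e1]; push_cast; ring
                 exact_mod_cast this⟩
  · exact ⟨m, by have : (t : ℝ) = ((N * m : ℤ) : ℝ) := by rw [e2]; push_cast; ring
                 exact_mod_cast this⟩

lemma tendsto_EE {c : ℕ → ℂ} (hc : ∀ m, ‖c m‖ ≤ 1) {N : ℕ} (hN : 0 < N) :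
    Tendsto (fun z : ℍ => EE c (ee ((z : ℂ) / N))) atImInfty (𝓝 1) := by
  have h0 : EE c 0 = 1 := by simp [EE]
  have hcont : ContinuousAt (EE c) 0 :=
    ((EE_differentiableOn hc).differentiableAt (Metric.ball_mem_nhds _ one_pos)).continuousAt
  have h := tendsto_ee_zero (β := (1 / N : ℝ)) (by positivity)
  have h2 := hcont.tendsto.comp h
  rw [h0] at h2
  refine h2.congr fun z => ?_
  simp only [Function.comp]
  congr 2; push_cast; ring

lemma bern_of_lt {N r : ℕ} (h : r < N) :
    bern ((r : ℝ) / N) = (r / N : ℝ) ^ 2 - (r / N : ℝ) + 1 / 6 := by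
  have hN : (0 : ℝ) < N := by exact_mod_cast (by omega : 0 < N)
  have : Int.fract ((r : ℝ) / N) = r / N := by
    rw [Int.fract_eq_self]
    exact ⟨by positivity, by rw [div_lt_one hN]; exact_mod_cast h⟩
  rw [bern, this]

lemma bern_add_int (x : ℝ) (n : ℤ) : bern (x + n) = bern x := by
  rw [bern, bern, Int.fract_add_intCast]

lemma bern_neg (x : ℝ) : bern (-x) = bern x := by
  by_cases h : Int.fract x = 0
  · have h2 : Int.fract (-x) = 0 := by rw [Int.fract_neg_eq_zero]; exact h
    rw [bern, bern, h, h2]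
  · rw [bern, bern, Int.fract_neg h]; ring

lemma int_split {N : ℕ} (hN : 0 < N) (r : ℤ) : ∃ (r' : ℕ) (n : ℤ), r' < N ∧ r = r' + N * n := by
  have hN' : (0 : ℤ) < N := by exact_mod_cast hN
  refine ⟨(r % N).toNat, r / N, ?_, ?_⟩
  · have := Int.emod_lt_of_pos r hN'
    have := Int.emod_nonneg r hN'.ne'
    omega
  · rw [Int.toNat_of_nonneg (Int.emod_nonneg r hN'.ne')]
    have := Int.emod_add_mul_ediv r N
    omega

lemma GG_ord_nat {N r : ℕ} (hrN : r < N) {t : ℤ} (h : ¬ (r = 0 ∧ (N : ℤ) ∣ t)) :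
    HasOrd (fun z : ℍ => GG (r / N : ℝ) (t / N : ℝ) z) (bern (r / N) / 2) := by
  have hN : 0 < N := by omega
  refine ⟨kap N r t, kap_ne_zero hrN h, ?_⟩
  have h1 := tendsto_EE (indc_norm N r (z := ee (t / N : ℝ)) (norm_ee_real _).le) hN
  have h2 := tendsto_EE (indc_norm N (N - r) (z := ee (-(t / N : ℝ) : ℝ)) (norm_ee_real _).le) hN
  have h3 := (h1.mul h2).const_mul (kap N r t)
  rw [mul_one, mul_one] at h3
  refine h3.congr fun z => ?_
  beta_reduce
  rw [GG_expansion hrN t z.2, bern_of_lt hrN]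
  set w : ℂ := ((((r / N : ℝ) ^ 2 - (r / N : ℝ) + 1 / 6) / 2 : ℝ) : ℂ) * (z : ℂ)
  rw [ee_neg]
  have := ee_ne_zero w
  field_simp

lemma GG_ord {N : ℕ} (hN : 0 < N) {r t : ℤ} (h : ¬ ((N : ℤ) ∣ r ∧ (N : ℤ) ∣ t)) :
    HasOrd (fun z : ℍ => GG (r / N : ℝ) (t / N : ℝ) z) (bern (r / N) / 2) := by
  obtain ⟨r', n, hr', rfl⟩ := int_split hN r
  have hN' : (N : ℝ) ≠ 0 := by positivity
  have e : (((r' + N * n : ℤ) : ℝ) / N) = r' / N + n := by push_cast; field_simp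
  rw [e, bern_add_int]
  refine ((GG_ord_nat hr' (t := t) ?_).const_mul (ee_ne_zero (n * ((1 - (t / N : ℝ)) / 2)))).congr ?_
  · rintro ⟨h1, h2⟩
    exact h ⟨by rw [h1]; simp, h2⟩
  · intro z
    exact GG_add_int_left _ _ _ z.2

lemma differentiableOn_EE_ee {c : ℕ → ℂ} (hc : ∀ m, ‖c m‖ ≤ 1) {N : ℕ} (hN : 0 < N) :
    DifferentiableOn ℂ (fun z => EE c (ee (z / N))) {z | 0 < z.im} := by
  refine (EE_differentiableOn hc).comp (f := fun z => ee (z / N)) ?_ ?_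
  · exact (differentiable_ee' (by fun_prop)).differentiableOn
  · intro z hz
    rw [mem_ball_zero_iff]
    apply norm_ee_lt_one
    rw [Complex.div_natCast_im]
    exact div_pos hz (by exact_mod_cast hN)

lemma GG_hol {N : ℕ} (hN : 0 < N) (r t : ℤ) :
    MDifferentiable 𝓘(ℂ) 𝓘(ℂ) (fun z : ℍ => GG (r / N : ℝ) (t / N : ℝ) z) := by
  obtain ⟨r', n, hr', rfl⟩ := int_split hN r
  have hN' : (N : ℝ) ≠ 0 := by positivity
  have e : (((r' + N * n : ℤ) : ℝ) / N) = r' / N + n := by push_cast; field_simp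
  rw [e]
  have h1 := differentiableOn_EE_ee (indc_norm N r' (z := ee (t / N : ℝ)) (norm_ee_real _).le) hN
  have h2 := differentiableOn_EE_ee (indc_norm N (N - r') (z := ee (-(t / N : ℝ) : ℝ)) (norm_ee_real _).le) hN
  have h3 : DifferentiableOn ℂ (fun z => ee ((((r' / N : ℝ) ^ 2 - (r' / N : ℝ) + 1 / 6) / 2 : ℝ) * z))
      {z | 0 < z.im} := (differentiable_ee' (by fun_prop)).differentiableOn
  apply hol_of_differentiableOn
  refine (((h3.const_mul (kap N r' t)).mul (h1.mul h2)).const_mul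
    (ee (n * ((1 - (t / N : ℝ)) / 2)))).congr fun z hz => ?_
  rw [GG_add_int_left _ _ _ hz, GG_expansion hr' t hz]
  rfl

/-- the powers of Siegel functions of level `N` -/
def U (N : ℕ) (r t : ℤ) (τ : ℂ) : ℂ := GG (r / N : ℝ) (t / N : ℝ) τ ^ (12 * N)

lemma U_shift {N : ℕ} (hN : 0 < N) (r t i j : ℤ) {τ : ℂ} (hτ : 0 < τ.im) :
    U N (r + N * i) (t + N * j) τ = U N r t τ := by
  have hN' : (N : ℝ) ≠ 0 := by positivity
  have hN'' : (N : ℂ) ≠ 0 := by exact_mod_cast hN.ne'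
  have e1 : (((r + N * i : ℤ) : ℝ) / N) = r / N + i := by push_cast; field_simp
  have e2 : (((t + N * j : ℤ) : ℝ) / N) = t / N + j := by push_cast; field_simp
  rw [U, U, e1, e2, GG_add_int_left _ _ _ hτ, GG_add_int_right, mul_pow, mul_pow]
  rw [← ee_nat_mul, ← ee_nat_mul]
  have h1 : ee (((12 * N : ℕ) : ℂ) * (i * ((1 - ((t / N + j : ℝ) : ℂ)) / 2))) = 1 := by
    rw [ee_eq_one_iff]
    refine ⟨6 * i * (N - t - N * j), ?_⟩
    push_cast; field_simp; ring
  have h2 : ee (((12 * N : ℕ) : ℂ) * (j * ((((r / N : ℝ) : ℂ) - 1) / 2))) = 1 := by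
    rw [ee_eq_one_iff]
    refine ⟨6 * j * (r - N), ?_⟩
    push_cast; field_simp; ring
  rw [h1, h2, one_mul, one_mul]

lemma U_congr {N : ℕ} (hN : 0 < N) {r t r' t' : ℤ} (h1 : (r : ZMod N) = r') (h2 : (t : ZMod N) = t')
    {τ : ℂ} (hτ : 0 < τ.im) : U N r t τ = U N r' t' τ := by
  rw [ZMod.intCast_eq_intCast_iff] at h1 h2
  obtain ⟨i, hi⟩ := h1.symm.dvd
  obtain ⟨j, hj⟩ := h2.symm.dvd
  rw [show r = r' + N * i by linarith, show t = t' + N * j by linarith, U_shift hN _ _ _ _ hτ]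

lemma chi_pow (A : SL(2, ℤ)) : chi A ^ 12 = 1 := by
  rw [chi, mul_pow, ← pow_mul, ← pow_mul, mul_comm _ 12, mul_comm _ 12,
    show 12 = 3 * 4 by norm_num, mul_assoc 3 4, pow_mul, ee_third_pow, one_pow,
    show 3 * 4 = 4 * 3 by norm_num, mul_assoc 4 3, pow_mul, ee_quarter_pow, one_pow, one_mul]

lemma U_smul {N : ℕ} (r t : ℤ) (A : SL(2, ℤ)) (z : ℍ) :
    U N r t ((A • z : ℍ) : ℂ) = U N (r * A 0 0 + t * A 1 0) (r * A 0 1 + t * A 1 1) z := by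
  rw [U, GG_smul, mul_pow, pow_mul, chi_pow, one_pow, one_mul, U]
  congr 2 <;> push_cast <;> ring

lemma U_ne_zero {N : ℕ} (hN : 0 < N) {r t : ℤ} (h : ¬ ((N : ℤ) ∣ r ∧ (N : ℤ) ∣ t)) (z : ℍ) :
    U N r t z ≠ 0 := pow_ne_zero _ (GG_ne_zero hN h z)

lemma U_hol {N : ℕ} (hN : 0 < N) (r t : ℤ) :
    MDifferentiable 𝓘(ℂ) 𝓘(ℂ) (fun z : ℍ => U N r t z) := hol_pow (GG_hol hN r t) _

lemma U_ord {N : ℕ} (hN : 0 < N) {r t : ℤ} (h : ¬ ((N : ℤ) ∣ r ∧ (N : ℤ) ∣ t)) :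
    HasOrd (fun z : ℍ => U N r t z) (6 * N * bern (r / N)) := by
  have := (GG_ord hN h).pow (12 * N)
  have e : ((12 * N : ℕ) : ℝ) * (bern (r / N) / 2) = 6 * N * bern (r / N) := by push_cast; ring
  rw [e] at this
  exact this

/-- `vec` analog: nonzero rows stay nonzero. -/
lemma row_ne_zero {N : ℕ} {r t : ℤ} (h : ¬ ((N : ℤ) ∣ r ∧ (N : ℤ) ∣ t)) (A : SL(2, ℤ)) :
    ¬ ((N : ℤ) ∣ (r * A 0 0 + t * A 1 0) ∧ (N : ℤ) ∣ (r * A 0 1 + t * A 1 1)) := by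
  rintro ⟨h1, h2⟩
  have hd := SL_det A
  apply h
  constructor
  · have : r = (r * A 0 0 + t * A 1 0) * A 1 1 - (r * A 0 1 + t * A 1 1) * A 1 0 := by
      linear_combination -r * hd
    rw [this]
    exact dvd_sub (h1.mul_right _) (h2.mul_right _)
  · have : t = (r * A 0 1 + t * A 1 1) * A 0 0 - (r * A 0 0 + t * A 1 0) * A 0 1 := by
      linear_combination -t * hd
    rw [this]
    exact dvd_sub (h2.mul_right _) (h1.mul_right _)

lemma U_smul_ord {N : ℕ} (hN : 0 < N) {r t : ℤ} (h : ¬ ((N : ℤ) ∣ r ∧ (N : ℤ) ∣ t)) (A : SL(2, ℤ)) :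
    HasOrd (fun z : ℍ => U N r t ((A • z : ℍ) : ℂ))
      (6 * N * bern ((r * A 0 0 + t * A 1 0 : ℤ) / N)) :=
  (U_ord hN (row_ne_zero h A)).congr fun z => U_smul r t A z

lemma U_Gamma {N : ℕ} (hN : 0 < N) (r t : ℤ) {A : SL(2, ℤ)} (hA : A ∈ CongruenceSubgroup.Gamma N)
    (z : ℍ) : U N r t ((A • z : ℍ) : ℂ) = U N r t z := by
  rw [CongruenceSubgroup.Gamma_mem] at hA
  obtain ⟨h1, h2, h3, h4⟩ := hA
  rw [U_smul]
  apply U_congr hN _ _ z.2 <;> push_cast <;> simp [h1, h2, h3, h4]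

/-! ### power series with coefficients in a subring -/

/-- power series with coefficients in `R` -/
def InS (R : Subring ℂ) : Subring (PowerSeries ℂ) where
  carrier := {p | ∀ n, PowerSeries.coeff n p ∈ R}
  mul_mem' {a b} ha hb n := by
    rw [PowerSeries.coeff_mul]
    exact R.sum_mem fun x _ => R.mul_mem (ha _) (hb _)
  one_mem' n := by
    rw [PowerSeries.coeff_one]; split_ifs
    · exact R.one_mem
    · exact R.zero_mem
  add_mem' {a b} ha hb n := by
    rw [map_add]; exact R.add_mem (ha n) (hb n)
  zero_mem' n := by rw [map_zero]; exact R.zero_mem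
  neg_mem' {a} ha n := by rw [map_neg]; exact R.neg_mem (ha n)

lemma mem_InS {R : Subring ℂ} {p : PowerSeries ℂ} :
    p ∈ InS R ↔ ∀ n, PowerSeries.coeff n p ∈ R := Iff.rfl

lemma InS_C {R : Subring ℂ} {c : ℂ} (hc : c ∈ R) : PowerSeries.C c ∈ InS R := by
  intro n
  rw [PowerSeries.coeff_C]; split_ifs
  · exact hc
  · exact R.zero_mem

lemma InS_X {R : Subring ℂ} : PowerSeries.X ∈ InS R := by
  intro n
  rw [PowerSeries.coeff_X]; split_ifs
  · exact R.one_mem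
  · exact R.zero_mem

lemma InS_inv {R : Subring ℂ} {p : PowerSeries ℂ} (hp : p ∈ InS R)
    (h1 : PowerSeries.constantCoeff p = 1) : p⁻¹ ∈ InS R := by
  intro n
  induction n using Nat.strong_induction_on with
  | _ n ih =>
    rw [PowerSeries.coeff_inv, h1]
    split_ifs with h
    · simpa using R.one_mem
    · rw [inv_one]
      apply R.mul_mem (by simpa using R.neg_mem R.one_mem)
      apply R.sum_mem
      intro x hx
      split_ifs with h2
      · exact R.mul_mem (hp _) (ih _ h2)
      · exact R.zero_mem

lemma InS_Ep {R : Subring ℂ} {c : ℕ → ℂ} (hc : ∀ m, c m ∈ R) : Ep c ∈ InS R := by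
  have h : ∀ K, Pq c K ∈ InS R := by
    intro K
    rw [Pq]
    refine (InS R).prod_mem fun m _ => ?_
    exact (InS R).sub_mem (InS R).one_mem ((InS R).mul_mem (InS_C (hc _)) ((InS R).pow_mem InS_X _))
  intro n
  rw [Ep, PowerSeries.coeff_mk]
  exact h n n

/-- integers in `ℂ` -/
def ZR : Subring ℂ := (Int.castRingHom ℂ).range

/-- rationals in `ℂ` -/
def QR : Subring ℂ := (algebraMap ℚ ℂ).range

lemma ZR_le_QR : ZR ≤ QR := by
  rintro _ ⟨n, rfl⟩
  exact ⟨n, by simp⟩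

lemma InS_mono {R S : Subring ℂ} (h : R ≤ S) {p : PowerSeries ℂ} (hp : p ∈ InS R) : p ∈ InS S :=
  fun n => h (hp n)

lemma indc_one_mem (R : Subring ℂ) (N r : ℕ) : ∀ m, indc N r 1 m ∈ R := by
  intro m; rw [indc]; split_ifs
  · exact R.one_mem
  · exact R.zero_mem

/-! ### the functions `rl` -/

lemma tprod_class {l : ℕ} {r : ℤ} {r' : ℕ} (h : (r' : ℤ) ≡ r [ZMOD l]) (z : ℍ) :
    (∏' n : {n : ℤ // 0 < n ∧ n ≡ r [ZMOD l]},
      (1 - Complex.exp (2 * (π : ℂ) * Complex.I * ((n : ℤ) : ℂ) * (z : ℂ)))⁻¹) =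
    (EE (indc l r' 1) (ee z))⁻¹ := by
  have hc := indc_norm l r' (z := 1) (by simp)
  have hq := norm_ee_lt_one z.2
  have hm := (multipliable_EE hc hq).hasProd
  have hinv : HasProd (fun n : ℕ => (1 - indc l r' 1 (n + 1) * ee z ^ (n + 1))⁻¹)
      (EE (indc l r' 1) (ee z))⁻¹ := by
    have h1 := Filter.Tendsto.inv₀ hm (EE_ne_zero hc hq)
    refine h1.congr fun s => ?_
    simp
  rw [← hinv.tprod_eq]
  have hinj : Function.Injective
      (fun n : {n : ℤ // 0 < n ∧ n ≡ r [ZMOD l]} => (n : ℤ).toNat - 1) := by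
    rintro ⟨a, ha, _⟩ ⟨b, hb, _⟩ hab
    simp only at hab
    apply Subtype.ext
    simp only
    omega
  rw [← hinj.tprod_eq (f := fun n : ℕ => (1 - indc l r' 1 (n + 1) * ee z ^ (n + 1))⁻¹)]
  · congr 1
    ext ⟨n, hn, hnr⟩
    have e1 : n.toNat - 1 + 1 = n.toNat := by omega
    have e2 : ((n.toNat : ℕ) : ℤ) = n := Int.toNat_of_nonneg hn.le
    simp only [e1]
    have h2 : n.toNat ≡ r' [MOD l] := by
      rw [← Int.natCast_modEq_iff, e2]
      exact hnr.trans h.symm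
    rw [indc, if_pos h2, one_mul, ← ee_nat_mul, ee]
    congr 3
    have e3 : ((n.toNat : ℕ) : ℂ) = (n : ℂ) := by exact_mod_cast congrArg (fun t : ℤ => (t : ℂ)) e2
    rw [e3]; ring
  · intro n hn
    rw [Function.mem_mulSupport] at hn
    have h1 : n + 1 ≡ r' [MOD l] := by
      by_contra hc
      apply hn
      rw [indc, if_neg hc]; simp
    refine ⟨⟨(n + 1 : ℕ), by positivity, ?_⟩, by simp⟩
    exact (Int.natCast_modEq_iff.mpr h1).trans h

lemma rl_eq {l : ℕ} (hl : 0 < l) {r : ℤ} (h : ¬ (l : ℤ) ∣ r) : ∃ r' : ℕ, 0 < r' ∧ r' < l ∧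
    (r' : ℤ) ≡ r [ZMOD l] ∧ ∀ z : ℍ, rl l r z = ee ((-(l * bern (r' / l) / 2) : ℝ) * z) *
      (EE (indc l r' 1) (ee z))⁻¹ * (EE (indc l (l - r') 1) (ee z))⁻¹ := by
  obtain ⟨r', n, hr', rfl⟩ := int_split hl r
  have hl' : (l : ℝ) ≠ 0 := by positivity
  have hr0 : 0 < r' := by
    rcases Nat.eq_zero_or_pos r' with h0 | h0
    · exact absurd ⟨n, by simp [h0]⟩ h
    · exact h0
  have hmod : (r' : ℤ) ≡ r' + l * n [ZMOD l] := by simp [Int.ModEq]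
  refine ⟨r', hr0, hr', hmod, fun z => ?_⟩
  have hmod2 : ((l - r' : ℕ) : ℤ) ≡ -(r' + l * n) [ZMOD l] := by
    rw [Int.modEq_iff_dvd]
    push_cast [hr'.le]
    exact ⟨-n - 1, by ring⟩
  rw [rl]
  rw [tprod_class hmod, tprod_class hmod2]
  have e : (((r' + l * n : ℤ) : ℝ) / (l : ℤ)) = r' / l + n := by push_cast; field_simp
  rw [e, bern_add_int, ee]
  congr 3
  push_cast; ring

lemma prod_roots {l : ℕ} (hl : 0 < l) {ζ : ℂ} (hζ : IsPrimitiveRoot ζ l) (y : ℂ) :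
    ∏ t ∈ Finset.range l, (1 - ζ ^ t * y) = 1 - y ^ l := by
  have h := hζ.pow_sub_pow_eq_prod_sub_mul 1 y hl
  rw [one_pow] at h
  rw [h]
  symm
  have e : Polynomial.nthRootsFinset l (1 : ℂ) = (Finset.range l).image (fun t => ζ ^ t) := by
    symm
    apply Finset.eq_of_subset_of_card_le
    · intro x hx
      obtain ⟨t, _, rfl⟩ := Finset.mem_image.mp hx
      rw [Polynomial.mem_nthRootsFinset hl, ← pow_mul, mul_comm, pow_mul, hζ.pow_eq_one, one_pow]
    · rw [hζ.card_nthRootsFinset, Finset.card_image_of_injOn, Finset.card_range]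
      intro a ha b hb hab
      exact hζ.pow_inj (by simpa using ha) (by simpa using hb) hab
  rw [e, Finset.prod_image]
  intro a ha b hb hab
  exact hζ.pow_inj (by simpa using ha) (by simpa using hb) hab

lemma prod_EE_roots {l : ℕ} (hl : 0 < l) (r : ℕ) {ζ : ℂ} (hζ : IsPrimitiveRoot ζ l) {x : ℂ}
    (hx : ‖x‖ < 1) :
    ∏ t ∈ Finset.range l, EE (indc l r (ζ ^ t)) x = EE (indc l r 1) (x ^ l) := by
  have hn : ‖ζ‖ = 1 := hζ.norm'_eq_one hl.ne'
  simp only [EE]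
  rw [← Multipliable.tprod_finsetProd]
  · congr 1
    ext n
    by_cases h : n + 1 ≡ r [MOD l]
    · simp only [indc, if_pos h]
      rw [prod_roots hl hζ]
      ring
    · simp only [indc, if_neg h]
      simp
  · intro t _
    exact multipliable_EE (indc_norm l r (by rw [norm_pow, hn, one_pow])) hx

lemma isPrimitiveRoot_ee {l : ℕ} (hl : 0 < l) : IsPrimitiveRoot (ee (1 / l)) l := by
  have := Complex.isPrimitiveRoot_exp l hl.ne'
  rw [ee]
  convert this using 2
  ring

lemma prod_GG {l r : ℕ} (hr : 0 < r) (hrl : r < l) : ∃ c : ℂ, c ≠ 0 ∧ ∀ z : ℍ,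
    ∏ t ∈ Finset.range l, GG (r / l : ℝ) (t / l : ℝ) z = c * (ee ((l * bern (r / l) / 2 : ℝ) * z) *
      EE (indc l r 1) (ee z) * EE (indc l (l - r) 1) (ee z)) := by
  have hl : 0 < l := by omega
  have hl' : (l : ℂ) ≠ 0 := by exact_mod_cast hl.ne'
  refine ⟨∏ t ∈ Finset.range l, kap l r t, ?_, fun z => ?_⟩
  · exact Finset.prod_ne_zero_iff.mpr fun t _ => kap_ne_zero hrl (by omega)
  have hx : ‖ee ((z : ℂ) / l)‖ < 1 := by
    apply norm_ee_lt_one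
    rw [Complex.div_natCast_im]
    exact div_pos z.2 (by exact_mod_cast hl)
  have e1 : ∀ t : ℕ, ee ((t : ℤ) / l : ℝ) = ee (1 / l) ^ t := by
    intro t
    rw [← ee_nat_mul]; congr 1; push_cast; ring
  have e2 : ∀ t : ℕ, ee (-((t : ℤ) / l : ℝ) : ℝ) = (ee (1 / l))⁻¹ ^ t := by
    intro t
    rw [← ee_neg, ← ee_nat_mul]; congr 1; push_cast; ring
  have h1 : ∀ t ∈ Finset.range l, GG (r / l : ℝ) (t / l : ℝ) z = kap l r t *
      ee ((((r / l : ℝ) ^ 2 - (r / l : ℝ) + 1 / 6) / 2 : ℝ) * z) *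
      (EE (indc l r (ee (1 / l) ^ t)) (ee (z / l)) *
        EE (indc l (l - r) ((ee (1 / l))⁻¹ ^ t)) (ee (z / l))) := by
    intro t _
    have := GG_expansion hrl (t : ℤ) z.2
    rw [e1, e2] at this
    push_cast at this ⊢
    exact this
  rw [Finset.prod_congr rfl h1, Finset.prod_mul_distrib, Finset.prod_mul_distrib,
    Finset.prod_mul_distrib, prod_EE_roots hl r (isPrimitiveRoot_ee hl) hx,
    prod_EE_roots hl (l - r) (isPrimitiveRoot_ee hl).inv hx]
  rw [Finset.prod_const, Finset.card_range, ← ee_nat_mul, ← ee_nat_mul, bern_of_lt hrl,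
    mul_div_cancel₀ _ hl']
  rw [mul_assoc, ← mul_assoc (ee _)]
  congr 4
  push_cast; ring

lemma isModularUnit_iff {f : ℍ → ℂ} : IsModularUnit f ↔
    MDifferentiable 𝓘(ℂ) 𝓘(ℂ) f ∧ (∀ z, f z ≠ 0) ∧
    (∃ N : ℕ, 0 < N ∧ ∀ A ∈ CongruenceSubgroup.Gamma N, ∀ z : ℍ, f (A • z) = f z) ∧
    (∀ A : SL(2, ℤ), ∃ α : ℝ, HasOrd (fun z => f (A • z)) α) := by
  have e : ∀ (α : ℝ) (z : ℍ), cexp (-(2 * (π : ℂ) * Complex.I * (α : ℂ) * (z : ℂ))) =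
      ee (-(α * z)) := by
    intro α z
    rw [ee]; congr 1; ring
  simp only [IsModularUnit, HasOrd, e]

lemma Gamma_mono {M N : ℕ} (h : N ∣ M) {A : SL(2, ℤ)} (hA : A ∈ CongruenceSubgroup.Gamma M) :
    A ∈ CongruenceSubgroup.Gamma N := by
  rw [CongruenceSubgroup.Gamma_mem] at hA ⊢
  have key : ∀ (x : ℤ) (y : ℤ), (x : ZMod M) = (y : ZMod M) →
      (x : ZMod N) = (y : ZMod N) := by
    intro x y h'
    rw [ZMod.intCast_eq_intCast_iff] at h' ⊢
    exact h'.of_dvd (by exact_mod_cast h)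
  obtain ⟨h1, h2, h3, h4⟩ := hA
  refine ⟨?_, ?_, ?_, ?_⟩
  · simpa using key _ 1 (by simpa using h1)
  · simpa using key _ 0 (by simpa using h2)
  · simpa using key _ 0 (by simpa using h3)
  · simpa using key _ 1 (by simpa using h4)

lemma IsModularUnit.mul {f g : ℍ → ℂ} (hf : IsModularUnit f) (hg : IsModularUnit g) :
    IsModularUnit (fun z => f z * g z) := by
  rw [isModularUnit_iff] at *
  obtain ⟨f1, f2, ⟨N, hN, f3⟩, f4⟩ := hf
  obtain ⟨g1, g2, ⟨M, hM, g3⟩, g4⟩ := hg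
  refine ⟨hol_mul f1 g1, fun z => mul_ne_zero (f2 z) (g2 z), ⟨N * M, by positivity, ?_⟩, ?_⟩
  · intro A hA z
    rw [f3 A (Gamma_mono (dvd_mul_right _ _) hA), g3 A (Gamma_mono (dvd_mul_left _ _) hA)]
  · intro A
    obtain ⟨α, hα⟩ := f4 A
    obtain ⟨β, hβ⟩ := g4 A
    exact ⟨_, hα.mul hβ⟩

lemma IsModularUnit.inv {f : ℍ → ℂ} (hf : IsModularUnit f) :
    IsModularUnit (fun z => (f z)⁻¹) := by
  rw [isModularUnit_iff] at *
  obtain ⟨f1, f2, ⟨N, hN, f3⟩, f4⟩ := hf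
  refine ⟨hol_inv f1 f2, fun z => inv_ne_zero (f2 z), ⟨N, hN, ?_⟩, ?_⟩
  · intro A hA z
    rw [f3 A hA]
  · intro A
    obtain ⟨α, hα⟩ := f4 A
    exact ⟨_, hα.inv⟩

lemma IsModularUnit.const {c : ℂ} (hc : c ≠ 0) : IsModularUnit (fun _ => c) := by
  rw [isModularUnit_iff]
  exact ⟨hol_const c, fun _ => hc, ⟨1, one_pos, fun _ _ _ => rfl⟩, fun A => ⟨0, HasOrd.const hc⟩⟩

lemma IsModularUnit.pow {f : ℍ → ℂ} (hf : IsModularUnit f) (n : ℕ) :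
    IsModularUnit (fun z => f z ^ n) := by
  induction n with
  | zero => simpa using IsModularUnit.const one_ne_zero
  | succ n ih => simpa only [pow_succ] using ih.mul hf

lemma IsModularUnit.zpow {f : ℍ → ℂ} (hf : IsModularUnit f) (n : ℤ) :
    IsModularUnit (fun z => f z ^ n) := by
  cases n with
  | ofNat n => simpa using hf.pow n
  | negSucc n => simpa only [zpow_negSucc] using (hf.pow (n + 1)).inv

lemma IsModularUnit.prod {ι : Type*} (s : Finset ι) {f : ι → ℍ → ℂ}
    (hf : ∀ i ∈ s, IsModularUnit (f i)) : IsModularUnit (fun z => ∏ i ∈ s, f i z) := by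
  classical
  induction s using Finset.induction_on with
  | empty => simpa using IsModularUnit.const one_ne_zero
  | insert a s ha ih =>
    simp only [Finset.prod_insert ha]
    exact (hf a (by simp)).mul (ih fun i hi => hf i (by simp [hi]))

lemma GG_Gamma {N : ℕ} (hN : 0 < N) (r t : ℤ) {A : SL(2, ℤ)}
    (hA : A ∈ CongruenceSubgroup.Gamma (24 * N * N)) (z : ℍ) :
    GG (r / N : ℝ) (t / N : ℝ) ((A • z : ℍ) : ℂ) = GG (r / N : ℝ) (t / N : ℝ) z := by
  have hN0 : (N : ℝ) ≠ 0 := by positivity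
  have hNc : (N : ℂ) ≠ 0 := by exact_mod_cast hN.ne'
  rw [GG_smul, chi_Gamma (Gamma_mono ⟨2 * N * N, by ring⟩ hA), one_mul]
  rw [CongruenceSubgroup.Gamma_mem] at hA
  obtain ⟨h1, h2, h3, h4⟩ := hA
  have key : ∀ (x y : ℤ), (x : ZMod (24 * N * N)) = (y : ℤ) → ∃ k : ℤ, x = y + 24 * N * N * k := by
    intro x y h
    have := (ZMod.intCast_eq_intCast_iff _ _ _).1 h
    obtain ⟨k, hk⟩ := this.symm.dvd
    exact ⟨k, by push_cast at hk; linarith⟩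
  obtain ⟨a, ha⟩ := key _ 1 (by simpa using h1)
  obtain ⟨b, hb⟩ := key _ 0 (by simpa using h2)
  obtain ⟨c, hc⟩ := key _ 0 (by simpa using h3)
  obtain ⟨d, hd⟩ := key _ 1 (by simpa using h4)
  rw [ha, hb, hc, hd]
  have e1 : (r / N : ℝ) * ((1 + 24 * N * N * a : ℤ) : ℝ) + (t / N : ℝ) * ((0 + 24 * N * N * c : ℤ) : ℝ) =
      (r / N : ℝ) + ((2 * N * (12 * (r * a + t * c)) : ℤ) : ℝ) := by
    push_cast; field_simp; ring
  have e2 : (r / N : ℝ) * ((0 + 24 * N * N * b : ℤ) : ℝ) + (t / N : ℝ) * ((1 + 24 * N * N * d : ℤ) : ℝ) =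
      (t / N : ℝ) + ((2 * N * (12 * (r * b + t * d)) : ℤ) : ℝ) := by
    push_cast; field_simp; ring
  rw [e1, e2, GG_add_int_left _ _ _ z.im_pos, GG_add_int_right]
  have e3 : ∀ k : ℤ, (((2 * N * (12 * (r * b + t * d)) : ℤ) : ℂ)) * ((((r / N : ℝ) : ℂ) - 1) / 2) =
      ((12 * (r * b + t * d) * (r - N) : ℤ) : ℂ) := by
    intro k; push_cast; field_simp
  have e4 : (((2 * N * (12 * (r * a + t * c)) : ℤ) : ℂ)) * ((1 - (((t / N : ℝ) + ((2 * N * (12 * (r * b + t * d)) : ℤ) : ℝ) : ℝ) : ℂ)) / 2) =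
      ((12 * (r * a + t * c) * (N - t - N * (2 * N * (12 * (r * b + t * d)))) : ℤ) : ℂ) := by
    push_cast; field_simp; ring
  rw [e3 0, e4, ee_int, ee_int]; simp

lemma GG_unit {N : ℕ} (hN : 0 < N) {r t : ℤ} (h : ¬ ((N : ℤ) ∣ r ∧ (N : ℤ) ∣ t)) :
    IsModularUnit (fun z : ℍ => GG (r / N : ℝ) (t / N : ℝ) z) := by
  rw [isModularUnit_iff]
  refine ⟨GG_hol hN r t, GG_ne_zero hN h, ⟨24 * N * N, by positivity, fun A hA z => GG_Gamma hN r t hA z⟩, ?_⟩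
  intro A
  have := (GG_ord hN (row_ne_zero h A)).const_mul (chi_ne_zero A)
  refine ⟨_, this.congr ?_⟩
  intro z
  beta_reduce
  rw [GG_smul]
  congr 2 <;> push_cast <;> ring

/-- rational q-expansion with nonvanishing leading coefficient one -/
def RatQ (f : ℍ → ℂ) : Prop := ∃ (s : ℚ) (p : PowerSeries ℂ) (g : ℂ → ℂ), HP p g ∧ p ∈ InS QR ∧
  PowerSeries.constantCoeff p = 1 ∧ (∀ x, ‖x‖ < 1 → g x ≠ 0) ∧ ∀ z : ℍ, f z = ee (s * z) * g (ee z)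

lemma RatQ.mul {f g : ℍ → ℂ} (hf : RatQ f) (hg : RatQ g) : RatQ (fun z => f z * g z) := by
  obtain ⟨s, p, F, h1, h2, h3, h4, h5⟩ := hf
  obtain ⟨s', p', F', h1', h2', h3', h4', h5'⟩ := hg
  refine ⟨s + s', p * p', _, h1.mul h1', mul_mem h2 h2', by simp [h3, h3'],
    fun x hx => mul_ne_zero (h4 x hx) (h4' x hx), fun z => ?_⟩
  beta_reduce
  rw [h5, h5']; push_cast; rw [add_mul, ee_add]; ring

lemma RatQ.inv {f : ℍ → ℂ} (hf : RatQ f) : RatQ (fun z => (f z)⁻¹) := by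
  obtain ⟨s, p, F, h1, h2, h3, h4, h5⟩ := hf
  refine ⟨-s, p⁻¹, _, h1.inv h4, InS_inv h2 h3, by simp [h3],
    fun x hx => inv_ne_zero (h4 x hx), fun z => ?_⟩
  beta_reduce
  rw [h5]; push_cast; rw [neg_mul, ee_neg, mul_inv]

lemma RatQ.one : RatQ (fun _ => 1) :=
  ⟨0, 1, _, HP.one, one_mem _, by simp, fun _ _ => one_ne_zero, fun z => by simp [ee_zero]⟩

lemma RatQ.pow {f : ℍ → ℂ} (hf : RatQ f) (n : ℕ) : RatQ (fun z => f z ^ n) := by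
  induction n with
  | zero => simpa using RatQ.one
  | succ n ih => simpa only [pow_succ] using ih.mul hf

lemma RatQ.zpow {f : ℍ → ℂ} (hf : RatQ f) (n : ℤ) : RatQ (fun z => f z ^ n) := by
  cases n with
  | ofNat n => simpa using hf.pow n
  | negSucc n => simpa only [zpow_negSucc] using (hf.pow (n + 1)).inv

lemma RatQ.prod {ι : Type*} (s : Finset ι) {f : ι → ℍ → ℂ}
    (hf : ∀ i ∈ s, RatQ (f i)) : RatQ (fun z => ∏ i ∈ s, f i z) := by
  classical
  induction s using Finset.induction_on with
  | empty => simpa using RatQ.one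
  | insert a s ha ih =>
    simp only [Finset.prod_insert ha]
    exact (hf a (by simp)).mul (ih fun i hi => hf i (by simp [hi]))

lemma bern_rat {l r : ℕ} (h : r < l) : ∃ s : ℚ, (l * bern (r / l : ℝ) / 2 : ℝ) = s := by
  rw [bern_of_lt h]
  exact ⟨l * ((r / l) ^ 2 - r / l + 1 / 6) / 2, by push_cast; rfl⟩

lemma rl_ratQ {l : ℕ} (hl : 0 < l) {r : ℤ} (h : ¬ (l : ℤ) ∣ r) : RatQ (rl l r) := by
  obtain ⟨r', h1, h2, -, h3⟩ := rl_eq hl h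
  obtain ⟨s, hs⟩ := bern_rat h2
  have n1 := indc_norm l r' (z := 1) (by simp)
  have n2 := indc_norm l (l - r') (z := 1) (by simp)
  refine ⟨-s, (Ep (indc l r' 1))⁻¹ * (Ep (indc l (l - r') 1))⁻¹, _,
    ((HP_Ep n1).inv (fun x hx => EE_ne_zero n1 hx)).mul ((HP_Ep n2).inv (fun x hx => EE_ne_zero n2 hx)),
    mul_mem (InS_inv (InS_Ep (indc_one_mem _ _ _)) (constantCoeff_Ep _)) (InS_inv (InS_Ep (indc_one_mem _ _ _)) (constantCoeff_Ep _)),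
    by simp [constantCoeff_Ep], fun x hx => mul_ne_zero (inv_ne_zero (EE_ne_zero n1 hx)) (inv_ne_zero (EE_ne_zero n2 hx)), fun z => ?_⟩
  rw [h3, hs]; push_cast; ring

lemma rl_unit {l : ℕ} (hl : 0 < l) {r : ℤ} (h : ¬ (l : ℤ) ∣ r) : IsModularUnit (rl l r) := by
  obtain ⟨r', h1, h2, -, h3⟩ := rl_eq hl h
  obtain ⟨c, hc, h4⟩ := prod_GG h1 h2
  have h5 : IsModularUnit (fun z : ℍ => ∏ t ∈ Finset.range l, GG (((r' : ℕ) : ℤ) / l : ℝ) (((t : ℕ) : ℤ) / l : ℝ) z) := by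
    refine IsModularUnit.prod _ fun t _ => GG_unit hl ?_
    rintro ⟨h6, -⟩
    exact absurd (Nat.le_of_dvd h1 (by exact_mod_cast h6)) (by omega)
  have h6 := (IsModularUnit.const hc).mul h5.inv
  have : rl l r = (fun z : ℍ => c * (∏ t ∈ Finset.range l, GG (((r' : ℕ) : ℤ) / l : ℝ) (((t : ℕ) : ℤ) / l : ℝ) z)⁻¹) := by
    funext z
    simp only [Int.cast_natCast]
    rw [h4, h3, mul_inv, ← mul_assoc, mul_inv_cancel₀ hc, one_mul, mul_inv, mul_inv, ← ee_neg]
    push_cast; rw [neg_mul]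
  rw [this]; exact h6

lemma forward {f : ℍ → ℂ} (h : ∃ γ : ℚ, γ ≠ 0 ∧ ∃ (k : ℕ) (r L m : Fin k → ℤ),
    (∀ i, 1 ≤ L i ∧ ¬ L i ∣ r i) ∧ ∀ z, f z = (γ : ℂ) * ∏ i, rl (L i) (r i) z ^ m i) :
    IsModularUnit f ∧ ∃ (s : ℚ) (c : ℕ → ℚ), ∀ z : ℍ,
      f z * cexp (-(2 * (π : ℂ) * Complex.I * (s : ℂ) * (z : ℂ))) =
        ∑' n : ℕ, (c n : ℂ) * cexp (2 * (π : ℂ) * Complex.I * (n : ℂ) * (z : ℂ)) := by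
  obtain ⟨γ, hγ, k, r, L, m, h1, h2⟩ := h
  have hL : ∀ i, ∃ l : ℕ, 0 < l ∧ L i = l := fun i =>
    ⟨(L i).toNat, by have := (h1 i).1; omega, by have := (h1 i).1; omega⟩
  choose l hl hl' using hL
  have h3 : ∀ i, ¬ (l i : ℤ) ∣ r i := fun i => hl' i ▸ (h1 i).2
  simp only [hl'] at h2
  constructor
  · rw [show f = fun z => (γ : ℂ) * ∏ i, rl (l i) (r i) z ^ m i from funext h2]
    exact (IsModularUnit.const (by exact_mod_cast hγ)).mul
      (IsModularUnit.prod _ fun i _ => (rl_unit (hl i) (h3 i)).zpow _)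
  · obtain ⟨s, p, g, g1, g2, g3, g4, g5⟩ := RatQ.prod Finset.univ fun i _ => (rl_ratQ (hl i) (h3 i)).zpow (m i)
    choose c hc using fun n => (mem_InS.1 g2 n)
    refine ⟨s, fun n => γ * c n, fun z => ?_⟩
    have e1 : cexp (-(2 * (π : ℂ) * Complex.I * (s : ℂ) * (z : ℂ))) = ee (-(s * z)) := by
      rw [ee]; congr 1; ring
    have e2 : ∀ n : ℕ, cexp (2 * (π : ℂ) * Complex.I * (n : ℂ) * (z : ℂ)) = ee z ^ n := by
      intro n; rw [← ee_nat_mul, ee]; congr 1; ring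
    simp only [e2]
    rw [h2, e1]
    have g6 := g5 z
    beta_reduce at g6
    rw [g6, ee_neg]
    have := (g1 (ee z) (norm_ee_lt_one z.im_pos)).tsum_eq
    rw [← this, show ∀ a b c : ℂ, a * (b * c) * b⁻¹ = (b * b⁻¹) * (a * c) by intros; ring,
      mul_inv_cancel₀ (ee_ne_zero _), one_mul, ← tsum_mul_left]
    refine tsum_congr fun n => ?_
    rw [← hc]; push_cast; simp [mul_assoc]

lemma mulTk_entries (A : SL(2, ℤ)) (k : ℤ) (i : Fin 2) :
    (A * ModularGroup.T ^ k) i 0 = A i 0 ∧ (A * ModularGroup.T ^ k) i 1 = A i 0 * k + A i 1 := by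
  have h : ((A * ModularGroup.T ^ k : SL(2, ℤ)) : Matrix (Fin 2) (Fin 2) ℤ) =
      (A : Matrix (Fin 2) (Fin 2) ℤ) * !![1, k; 0, 1] := by
    rw [← ModularGroup.coe_T_zpow]; rfl
  constructor
  · change ((A * ModularGroup.T ^ k : SL(2, ℤ)) : Matrix (Fin 2) (Fin 2) ℤ) i 0 = _
    rw [h]; simp [Matrix.mul_apply, Fin.sum_univ_two]
  · change ((A * ModularGroup.T ^ k : SL(2, ℤ)) : Matrix (Fin 2) (Fin 2) ℤ) i 1 = _
    rw [h]; simp [Matrix.mul_apply, Fin.sum_univ_two]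

lemma Gamma_of_col {N : ℕ} {A A' : SL(2, ℤ)} (h0 : ((A 0 0 : ℤ) : ZMod N) = (A' 0 0 : ℤ))
    (h1 : ((A 1 0 : ℤ) : ZMod N) = (A' 1 0 : ℤ)) :
    ∃ k : ℤ, A' * (A * ModularGroup.T ^ k)⁻¹ ∈ CongruenceSubgroup.Gamma N := by
  refine ⟨A 1 1 * A' 0 1 - A 0 1 * A' 1 1, ?_⟩
  rw [CongruenceSubgroup.Gamma_mem', map_mul, map_inv, mul_inv_eq_one]
  have d := SL_det_zmod N A
  have d' := SL_det_zmod N A'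
  have e := mulTk_entries A (A 1 1 * A' 0 1 - A 0 1 * A' 1 1)
  rw [← h0, ← h1] at d'
  set B := A * ModularGroup.T ^ (A 1 1 * A' 0 1 - A 0 1 * A' 1 1) with hB
  ext i j
  change ((A' i j : ℤ) : ZMod N) = ((B i j : ℤ) : ZMod N)
  fin_cases i <;> fin_cases j <;> simp only [Fin.zero_eta, Fin.mk_one, Fin.isValue]
  · rw [(e 0).1]; exact h0.symm
  · rw [(e 0).2]; push_cast
    linear_combination (-(A' 0 1 : ZMod N)) * d + (A 0 1 : ZMod N) * d'
  · rw [(e 1).1]; exact h1.symm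
  · rw [(e 1).2]; push_cast
    linear_combination (-(A' 1 1 : ZMod N)) * d + (A 1 1 : ZMod N) * d'

lemma ord_col {N : ℕ} {f : ℍ → ℂ}
    (inv : ∀ A ∈ CongruenceSubgroup.Gamma N, ∀ z : ℍ, f (A • z) = f z) {A A' : SL(2, ℤ)}
    (h0 : ((A 0 0 : ℤ) : ZMod N) = (A' 0 0 : ℤ))
    (h1 : ((A 1 0 : ℤ) : ZMod N) = (A' 1 0 : ℤ)) {α : ℝ} (h : HasOrd (fun z => f (A • z)) α) :
    HasOrd (fun z => f (A' • z)) α := by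
  obtain ⟨k, hk⟩ := Gamma_of_col h0 h1
  refine (h.shift k).congr fun z => ?_
  beta_reduce
  rw [← modular_T_zpow_smul, ← mul_smul, ← inv _ hk ((A * ModularGroup.T ^ k) • z), ← mul_smul, inv_mul_cancel_right]

lemma ord_int {N : ℕ} {f : ℍ → ℂ}
    (inv : ∀ A ∈ CongruenceSubgroup.Gamma N, ∀ z : ℍ, f (A • z) = f z) {A : SL(2, ℤ)}
    {α : ℝ} (h : HasOrd (fun z => f (A • z)) α) : ∃ n : ℤ, α * N = n := by
  have := h.int_of_periodic N ?_
  · exact_mod_cast this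
  intro z
  beta_reduce
  rw [← modular_T_zpow_smul, ← mul_smul]
  have hT : ModularGroup.T ^ (N : ℤ) ∈ CongruenceSubgroup.Gamma N := by
    rw [CongruenceSubgroup.Gamma_mem, ModularGroup.coe_T_zpow]
    simp
  have := inv _ ((CongruenceSubgroup.Gamma_normal N).conj_mem _ hT A) (A • z)
  rw [← mul_smul] at this
  rwa [inv_mul_cancel_right] at this

lemma neg_smul_H (A : SL(2, ℤ)) (z : ℍ) : (-A) • z = A • z := by
  simp

lemma ord_neg {f : ℍ → ℂ} {A : SL(2, ℤ)} {α : ℝ} (h : HasOrd (fun z => f (A • z)) α) :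
    HasOrd (fun z => f ((-A) • z)) α :=
  h.congr fun z => by rw [neg_smul_H]

/-- Bernoulli function on `ZMod N` -/
def bz {N : ℕ} (y : ZMod N) : ℝ := bern (y.val / N)

lemma bz_intCast {N : ℕ} [NeZero N] (k : ℤ) : bz (k : ZMod N) = bern (k / N : ℝ) := by
  rw [bz]
  have h : ((((k : ZMod N).val : ℕ) : ℤ)) = k % N := ZMod.val_intCast k
  have hN : (N : ℝ) ≠ 0 := by exact_mod_cast NeZero.ne N
  have h2 : (k : ℝ) / N = ((k : ZMod N).val : ℝ) / N + ((k / N : ℤ) : ℝ) := by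
    have h3 : (k : ℝ) = (((k : ZMod N).val : ℕ) : ℝ) + N * ((k / N : ℤ) : ℝ) := by
      have : (k : ℤ) = (((k : ZMod N).val : ℕ) : ℤ) + N * (k / N) := by
        rw [h]; exact (Int.emod_add_mul_ediv k N).symm
      exact_mod_cast this
    rw [div_add' _ _ _ hN, mul_comm _ (N : ℝ), ← h3]
  rw [h2, bern_add_int]

lemma bz_neg {N : ℕ} [NeZero N] (y : ZMod N) : bz (-y) = bz y := by
  obtain ⟨k, rfl⟩ := ZMod.intCast_surjective y
  rw [← Int.cast_neg, bz_intCast, bz_intCast, Int.cast_neg, neg_div, bern_neg]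

lemma bz_rat {N : ℕ} [NeZero N] (y : ZMod N) : ∃ q : ℚ, bz y = q := by
  rw [bz, bern_of_lt (ZMod.val_lt y)]
  exact ⟨(y.val / N) ^ 2 - y.val / N + 1 / 6, by push_cast; rfl⟩

lemma hasSum_bern {x : ℝ} (h0 : 0 ≤ x) (h1 : x < 1) :
    HasSum (fun n : ℕ => 1 / (n : ℝ) ^ 2 * Real.cos (2 * π * n * x)) (π ^ 2 * bern x) := by
  have h := hasSum_one_div_nat_pow_mul_cos (k := 1) one_ne_zero (x := x) ⟨h0, h1.le⟩
  have e : bern x = x ^ 2 - x + 1 / 6 := by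
    rw [bern, Int.fract_eq_self.2 ⟨h0, h1⟩]
  have e2 : ((-1 : ℝ) ^ (1 + 1) * (2 * π) ^ (2 * 1) / 2 / (Nat.factorial (2 * 1)) *
        (Polynomial.map (algebraMap ℚ ℝ) (Polynomial.bernoulli (2 * 1))).eval x) = π ^ 2 * bern x := by
    rw [e]
    simp [Polynomial.bernoulli, Finset.sum_range_succ, Polynomial.eval_add, bernoulli_one, bernoulli_two, Nat.factorial]
    ring
  rw [e2] at h
  simpa using h

lemma hasSum_bz {N : ℕ} [NeZero N] (y : ZMod N) :
    HasSum (fun n : ℕ => (1 / (n : ℂ) ^ 2) * ((ZMod.stdAddChar ((n : ZMod N) * y) : ℂ) + ZMod.stdAddChar (-((n : ZMod N) * y))))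
      ((2 * π ^ 2 * bz y : ℝ) : ℂ) := by
  have hN : (0 : ℝ) < N := by exact_mod_cast (NeZero.pos N)
  have h := hasSum_bern (x := y.val / N) (by positivity) (by
    rw [div_lt_one hN]; exact_mod_cast ZMod.val_lt y)
  have h2 := (Complex.hasSum_ofReal.2 h).mul_left 2
  rw [bz]
  have e3 : ((2 * π ^ 2 * bern (y.val / N) : ℝ) : ℂ) = 2 * ((π ^ 2 * bern (y.val / N) : ℝ) : ℂ) := by
    push_cast; ring
  rw [e3]
  refine h2.congr_fun ?_
  intro n
  have e4 : (n : ZMod N) * y = (((n * y.val : ℕ) : ℤ) : ZMod N) := by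
    push_cast; simp
  rw [e4, ← Int.cast_neg, ZMod.stdAddChar_coe, ZMod.stdAddChar_coe]
  push_cast
  rw [Complex.cos]
  have : ∀ a b c d : ℂ, a = c → b = d → 2 * (1 / (n : ℂ) ^ 2 * ((cexp a + cexp b) / 2)) = 1 / (n : ℂ) ^ 2 * (cexp c + cexp d) := by
    rintro a b _ _ rfl rfl; ring
  rw [eq_comm]
  refine this _ _ _ _ ?_ ?_ <;> ring

lemma sum_char {N : ℕ} [NeZero N] (a b : ZMod N) :
    ∑ v : ZMod N × ZMod N, (ZMod.stdAddChar (v.1 * a + v.2 * b) : ℂ) =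
      if (a, b) = (0, 0) then (N : ℂ) ^ 2 else 0 := by
  have hp := ZMod.isPrimitive_stdAddChar N
  rw [Fintype.sum_prod_type]
  simp only [AddChar.map_add_eq_mul]
  simp only [← Finset.mul_sum, ← Finset.sum_mul]
  rw [AddChar.sum_mulShift a hp, AddChar.sum_mulShift b hp]
  by_cases ha : a = 0 <;> by_cases hb : b = 0 <;> simp [ha, hb, ZMod.card, sq]

lemma fourier_key {N : ℕ} [NeZero N] (μ : ZMod N × ZMod N → ℝ)
    (h : ∀ v : ZMod N × ZMod N, ∑ x, μ x * bz (v.1 * x.1 + v.2 * x.2) = 0) (w : ZMod N × ZMod N) :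
    HasSum (fun n : ℕ => 1 / (n : ℝ) ^ 2 * ∑ x : ZMod N × ZMod N,
      if ((n : ZMod N) * x.1, (n : ZMod N) * x.2) = w then μ x + μ (-x) else 0) 0 := by
  have h1 : ∀ v : ZMod N × ZMod N, HasSum (fun n : ℕ => ∑ x : ZMod N × ZMod N, (ZMod.stdAddChar (-(v.1 * w.1 + v.2 * w.2)) : ℂ) *
      ((μ x : ℂ) * ((1 / (n : ℂ) ^ 2) * (ZMod.stdAddChar ((n : ZMod N) * (v.1 * x.1 + v.2 * x.2)) +
        ZMod.stdAddChar (-((n : ZMod N) * (v.1 * x.1 + v.2 * x.2))))))) 0 := by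
    intro v
    have := hasSum_sum (s := Finset.univ) (fun (x : ZMod N × ZMod N) _ =>
      ((hasSum_bz (v.1 * x.1 + v.2 * x.2)).mul_left (μ x : ℂ)).mul_left (ZMod.stdAddChar (-(v.1 * w.1 + v.2 * w.2)) : ℂ))
    have e : ∑ x : ZMod N × ZMod N, (ZMod.stdAddChar (-(v.1 * w.1 + v.2 * w.2)) : ℂ) * ((μ x : ℂ) * ((2 * π ^ 2 * bz (v.1 * x.1 + v.2 * x.2) : ℝ) : ℂ)) = 0 := by
      rw [← Finset.mul_sum]
      have h2 := h v
      have : ∑ x : ZMod N × ZMod N, ((μ x : ℂ) * ((2 * π ^ 2 * bz (v.1 * x.1 + v.2 * x.2) : ℝ) : ℂ)) =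
        2 * π ^ 2 * ((∑ x, μ x * bz (v.1 * x.1 + v.2 * x.2) : ℝ) : ℂ) := by
        push_cast; rw [Finset.mul_sum]
        refine Finset.sum_congr rfl fun x _ => ?_
        ring
      rw [this, h2]; simp
    rw [e] at this
    exact this
  have h2 := hasSum_sum (s := Finset.univ) (fun v _ => h1 v)
  simp only [Finset.sum_const_zero] at h2
  have h3 := h2.mul_left (1 / (N : ℂ) ^ 2)
  rw [mul_zero] at h3
  rw [← Complex.hasSum_ofReal]
  simp only [Complex.ofReal_zero]
  refine h3.congr_fun fun n => ?_
  have hN0 : (N : ℂ) ≠ 0 := by exact_mod_cast NeZero.ne N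
  rw [Finset.sum_comm]
  have key : ∀ x : ZMod N × ZMod N, ∑ v : ZMod N × ZMod N, (ZMod.stdAddChar (-(v.1 * w.1 + v.2 * w.2)) : ℂ) *
      ((μ x : ℂ) * ((1 / (n : ℂ) ^ 2) * (ZMod.stdAddChar ((n : ZMod N) * (v.1 * x.1 + v.2 * x.2)) +
        ZMod.stdAddChar (-((n : ZMod N) * (v.1 * x.1 + v.2 * x.2)))))) =
      (N : ℂ) ^ 2 * (1 / (n : ℂ) ^ 2 * ((if ((n : ZMod N) * x.1, (n : ZMod N) * x.2) = w then (μ x : ℂ) else 0) +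
       (if ((n : ZMod N) * (-x).1, (n : ZMod N) * (-x).2) = w then (μ x : ℂ) else 0))) := by
    intro x
    have e1 := sum_char ((n : ZMod N) * x.1 - w.1) ((n : ZMod N) * x.2 - w.2)
    have e2 := sum_char ((n : ZMod N) * (-x).1 - w.1) ((n : ZMod N) * (-x).2 - w.2)
    have c1 : (((n : ZMod N) * x.1 - w.1, (n : ZMod N) * x.2 - w.2) = ((0 : ZMod N), (0 : ZMod N))) ↔
       ((n : ZMod N) * x.1, (n : ZMod N) * x.2) = w := by
      rw [Prod.ext_iff, Prod.ext_iff]; simp [sub_eq_zero]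
    have c2 : (((n : ZMod N) * (-x).1 - w.1, (n : ZMod N) * (-x).2 - w.2) = ((0 : ZMod N), (0 : ZMod N))) ↔
       ((n : ZMod N) * (-x).1, (n : ZMod N) * (-x).2) = w := by
      rw [Prod.ext_iff, Prod.ext_iff]; simp [sub_eq_zero]
    rw [if_congr c1 rfl rfl] at e1
    rw [if_congr c2 rfl rfl] at e2
    have e3 : ∀ v : ZMod N × ZMod N, (ZMod.stdAddChar (-(v.1 * w.1 + v.2 * w.2)) : ℂ) *
      ((μ x : ℂ) * ((1 / (n : ℂ) ^ 2) * (ZMod.stdAddChar ((n : ZMod N) * (v.1 * x.1 + v.2 * x.2)) +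
        ZMod.stdAddChar (-((n : ZMod N) * (v.1 * x.1 + v.2 * x.2)))))) =
       (μ x : ℂ) * (1 / (n : ℂ) ^ 2) * (ZMod.stdAddChar (v.1 * ((n : ZMod N) * x.1 - w.1) + v.2 * ((n : ZMod N) * x.2 - w.2)) +
        ZMod.stdAddChar (v.1 * ((n : ZMod N) * (-x).1 - w.1) + v.2 * ((n : ZMod N) * (-x).2 - w.2))) := by
      intro v
      have a1 : v.1 * ((n : ZMod N) * x.1 - w.1) + v.2 * ((n : ZMod N) * x.2 - w.2) =
        -(v.1 * w.1 + v.2 * w.2) + (n : ZMod N) * (v.1 * x.1 + v.2 * x.2) := by ring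
      have a2 : v.1 * ((n : ZMod N) * (-x).1 - w.1) + v.2 * ((n : ZMod N) * (-x).2 - w.2) =
        -(v.1 * w.1 + v.2 * w.2) + -((n : ZMod N) * (v.1 * x.1 + v.2 * x.2)) := by simp; ring
      rw [a1, a2, AddChar.map_add_eq_mul, AddChar.map_add_eq_mul]; ring
    rw [Finset.sum_congr rfl fun v _ => e3 v, ← Finset.mul_sum, Finset.sum_add_distrib, e1, e2]
    split_ifs <;> ring
  rw [Finset.sum_congr rfl fun x _ => key x, ← Finset.mul_sum, ← mul_assoc, one_div_mul_cancel (pow_ne_zero _ hN0), one_mul,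
    ← Finset.mul_sum, Finset.sum_add_distrib]
  have e5 := Equiv.sum_comp (Equiv.neg (ZMod N × ZMod N)) (fun x : ZMod N × ZMod N =>
    if ((n : ZMod N) * x.1, (n : ZMod N) * x.2) = w then (μ (-x) : ℂ) else 0)
  simp only [Equiv.neg_apply, neg_neg] at e5
  rw [e5]
  push_cast
  rw [← Finset.sum_add_distrib]
  congr 1
  refine Finset.sum_congr rfl fun x _ => ?_
  split_ifs <;> simp

lemma even_part_zero {N : ℕ} [NeZero N] (μ : ZMod N × ZMod N → ℝ)
    (h : ∀ v : ZMod N × ZMod N, ∑ x, μ x * bz (v.1 * x.1 + v.2 * x.2) = 0)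
    (hs : ∀ x, μ x ≠ 0 → ∃ c d, c * x.1 + d * x.2 = 1) (x : ZMod N × ZMod N) :
    μ x + μ (-x) = 0 := by
  obtain ⟨w, -, hw⟩ := Finset.exists_max_image Finset.univ (fun x : ZMod N × ZMod N => |μ x + μ (-x)|) ⟨0, by simp⟩
  set M := |μ w + μ (-w)| with hM
  suffices hM0 : M ≤ 0 by
    have := hw x (by simp)
    exact abs_nonpos_iff.1 (this.trans hM0)
  by_cases hw0 : μ w + μ (-w) = 0
  · rw [hM, hw0]; simp
  have hc : ∃ c d, c * w.1 + d * w.2 = 1 := by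
    by_cases h1 : μ w = 0
    · have h2 : μ (-w) ≠ 0 := fun h2 => hw0 (by rw [h1, h2, add_zero])
      obtain ⟨c, d, hcd⟩ := hs _ h2
      exact ⟨-c, -d, by rw [← hcd]; simp⟩
    · exact hs _ h1
  obtain ⟨c, d, hcd⟩ := hc
  have hsum := fourier_key μ h w
  set S : ℕ → ℝ := fun n => ∑ x : ZMod N × ZMod N,
      if ((n : ZMod N) * x.1, (n : ZMod N) * x.2) = w then μ x + μ (-x) else 0 with hS
  have hS1 : S 1 = μ w + μ (-w) := by
    simp [hS]
  have hSn : ∀ n, |S n| ≤ M := by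
    intro n
    have huniq : ∀ x : ZMod N × ZMod N, ((n : ZMod N) * x.1, (n : ZMod N) * x.2) = w →
        S n = μ x + μ (-x) := by
      intro x hx
      rw [hS]; beta_reduce
      rw [Finset.sum_eq_single x]
      · rw [if_pos hx]
      · intro y _ hy
        rw [if_neg]
        intro hy'
        apply hy
        have hu : (n : ZMod N) * (c * x.1 + d * x.2) = 1 := by
          rw [← hcd, ← hx]; ring
        have h1 : (n : ZMod N) * x.1 = n * y.1 := by
          have := (hx.trans hy'.symm); exact (Prod.ext_iff.1 this).1
        have h2 : (n : ZMod N) * x.2 = n * y.2 := by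
          have := (hx.trans hy'.symm); exact (Prod.ext_iff.1 this).2
        ext
        · linear_combination (x.1 - y.1) * hu - (c * x.1 + d * x.2) * h1
        · linear_combination (x.2 - y.2) * hu - (c * x.1 + d * x.2) * h2
      · simp
    by_cases hex : ∃ x : ZMod N × ZMod N, ((n : ZMod N) * x.1, (n : ZMod N) * x.2) = w
    · obtain ⟨x, hx⟩ := hex
      rw [huniq x hx]; exact hw x (by simp)
    · have : S n = 0 := by
        rw [hS]; beta_reduce
        apply Finset.sum_eq_zero
        intro x _
        rw [if_neg (fun hx => hex ⟨x, hx⟩)]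
      rw [this]; simp [hM]
  obtain ⟨σ, hσ, hσ1⟩ : ∃ σ : ℝ, |σ| = 1 ∧ σ * S 1 = M := by
    rcases le_total 0 (S 1) with h0 | h0
    · exact ⟨1, by simp, by rw [hM, ← hS1, abs_of_nonneg h0]; ring⟩
    · exact ⟨-1, by simp, by rw [hM, ← hS1, abs_of_nonpos h0]; ring⟩
  have hz := hasSum_zeta_two
  have h4 := (hz.mul_left M).add (hsum.mul_left σ)
  have h5 := le_hasSum h4 1 (by
    intro j _
    have : |σ * S j| ≤ M := by rw [abs_mul, hσ, one_mul]; exact hSn j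
    have h6 := (abs_le.1 this).1
    have : M * (1 / (j : ℝ) ^ 2) + σ * (1 / (j : ℝ) ^ 2 * S j) = (1 / (j : ℝ) ^ 2) * (M + σ * S j) := by ring
    rw [this]
    exact mul_nonneg (by positivity) (by linarith))
  change M * (1 / ((1 : ℕ) : ℝ) ^ 2) + σ * (1 / ((1 : ℕ) : ℝ) ^ 2 * S 1) ≤ _ at h5
  simp only [Nat.cast_one, one_pow, div_one, one_mul, mul_one, hσ1, mul_zero, add_zero] at h5
  have hpi : π ^ 2 / 6 < 2 := by
    have := Real.pi_lt_d2
    have := Real.pi_pos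
    nlinarith
  have h7 : 2 * M ≤ M * (π ^ 2 / 6) := by linarith [h5]
  nlinarith

/-- first column modulo `N` -/
def fcol (N : ℕ) (A : SL(2, ℤ)) : ZMod N × ZMod N := ((A 0 0 : ℤ), (A 1 0 : ℤ))

lemma fcol_neg (N : ℕ) (A : SL(2, ℤ)) : fcol N (-A) = -fcol N A := by
  simp [fcol]

lemma fcol_unimodular {N : ℕ} (A : SL(2, ℤ)) : ∃ c d, c * (fcol N A).1 + d * (fcol N A).2 = 1 :=
  ⟨(A 1 1 : ℤ), -(A 0 1 : ℤ), by
    have := SL_det_zmod N A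
    simp only [fcol]; linear_combination this⟩

lemma exists_alpha {N : ℕ} [NeZero N] {f : ℍ → ℂ}
    (inv : ∀ A ∈ CongruenceSubgroup.Gamma N, ∀ z : ℍ, f (A • z) = f z)
    (ord : ∀ A : SL(2, ℤ), ∃ α : ℝ, HasOrd (fun z => f (A • z)) α) :
    ∃ α : ZMod N × ZMod N → ℚ, (∀ A, HasOrd (fun z => f (A • z)) (α (fcol N A))) ∧
      (∀ x, α (-x) = α x) ∧ ∀ x, (¬ ∃ A, fcol N A = x) → α x = 0 := by
  classical
  have h1 : ∀ A : SL(2, ℤ), ∃ α : ℚ, HasOrd (fun z => f (A • z)) α := by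
    intro A
    obtain ⟨α, hα⟩ := ord A
    obtain ⟨n, hn⟩ := ord_int inv hα
    refine ⟨n / N, ?_⟩
    have hN : (N : ℝ) ≠ 0 := by exact_mod_cast NeZero.ne N
    have : ((n / N : ℚ) : ℝ) = α := by push_cast; rw [← hn]; field_simp
    rwa [this]
  choose a ha using h1
  have key : ∀ A A' : SL(2, ℤ), fcol N A = fcol N A' → a A = a A' := by
    intro A A' h
    have := (ord_col inv (Prod.ext_iff.1 h).1 (Prod.ext_iff.1 h).2 (ha A)).unique (ha A')
    exact_mod_cast this
  have key2 : ∀ A : SL(2, ℤ), a (-A) = a A := by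
    intro A
    have := (ord_neg (ha A)).unique (ha (-A))
    exact_mod_cast this.symm
  refine ⟨fun x => if h : ∃ A, fcol N A = x then a h.choose else 0, ?_, ?_, ?_⟩
  · intro A
    have h : ∃ B, fcol N B = fcol N A := ⟨A, rfl⟩
    beta_reduce
    rw [dif_pos h, key _ _ h.choose_spec]
    exact ha A
  · intro x
    beta_reduce
    by_cases h : ∃ A, fcol N A = x
    · have h' : ∃ A, fcol N A = -x := by
        obtain ⟨A, hA⟩ := h
        exact ⟨-A, by rw [fcol_neg, hA]⟩
      rw [dif_pos h, dif_pos h', ← key2 h.choose]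
      apply key
      rw [h'.choose_spec, fcol_neg, h.choose_spec]
    · have h' : ¬ ∃ A, fcol N A = -x := by
        rintro ⟨A, hA⟩
        exact h ⟨-A, by rw [fcol_neg, hA, neg_neg]⟩
      rw [dif_neg h, dif_neg h']
  · intro x h
    beta_reduce
    rw [dif_neg h]

lemma exists_combination {N : ℕ} [NeZero N] (α : ZMod N × ZMod N → ℚ)
    (he : ∀ x, α (-x) = α x) (h0 : ∀ x, (¬ ∃ A, fcol N A = x) → α x = 0) :
    ∃ m : ZMod N × ZMod N → ℚ, ∀ A : SL(2, ℤ), (α (fcol N A) : ℝ) =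
      ∑ v, (m v : ℝ) * bz (v.1 * (fcol N A).1 + v.2 * (fcol N A).2) := by
  classical
  choose β hβ using fun y : ZMod N => bz_rat y
  set b : ZMod N × ZMod N → (ZMod N × ZMod N → ℚ) := fun v x =>
    if ∃ A, fcol N A = x then β (v.1 * x.1 + v.2 * x.2) else 0 with hb
  have hmem : α ∈ Submodule.span ℚ (Set.range b) := by
    by_contra hcon
    obtain ⟨φ, hφ, hker⟩ := Submodule.exists_le_ker_of_notMem hcon
    have hφs : ∀ g : ZMod N × ZMod N → ℚ, φ g = ∑ x, g x * φ (Pi.single x 1) := by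
      intro g
      conv_lhs => rw [← Finset.univ_sum_single g]
      rw [map_sum]
      refine Finset.sum_congr rfl fun x _ => ?_
      rw [← smul_eq_mul, ← map_smul]
      congr 1
      rw [← Pi.single_smul]; simp
    set μ : ZMod N × ZMod N → ℚ := fun x => if ∃ A, fcol N A = x then φ (Pi.single x 1) else 0 with hμ
    have hμb : ∀ v : ZMod N × ZMod N, ∑ x, (μ x : ℝ) * bz (v.1 * x.1 + v.2 * x.2) = 0 := by
      intro v
      have h1 : φ (b v) = 0 := hker (Submodule.subset_span ⟨v, rfl⟩)
      rw [hφs] at h1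
      have h2 : ∑ x, μ x * β (v.1 * x.1 + v.2 * x.2) = 0 := by
        rw [← h1]
        refine Finset.sum_congr rfl fun x _ => ?_
        simp only [hμ, hb]
        split_ifs <;> ring
      simp only [hβ]
      exact_mod_cast h2
    have hev := even_part_zero (fun x => (μ x : ℝ)) hμb (by
      intro x hx
      have : ∃ A, fcol N A = x := by
        by_contra h
        apply hx
        simp only [hμ, if_neg h]; simp
      obtain ⟨A, rfl⟩ := this
      exact fcol_unimodular A)
    have hev' : ∀ x, μ (-x) = -μ x := by
      intro x
      have := hev x
      beta_reduce at this
      have h3 : μ x + μ (-x) = 0 := by exact_mod_cast this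
      linarith
    apply hφ
    have h3 : φ α = ∑ x, α x * μ x := by
      rw [hφs]
      refine Finset.sum_congr rfl fun x _ => ?_
      simp only [hμ]
      split_ifs with h
      · rfl
      · rw [h0 x h]; ring
    have h4 := Equiv.sum_comp (Equiv.neg (ZMod N × ZMod N)) (fun x : ZMod N × ZMod N => α x * μ x)
    simp only [Equiv.neg_apply, he, hev', mul_neg, Finset.sum_neg_distrib] at h4
    rw [h3]; linarith
  obtain ⟨m, hm⟩ := (Submodule.mem_span_range_iff_exists_fun ℚ).1 hmem
  refine ⟨m, fun A => ?_⟩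
  have := congrFun hm (fcol N A)
  rw [← this]
  simp only [Finset.sum_apply, Pi.smul_apply, hb, smul_eq_mul, hβ]
  have hA : ∃ B, fcol N B = fcol N A := ⟨A, rfl⟩
  push_cast
  refine Finset.sum_congr rfl fun v _ => ?_
  rw [if_pos hA]

lemma val_ne {N : ℕ} [NeZero N] {v : ZMod N × ZMod N} (hv : v ≠ 0) :
    ¬ ((N : ℤ) ∣ (v.1.val : ℤ) ∧ (N : ℤ) ∣ (v.2.val : ℤ)) := by
  rintro ⟨h1, h2⟩
  apply hv
  ext
  · have := (ZMod.intCast_zmod_eq_zero_iff_dvd _ N).2 h1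
    simpa using this
  · have := (ZMod.intCast_zmod_eq_zero_iff_dvd _ N).2 h2
    simpa using this

lemma unit_structure {N : ℕ} [NeZero N] {f : ℍ → ℂ} (hol : MDifferentiable 𝓘(ℂ) 𝓘(ℂ) f)
    (hne : ∀ z, f z ≠ 0)
    (inv : ∀ A ∈ CongruenceSubgroup.Gamma N, ∀ z : ℍ, f (A • z) = f z)
    (ord : ∀ A : SL(2, ℤ), ∃ α : ℝ, HasOrd (fun z => f (A • z)) α) :
    ∃ (D : ℕ) (k : ZMod N × ZMod N → ℤ) (c : ℂ), 0 < D ∧ c ≠ 0 ∧ ∀ z : ℍ, f z ^ D =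
      c * ∏ v ∈ Finset.univ.erase (0 : ZMod N × ZMod N), U N (v.1.val : ℤ) (v.2.val : ℤ) z ^ k v := by
  classical
  have hN : 0 < N := NeZero.pos N
  obtain ⟨α, h1, h2, h3⟩ := exists_alpha inv ord
  obtain ⟨m, hm⟩ := exists_combination α h2 h3
  set d : ℕ := ∏ v, (m v).den with hd
  have hd0 : 0 < d := Finset.prod_pos fun v _ => (m v).den_pos
  have hk : ∀ v, ∃ k : ℤ, (d : ℚ) * m v = k := by
    intro v
    obtain ⟨e, he⟩ := Finset.dvd_prod_of_mem (fun v => (m v).den) (Finset.mem_univ v)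
    refine ⟨e * (m v).num, ?_⟩
    rw [hd, he]
    push_cast
    have := Rat.den_mul_eq_num (m v)
    linear_combination (e : ℚ) * this
  choose k hk using hk
  set P : ℍ → ℂ := fun z => ∏ v ∈ Finset.univ.erase (0 : ZMod N × ZMod N), U N (v.1.val : ℤ) (v.2.val : ℤ) z ^ k v with hP
  have hPne : ∀ z, P z ≠ 0 := fun z => Finset.prod_ne_zero_iff.2 fun v hv =>
    zpow_ne_zero _ (U_ne_zero hN (val_ne (Finset.ne_of_mem_erase hv)) z)
  have hPhol : MDifferentiable 𝓘(ℂ) 𝓘(ℂ) P := hol_prod _ fun v hv =>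
    hol_zpow (U_hol hN _ _) (fun z => U_ne_zero hN (val_ne (Finset.ne_of_mem_erase hv)) z) _
  set κ : ℝ := 6 * N * k 0 * bz (0 : ZMod N) with hκ
  set h : ℍ → ℂ := fun z => f z ^ (6 * N * d) * (P z)⁻¹ with hh
  have hord : ∀ A : SL(2, ℤ), HasOrd (fun z => h (A • z)) κ := by
    intro A
    have o1 := (h1 A).pow (6 * N * d)
    have o2 := HasOrd.prod (Finset.univ.erase (0 : ZMod N × ZMod N)) (fun v hv =>
      (U_smul_ord hN (val_ne (Finset.ne_of_mem_erase hv)) A).zpow (k v))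
    have o3 := o1.mul o2.inv
    have e : κ = ((6 * N * d : ℕ) : ℝ) * (α (fcol N A)) + -∑ v ∈ Finset.univ.erase (0 : ZMod N × ZMod N),
        (k v : ℝ) * (6 * N * bern (((v.1.val : ℤ) * A 0 0 + (v.2.val : ℤ) * A 1 0 : ℤ) / N)) := by
      have e1 : ∀ v : ZMod N × ZMod N, bern (((v.1.val : ℤ) * A 0 0 + (v.2.val : ℤ) * A 1 0 : ℤ) / N) =
          bz (v.1 * (fcol N A).1 + v.2 * (fcol N A).2) := by
        intro v
        rw [← bz_intCast]
        congr 1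
        simp [fcol]
      simp only [e1]
      rw [hm A, ← Finset.add_sum_erase _ _ (Finset.mem_univ (0 : ZMod N × ZMod N)), mul_add, Finset.mul_sum,
        add_assoc, ← Finset.sum_neg_distrib, ← Finset.sum_add_distrib]
      have hk' : ∀ v, (k v : ℝ) = d * m v := by
        intro v
        have := hk v
        exact_mod_cast this.symm
      rw [Finset.sum_eq_zero]
      · simp [hκ, hk']; ring
      · intro v _
        rw [hk']; push_cast; ring
    rw [e]
    exact o3.congr fun z => rfl
  have hne' : ∀ z, h z ≠ 0 := fun z => mul_ne_zero (pow_ne_zero _ (hne z)) (inv_ne_zero (hPne z))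
  have hhol : MDifferentiable 𝓘(ℂ) 𝓘(ℂ) h := hol_mul (hol_pow hol _) (hol_inv hPhol hPne)
  have hinv : ∀ A ∈ CongruenceSubgroup.Gamma N, ∀ z : ℍ, h (A • z) = h z := by
    intro A hA z
    simp only [hh, hP]
    rw [inv A hA]
    simp only [U_Gamma hN _ _ hA]
  have hconst : ∃ c, ∀ z, h z = c := by
    rcases le_total 0 κ with h0 | h0
    · exact const_of_bounded hN hhol hinv fun A => (hord A).bounded h0
    · obtain ⟨c, hc⟩ := const_of_bounded hN (hol_inv hhol hne') (fun A hA z => by rw [hinv A hA])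
        fun A => (hord A).inv.bounded (by linarith)
      exact ⟨c⁻¹, fun z => by rw [← hc z, inv_inv]⟩
  obtain ⟨c, hc⟩ := hconst
  refine ⟨6 * N * d, k, c, by positivity, ?_, fun z => ?_⟩
  · rw [← hc UpperHalfPlane.I]; exact hne' _
  · have := hc z
    simp only [hh] at this
    rw [← this]
    change f z ^ (6 * N * d) = f z ^ (6 * N * d) * (P z)⁻¹ * P z
    rw [inv_mul_cancel_right₀ (hPne z)]

lemma exists_ee_eq {x : ℂ} (hx0 : x ≠ 0) (hx : ‖x‖ < 1) : ∃ z : ℍ, ee z = x := by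
  have h2 : (2 * (π : ℂ) * Complex.I) ≠ 0 := by simp [Real.pi_ne_zero]
  set w : ℂ := Complex.log x / (2 * (π : ℂ) * Complex.I) with hw
  have he : ee w = x := by
    rw [ee, hw, mul_div_cancel₀ _ h2, Complex.exp_log hx0]
  have him : 0 < w.im := by
    have h := norm_ee w
    rw [he] at h
    rw [h, Real.exp_lt_one_iff] at hx
    have := Real.pi_pos
    nlinarith
  exact ⟨⟨w, him⟩, he⟩

lemma exists_ee_div_eq {N : ℕ} (hN : 0 < N) {x : ℂ} (hx0 : x ≠ 0) (hx : ‖x‖ < 1) :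
    ∃ z : ℍ, ee ((z : ℂ) / N) = x := by
  obtain ⟨z, hz⟩ := exists_ee_eq hx0 hx
  have hN' : (0 : ℝ) < N := by exact_mod_cast hN
  have hN0 : (N : ℂ) ≠ 0 := by norm_cast; omega
  refine ⟨⟨(N : ℝ) * (z : ℂ), ?_⟩, ?_⟩
  · rw [Complex.re_ofReal_mul (N:ℝ) (z:ℂ) |> fun _ => Complex.im_ofReal_mul (N : ℝ) (z : ℂ)]
    exact mul_pos hN' z.im_pos
  · rw [← hz]
    congr 1
    change ((N : ℝ) * (z : ℂ)) / (N : ℂ) = z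
    push_cast
    field_simp

lemma InS_of_C_mul {p : PowerSeries ℂ} {a : ℚ} (ha : a ≠ 0)
    (h : PowerSeries.C (a : ℂ) * p ∈ InS QR) : p ∈ InS QR := by
  intro n
  obtain ⟨b, hb⟩ := h n
  rw [PowerSeries.coeff_C_mul] at hb
  refine ⟨b / a, ?_⟩
  have ha' : (a : ℂ) ≠ 0 := by exact_mod_cast ha
  rw [map_div₀, hb]
  simp [ha']

lemma qexp_normal {f : ℍ → ℂ} (hne : ∀ z, f z ≠ 0) {s : ℚ} {c : ℕ → ℚ}
    (h : ∀ z : ℍ, f z * cexp (-(2 * (π : ℂ) * Complex.I * (s : ℂ) * (z : ℂ))) =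
      ∑' n : ℕ, (c n : ℂ) * cexp (2 * (π : ℂ) * Complex.I * (n : ℂ) * (z : ℂ))) :
    ∃ γ : ℚ, γ ≠ 0 ∧ RatQ (fun z => (γ : ℂ)⁻¹ * f z) := by
  have h1 : ∀ z : ℍ, f z * ee (-(s * z)) = ∑' n : ℕ, (c n : ℂ) * ee z ^ n := by
    intro z
    have e1 : ee (-(s * z)) = cexp (-(2 * (π : ℂ) * Complex.I * (s : ℂ) * (z : ℂ))) := by
      rw [ee]; congr 1; ring
    rw [e1, h z]
    congr 1; ext n
    rw [← ee_nat_mul, ee]; congr 2; ring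
  set P : PowerSeries ℂ := PowerSeries.mk fun n => (c n : ℂ) with hP
  set g : ℂ → ℂ := fun x => ∑' n : ℕ, (c n : ℂ) * x ^ n with hg
  have hs : ∀ x : ℂ, ‖x‖ < 1 → Summable fun n => (c n : ℂ) * x ^ n := by
    intro x hx
    by_cases hx0 : x = 0
    · refine summable_of_ne_finset_zero (s := {0}) fun n hn => ?_
      simp at hn
      simp [hx0, hn]
    · obtain ⟨z, rfl⟩ := exists_ee_eq hx0 hx
      by_contra hc
      have := h1 z
      rw [tsum_eq_zero_of_not_summable hc] at this
      exact mul_ne_zero (hne z) (ee_ne_zero _) this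
  have hHP : HP P g := fun x hx => by
    have := (hs x hx).hasSum
    simpa [hP, hg] using this
  have hg0 : ∀ x : ℂ, x ≠ 0 → ‖x‖ < 1 → g x ≠ 0 := by
    intro x hx0 hx
    obtain ⟨z, rfl⟩ := exists_ee_eq hx0 hx
    rw [hg]; beta_reduce
    rw [← h1 z]
    exact mul_ne_zero (hne z) (ee_ne_zero _)
  have hPne : P ≠ 0 := by
    intro h0
    have h2 := hHP (1/2) (by norm_num)
    rw [h0] at h2
    simp at h2
    exact hg0 (1/2) (by norm_num) (by norm_num) (by
      have := h2.unique (hasSum_zero); simpa using this)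
  have hPQ : P ∈ InS QR := by
    intro n
    exact ⟨c n, by simp [hP]⟩
  obtain ⟨q, hq⟩ := PowerSeries.X_pow_order_dvd (φ := P)
  set n0 := P.order.toNat with hn0
  rw [hq] at hHP
  obtain ⟨g1, hg1, hgg⟩ := hHP.of_X_pow_mul n0
  have hq0 : PowerSeries.constantCoeff q = c n0 := by
    have h3 : PowerSeries.coeff n0 P = c n0 := by simp [hP]
    have h4 := PowerSeries.coeff_X_pow_mul q n0 0
    rw [← hq, zero_add, h3] at h4
    rw [h4]; simp
  have hc0 : (c n0) ≠ 0 := by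
    have h3 : PowerSeries.coeff n0 P ≠ 0 := PowerSeries.coeff_order hPne
    intro h4
    apply h3
    simp [hP, h4]
  have hc0' : ((c n0 : ℚ) : ℂ) ≠ 0 := by exact_mod_cast hc0
  refine ⟨c n0, hc0, s + n0, PowerSeries.C (((c n0 : ℚ) : ℂ)⁻¹) * q, _, (HP.C _).mul hg1, ?_, ?_, ?_, ?_⟩
  · refine mul_mem (InS_C ⟨(c n0)⁻¹, by simp⟩) fun n => ?_
    have h4 := PowerSeries.coeff_X_pow_mul q n0 n
    rw [← hq] at h4
    rw [← h4]
    exact hPQ _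
  · rw [map_mul, hq0]; simp [hc0']
  · intro x hx
    refine mul_ne_zero (inv_ne_zero hc0') ?_
    by_cases hx0 : x = 0
    · rw [hx0, hg1.apply_zero, hq0]; exact hc0'
    · intro h5
      apply hg0 x hx0 hx
      rw [hgg x hx, h5, mul_zero]
  · intro z
    have h5 : f z = ee (s * z) * g (ee z) := by
      rw [hg]; beta_reduce
      rw [← h1 z, mul_comm (f z), ← mul_assoc, ← ee_add]; simp [ee_zero]
    beta_reduce
    rw [h5, hgg _ (norm_ee_lt_one z.im_pos)]
    push_cast
    rw [add_mul, ee_add, ee_nat_mul]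
    ring

/-! ### Logarithmic derivatives -/

lemma thd_add (p q : PowerSeries ℂ) : thd (p + q) = thd p + thd q := by
  simp [thd, mul_add]

def LD (p l : PowerSeries ℂ) : Prop := thd p = p * l

lemma LD.mul {p q l m : PowerSeries ℂ} (h : LD p l) (h' : LD q m) : LD (p * q) (l + m) := by
  rw [LD] at *; rw [thd_mul, h, h']; ring

lemma LD.one : LD 1 0 := by
  rw [LD]; ext n; rw [coeff_thd]; simp [PowerSeries.coeff_one]

lemma LD.pow {p l : PowerSeries ℂ} (h : LD p l) (n : ℕ) : LD (p ^ n) (n * l) := by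
  induction n with
  | zero => simpa using LD.one
  | succ n ih => rw [pow_succ]; have := ih.mul h; push_cast; rwa [add_mul, one_mul]

lemma LD.prod {ι : Type*} (s : Finset ι) {p l : ι → PowerSeries ℂ} (h : ∀ i ∈ s, LD (p i) (l i)) :
    LD (∏ i ∈ s, p i) (∑ i ∈ s, l i) := by
  classical
  induction s using Finset.induction_on with
  | empty => simpa using LD.one
  | insert a s ha ih =>
    rw [Finset.prod_insert ha, Finset.sum_insert ha]
    exact (h a (by simp)).mul (ih fun i hi => h i (by simp [hi]))

lemma LD.cancel {p q l m : PowerSeries ℂ} (h : LD q m) (h' : LD (p * q) l) (hq : q ≠ 0) :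
    LD p (l - m) := by
  rw [LD] at *
  rw [thd_mul, h] at h'
  apply mul_right_cancel₀ hq
  linear_combination h'

lemma LD.pow_iff {p l : PowerSeries ℂ} (hp : p ≠ 0) {n : ℕ} (hn : 0 < n) (h : LD (p ^ n) l) :
    (n : PowerSeries ℂ) * thd p = p * l := by
  obtain ⟨n, rfl⟩ : ∃ k, n = k + 1 := ⟨n - 1, by omega⟩
  have key : thd (p ^ (n + 1)) = ((n + 1 : ℕ) : PowerSeries ℂ) * p ^ n * thd p := by
    clear h
    induction n with
    | zero => simp
    | succ n ih =>
      rw [pow_succ, thd_mul, ih (by omega)]; push_cast; ring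
  rw [LD, key] at h
  apply mul_left_cancel₀ (pow_ne_zero n hp)
  rw [← mul_assoc, mul_comm (p ^ n)]
  rw [h]; ring

lemma LD.unique {p q l : PowerSeries ℂ} (hp : LD p l) (hq : LD q l)
    (h : PowerSeries.constantCoeff p = PowerSeries.constantCoeff q)
    (h0 : PowerSeries.constantCoeff l = 0) : p = q := by
  ext n
  induction n using Nat.strong_induction_on with
  | _ n ih =>
    rcases Nat.eq_zero_or_pos n with rfl | hn
    · simpa using h
    · have h1 := congrArg (PowerSeries.coeff n) hp
      have h2 := congrArg (PowerSeries.coeff n) hq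
      rw [coeff_thd, PowerSeries.coeff_mul] at h1 h2
      have hn' : (n : ℂ) ≠ 0 := by norm_cast; omega
      apply mul_left_cancel₀ hn'
      rw [h1, h2]
      refine Finset.sum_congr rfl fun x hx => ?_
      rw [Finset.HasAntidiagonal.mem_antidiagonal] at hx
      rcases Nat.lt_or_ge x.1 n with hlt | hge
      · rw [ih _ hlt]
      · have : x.2 = 0 := by omega
        simp [this, h0]

lemma LD_Ep (c : ℕ → ℂ) : LD (Ep c) (-Lc c) := by rw [LD, thd_Ep]; ring

/-! ### Expansion of `U` -/

section Vsec
variable (N : ℕ)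

def cA (v : ZMod N × ZMod N) : ℕ → ℂ := indc N v.1.val (ee (((v.2.val : ℤ) : ℝ) / (N : ℝ) : ℝ))
def cB (v : ZMod N × ZMod N) : ℕ → ℂ :=
  indc N (N - v.1.val) (ee (-(((v.2.val : ℤ) : ℝ) / (N : ℝ)) : ℝ))
def Vp (v : ZMod N × ZMod N) : PowerSeries ℂ := Ep (cA N v) * Ep (cB N v)
def Vg (v : ZMod N × ZMod N) (x : ℂ) : ℂ := EE (cA N v) x * EE (cB N v) x

lemma cA_norm (v : ZMod N × ZMod N) (m : ℕ) : ‖cA N v m‖ ≤ 1 :=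
  indc_norm N _ (norm_ee_real _).le m

lemma cB_norm (v : ZMod N × ZMod N) (m : ℕ) : ‖cB N v m‖ ≤ 1 :=
  indc_norm N _ (norm_ee_real _).le m

lemma HP_Vp (v : ZMod N × ZMod N) : HP (Vp N v) (Vg N v) :=
  (HP_Ep (cA_norm N v)).mul (HP_Ep (cB_norm N v))

lemma Vp_const (v : ZMod N × ZMod N) : PowerSeries.constantCoeff (Vp N v) = 1 := by
  simp [Vp, constantCoeff_Ep]

lemma Vg_ne_zero (v : ZMod N × ZMod N) {x : ℂ} (hx : ‖x‖ < 1) : Vg N v x ≠ 0 :=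
  mul_ne_zero (EE_ne_zero (cA_norm N v) hx) (EE_ne_zero (cB_norm N v) hx)

lemma LD_Vp (v : ZMod N × ZMod N) : LD (Vp N v) (-(Lc (cA N v) + Lc (cB N v))) := by
  have := (LD_Ep (cA N v)).mul (LD_Ep (cB N v))
  rw [Vp]; convert this using 1; ring

def Va (v : ZMod N × ZMod N) : ℝ :=
  12 * N * ((((v.1.val : ℝ) / N) ^ 2 - (v.1.val : ℝ) / N + 1 / 6) / 2)

lemma U_Vexp [NeZero N] (v : ZMod N × ZMod N) (z : ℍ) :
    U N (v.1.val : ℤ) (v.2.val : ℤ) z =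
      kap N v.1.val (v.2.val : ℤ) ^ (12 * N) * ee (Va N v * z) * Vg N v (ee ((z : ℂ) / N)) ^ (12 * N) := by
  have h := GG_expansion (ZMod.val_lt v.1) (v.2.val : ℤ) z.im_pos
  rw [U]
  have e : (((v.1.val : ℕ) : ℤ) : ℝ) = (v.1.val : ℝ) := by push_cast; rfl
  rw [e]
  erw [h]
  rw [mul_pow, mul_pow, ← ee_nat_mul]
  congr 3
  rw [Va]
  push_cast; ring_nf

end Vsec

lemma HasOrd.ee_mul (α : ℝ) : HasOrd (fun z : ℍ => ee (α * z)) α := by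
  refine ⟨1, one_ne_zero, ?_⟩
  have : (fun z : ℍ => ee (α * z) * ee (-(α * (z : ℂ)))) = fun _ => 1 := by
    ext z; rw [← ee_add]; simp [ee_zero]
  rw [this]
  exact tendsto_const_nhds

lemma tendsto_HP {p : PowerSeries ℂ} {g : ℂ → ℂ} (h : HP p g) {N : ℕ} (hN : 0 < N) :
    Tendsto (fun z : ℍ => g (ee ((z : ℂ) / N))) atImInfty (𝓝 (PowerSeries.constantCoeff p)) := by
  have hN' : (0 : ℝ) < 1 / N := by positivity
  have h1 : Tendsto (fun z : ℍ => ee ((z : ℂ) / N)) atImInfty (𝓝 0) := by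
    refine (tendsto_ee_zero hN').congr fun z => ?_
    push_cast; congr 1; ring
  have h2 : ContinuousAt g 0 :=
    (h.differentiableOn.differentiableAt (Metric.ball_mem_nhds 0 one_pos)).continuousAt
  rw [← h.apply_zero]
  exact h2.tendsto.comp h1

lemma HP.hasOrd {p : PowerSeries ℂ} {g : ℂ → ℂ} (h : HP p g) {N : ℕ} (hN : 0 < N)
    (h0 : PowerSeries.constantCoeff p ≠ 0) : HasOrd (fun z : ℍ => g (ee ((z : ℂ) / N))) 0 :=
  ⟨_, h0, by simpa [ee_zero] using tendsto_HP h hN⟩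

lemma zpow_toNat {x : ℂ} (hx : x ≠ 0) (k : ℤ) : x ^ k * x ^ (-k).toNat = x ^ k.toNat := by
  rw [← zpow_natCast, ← zpow_natCast, ← zpow_add₀ hx]; congr 1; omega

lemma constantCoeff_expand' {N : ℕ} (hN : N ≠ 0) (p : PowerSeries ℂ) :
    PowerSeries.constantCoeff (PowerSeries.expand N hN p) = PowerSeries.constantCoeff p := by
  simp

lemma formal_identity {N : ℕ} [NeZero N] {f : ℍ → ℂ} {s : ℚ} {p : PowerSeries ℂ} {g : ℂ → ℂ}
    (hp : HP p g) (hc : PowerSeries.constantCoeff p = 1)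
    (hf : ∀ z : ℍ, f z = ee (s * z) * g (ee z)) {D : ℕ} {k : ZMod N × ZMod N → ℤ} {c : ℂ}
    (hc0 : c ≠ 0) (h : ∀ z : ℍ, f z ^ D =
      c * ∏ v ∈ Finset.univ.erase (0 : ZMod N × ZMod N), U N (v.1.val : ℤ) (v.2.val : ℤ) z ^ k v) :
    PowerSeries.expand N (NeZero.ne N) p ^ D *
      ∏ v ∈ Finset.univ.erase (0 : ZMod N × ZMod N), Vp N v ^ (12 * N * (-k v).toNat) =
      ∏ v ∈ Finset.univ.erase (0 : ZMod N × ZMod N), Vp N v ^ (12 * N * (k v).toNat) := by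
  have hN : 0 < N := NeZero.pos N
  set S := Finset.univ.erase (0 : ZMod N × ZMod N) with hS
  have hF := hp.expand (NeZero.ne N)
  set F := PowerSeries.expand N (NeZero.ne N) p with hFdef
  have hFc : PowerSeries.constantCoeff F = 1 := by rw [hFdef, constantCoeff_expand', hc]
  set c' : ℂ := c * ∏ v ∈ S, (kap N v.1.val (v.2.val : ℤ) ^ (12 * N)) ^ k v with hc'
  have hxN : ∀ z : ℍ, ee ((z : ℂ) / N) ^ N = ee z := by
    intro z
    have hN0 : (N : ℂ) ≠ 0 := by norm_cast; omega
    rw [← ee_nat_mul]; congr 1; field_simp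
  have hx1 : ∀ z : ℍ, ‖ee ((z : ℂ) / N)‖ < 1 := by
    intro z
    apply norm_ee_lt_one
    rw [Complex.div_natCast_im]
    have := z.im_pos
    exact div_pos this (by exact_mod_cast hN)
  set β : ℝ := ∑ v ∈ S, k v * Va N v with hβ
  have hkap : c' ≠ 0 := by
    refine mul_ne_zero hc0 (Finset.prod_ne_zero_iff.mpr fun v hv => zpow_ne_zero _ (pow_ne_zero _ ?_))
    refine kap_ne_zero (ZMod.val_lt v.1) ?_
    have := val_ne (Finset.ne_of_mem_erase hv)
    rintro ⟨h1, h2⟩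
    exact this ⟨by rw [h1]; simp, h2⟩
  have h2 : ∀ z : ℍ, ee (((D * s : ℝ)) * z) * g (ee ((z : ℂ) / N) ^ N) ^ D =
      c' * (ee (β * z) * ∏ v ∈ S, (Vg N v (ee ((z : ℂ) / N)) ^ (12 * N)) ^ k v) := by
    intro z
    have e1 : ee (((D * s : ℝ)) * z) = ee (s * z) ^ D := by
      rw [← ee_nat_mul]; congr 1; push_cast; ring
    have e2 : ee (β * z) = ∏ v ∈ S, ee (Va N v * z) ^ k v := by
      have : ∀ T : Finset (ZMod N × ZMod N), ee ((∑ v ∈ T, k v * Va N v : ℝ) * z) =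
          ∏ v ∈ T, ee (Va N v * z) ^ k v := by
        classical
        intro T
        induction T using Finset.induction_on with
        | empty => simp [ee_zero]
        | insert a T ha ih =>
          rw [Finset.prod_insert ha, Finset.sum_insert ha, ← ih, ← ee_int_mul, ← ee_add]
          congr 1; push_cast; ring
      exact this S
    rw [e1, e2, hxN, ← mul_pow, ← hf, h z, hc', mul_assoc, ← Finset.prod_mul_distrib,
      ← Finset.prod_mul_distrib]
    congr 1
    refine Finset.prod_congr rfl fun v _ => ?_
    rw [U_Vexp, mul_zpow, mul_zpow]; ring
  have o1 : HasOrd (fun z : ℍ => ee (((D * s : ℝ)) * z) * g (ee ((z : ℂ) / N) ^ N) ^ D)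
      (D * s : ℝ) := by
    have := (HasOrd.ee_mul (D * s : ℝ)).mul ((hF.hasOrd hN (by rw [hFc]; exact one_ne_zero)).pow D)
    simpa using this
  have o2 : HasOrd (fun z : ℍ => ee (((D * s : ℝ)) * z) * g (ee ((z : ℂ) / N) ^ N) ^ D) β := by
    have h3 : HasOrd (fun z : ℍ => ∏ v ∈ S, (Vg N v (ee ((z : ℂ) / N)) ^ (12 * N)) ^ k v)
        (∑ v ∈ S, (k v : ℝ) * ((12 * N : ℕ) * 0)) :=
      HasOrd.prod S fun v _ => (((HP_Vp N v).hasOrd hN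
        (by rw [Vp_const]; exact one_ne_zero)).pow (12 * N)).zpow (k v)
    have := ((HasOrd.ee_mul β).mul h3).const_mul hkap
    refine HasOrd.congr ?_ h2
    simpa using this
  have hββ : (D * s : ℝ) = β := o1.unique o2
  have h4 : ∀ x : ℂ, x ≠ 0 → ‖x‖ < 1 →
      g (x ^ N) ^ D * ∏ v ∈ S, Vg N v x ^ (12 * N * (-k v).toNat) =
      c' * ∏ v ∈ S, Vg N v x ^ (12 * N * (k v).toNat) := by
    intro x hx0 hx
    obtain ⟨z, rfl⟩ := exists_ee_div_eq hN hx0 hx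
    have h5 := h2 z
    rw [hββ, mul_left_comm c'] at h5
    rw [mul_left_cancel₀ (ee_ne_zero _) h5, mul_assoc, ← Finset.prod_mul_distrib]
    congr 1
    refine Finset.prod_congr rfl fun v _ => ?_
    rw [pow_mul _ (12 * N) (-k v).toNat, pow_mul _ (12 * N) (k v).toNat]
    exact zpow_toNat (pow_ne_zero _ (Vg_ne_zero N v hx)) _
  have h6 := ((hF.pow D).mul (HP.prod S fun v _ => (HP_Vp N v).pow (12 * N * (-k v).toNat))
    ).unique_punctured ((HP.C c').mul (HP.prod S fun v _ => (HP_Vp N v).pow (12 * N * (k v).toNat))) h4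
  have h7 := congrArg PowerSeries.constantCoeff h6
  have hc1 : c' = 1 := by
    simpa [hFc, Vp_const] using h7.symm
  rw [hc1] at h6
  simpa using h6

def OR : Subring ℂ := (integralClosure ℤ ℂ).toSubring

lemma ee_root_mem {N : ℕ} (hN : 0 < N) (t : ℤ) : ee ((t : ℝ) / (N : ℝ) : ℝ) ∈ OR := by
  refine (integralClosure ℤ ℂ).mem_toSubring.mpr ?_
  refine IsIntegral.of_pow hN ?_
  rw [← ee_nat_mul]
  have hN0 : (N : ℂ) ≠ 0 := by norm_cast; omega
  have : (N : ℂ) * (((t : ℝ) / (N : ℝ) : ℝ) : ℂ) = t := by push_cast; field_simp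
  rw [this, ee_int]
  exact isIntegral_one

lemma Vp_mem (N : ℕ) [NeZero N] (v : ZMod N × ZMod N) : Vp N v ∈ InS OR := by
  have hN : 0 < N := NeZero.pos N
  refine mul_mem (InS_Ep fun m => ?_) (InS_Ep fun m => ?_)
  · rw [cA, indc]; split_ifs
    · exact ee_root_mem hN _
    · exact zero_mem _
  · rw [cB, indc]; split_ifs
    · have := ee_root_mem hN (-(v.2.val : ℤ))
      convert this using 3
      push_cast; ring
    · exact zero_mem _

lemma InS_cancel {R : Subring ℂ} {p q r : PowerSeries ℂ} (h : p * q = r) (hq : q ∈ InS R)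
    (hr : r ∈ InS R) (h1 : PowerSeries.constantCoeff q = 1) : p ∈ InS R := by
  have : p = r * q⁻¹ := by
    rw [← h, mul_assoc, PowerSeries.mul_inv_cancel _ (by rw [h1]; exact one_ne_zero), mul_one]
  rw [this]
  exact mul_mem hr (InS_inv hq h1)

lemma prod_Vp_const (N : ℕ) [NeZero N] (S : Finset (ZMod N × ZMod N)) (e : ZMod N × ZMod N → ℕ) :
    PowerSeries.constantCoeff (∏ v ∈ S, Vp N v ^ e v) = 1 := by
  simp [Vp_const]

lemma ne_zero_of_const {p : PowerSeries ℂ} (h : PowerSeries.constantCoeff p = 1) : p ≠ 0 := by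
  rintro rfl; simp at h

lemma F_pow_mem {N : ℕ} [NeZero N] {F : PowerSeries ℂ} {D : ℕ} {k : ZMod N × ZMod N → ℤ}
    {S : Finset (ZMod N × ZMod N)}
    (h : F ^ D * ∏ v ∈ S, Vp N v ^ (12 * N * (-k v).toNat) =
      ∏ v ∈ S, Vp N v ^ (12 * N * (k v).toNat)) : F ^ D ∈ InS OR :=
  InS_cancel h ((InS OR).prod_mem fun v _ => (InS OR).pow_mem (Vp_mem N v) _)
    ((InS OR).prod_mem fun v _ => (InS OR).pow_mem (Vp_mem N v) _) (prod_Vp_const N S _)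

lemma F_thd {N : ℕ} [NeZero N] {F : PowerSeries ℂ} {D : ℕ} (hD : 0 < D) (hF : F ≠ 0)
    {k : ZMod N × ZMod N → ℤ} {S : Finset (ZMod N × ZMod N)}
    (h : F ^ D * ∏ v ∈ S, Vp N v ^ (12 * N * (-k v).toNat) =
      ∏ v ∈ S, Vp N v ^ (12 * N * (k v).toNat)) :
    (D : PowerSeries ℂ) * thd F =
      F * -(∑ v ∈ S, (12 * N * k v : ℤ) * (Lc (cA N v) + Lc (cB N v))) := by
  have l1 := LD.prod S (fun v _ => (LD_Vp N v).pow (12 * N * (-k v).toNat))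
  have l2 := LD.prod S (fun v _ => (LD_Vp N v).pow (12 * N * (k v).toNat))
  rw [← h] at l2
  have l3 := l1.cancel l2 (ne_zero_of_const (prod_Vp_const N S _))
  have l4 := l3.pow_iff hF hD
  rw [l4]
  congr 1
  rw [← Finset.sum_sub_distrib, ← Finset.sum_neg_distrib]
  refine Finset.sum_congr rfl fun v _ => ?_
  have : (k v : PowerSeries ℂ) = ((k v).toNat : PowerSeries ℂ) - ((-k v).toNat : PowerSeries ℂ) := by
    have : (k v) = ((k v).toNat : ℤ) - ((-k v).toNat : ℤ) := by omega
    conv_lhs => rw [this]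
    push_cast; rfl
  push_cast
  rw [this]
  ring

/-! ### Galois action on `N`-th roots of unity -/

section Gal
variable {N : ℕ} [NeZero N]

lemma xi_nat (n : ℕ) (x : ZMod N) : (ZMod.stdAddChar ((n : ZMod N) * x) : ℂ) = ZMod.stdAddChar x ^ n := by
  rw [← AddChar.map_nsmul_eq_pow, nsmul_eq_mul]

lemma xi_primitive (u : (ZMod N)ˣ) : IsPrimitiveRoot (ZMod.stdAddChar (u : ZMod N) : ℂ) N := by
  constructor
  · rw [← xi_nat]; simp
  · intro l hl
    rw [← xi_nat, ← AddChar.map_zero_eq_one (ZMod.stdAddChar (N := N))] at hl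
    have := ZMod.injective_stdAddChar hl
    rw [Units.mul_left_eq_zero] at this
    exact (ZMod.natCast_eq_zero_iff l N).mp this

def GalP (u : (ZMod N)ˣ) (X Y : ℂ) : Prop :=
  ∃ P : Polynomial ℚ, Polynomial.aeval (ZMod.stdAddChar (1 : ZMod N) : ℂ) P = X ∧
    Polynomial.aeval (ZMod.stdAddChar (u : ZMod N) : ℂ) P = Y

lemma GalP.add {u : (ZMod N)ˣ} {X Y X' Y' : ℂ} (h : GalP u X Y) (h' : GalP u X' Y') :
    GalP u (X + X') (Y + Y') := by
  obtain ⟨P, h1, h2⟩ := h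
  obtain ⟨P', h1', h2'⟩ := h'
  exact ⟨P + P', by rw [map_add, h1, h1'], by rw [map_add, h2, h2']⟩

lemma GalP.mul {u : (ZMod N)ˣ} {X Y X' Y' : ℂ} (h : GalP u X Y) (h' : GalP u X' Y') :
    GalP u (X * X') (Y * Y') := by
  obtain ⟨P, h1, h2⟩ := h
  obtain ⟨P', h1', h2'⟩ := h'
  exact ⟨P * P', by rw [map_mul, h1, h1'], by rw [map_mul, h2, h2']⟩

lemma GalP.ratCast (u : (ZMod N)ˣ) (q : ℚ) : GalP u (q : ℂ) q :=
  ⟨Polynomial.C q, by simp, by simp⟩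

lemma GalP.sum {u : (ZMod N)ˣ} {ι : Type*} (s : Finset ι) {X Y : ι → ℂ}
    (h : ∀ i ∈ s, GalP u (X i) (Y i)) : GalP u (∑ i ∈ s, X i) (∑ i ∈ s, Y i) := by
  classical
  induction s using Finset.induction_on with
  | empty => simpa using GalP.ratCast u 0
  | insert a s ha ih =>
    rw [Finset.sum_insert ha, Finset.sum_insert ha]
    exact (h a (by simp)).add (ih fun i hi => h i (by simp [hi]))

lemma GalP.xi (u : (ZMod N)ˣ) (x : ZMod N) :
    GalP u (ZMod.stdAddChar x) (ZMod.stdAddChar ((u : ZMod N) * x)) := by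
  refine ⟨Polynomial.X ^ x.val, ?_, ?_⟩
  · rw [map_pow, Polynomial.aeval_X, ← xi_nat]; simp
  · rw [map_pow, Polynomial.aeval_X, ← xi_nat, mul_comm]; simp

lemma GalP.eq_of_rat {u : (ZMod N)ˣ} {X Y : ℂ} (h : GalP u X Y) {q : ℚ} (hq : X = q) : Y = q := by
  obtain ⟨P, h1, h2⟩ := h
  have m1 := Polynomial.cyclotomic_eq_minpoly_rat (xi_primitive (1 : (ZMod N)ˣ)) (NeZero.pos N)
  have m2 := Polynomial.cyclotomic_eq_minpoly_rat (xi_primitive u) (NeZero.pos N)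
  have h3 : minpoly ℚ (ZMod.stdAddChar (1 : ZMod N) : ℂ) ∣ (P - Polynomial.C q) := by
    apply minpoly.dvd
    rw [map_sub, h1, hq]; simp
  rw [Units.val_one] at m1
  rw [← m1, m2] at h3
  have h4 : Polynomial.aeval (ZMod.stdAddChar (u : ZMod N) : ℂ) (P - Polynomial.C q) = 0 := by
    obtain ⟨Q, hQ⟩ := h3
    rw [hQ, map_mul, minpoly.aeval, zero_mul]
  rw [map_sub, h2] at h4
  simpa [sub_eq_zero] using h4

/-- Ramanujan sums -/
def cc (t x : ZMod N) : ℂ := ∑ u : (ZMod N)ˣ, ZMod.stdAddChar ((u : ZMod N) * (t * x))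

lemma cc_unit (t x : ZMod N) (w : (ZMod N)ˣ) : cc t (w * x) = cc t x := by
  rw [cc, cc, ← Equiv.sum_comp (Equiv.mulRight w)
    (fun u : (ZMod N)ˣ => (ZMod.stdAddChar ((u : ZMod N) * (t * x)) : ℂ))]
  refine Finset.sum_congr rfl fun u _ => ?_
  congr 1
  rw [Equiv.coe_mulRight, Units.val_mul]; ring

lemma cc_neg (t x : ZMod N) : ∑ u : (ZMod N)ˣ, (ZMod.stdAddChar ((u : ZMod N) * -(t * x)) : ℂ) = cc t x := by
  rw [← cc_unit t x (-1), cc]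
  refine Finset.sum_congr rfl fun u _ => ?_
  congr 1
  push_cast; ring

lemma cc_gcd (t : ZMod N) (k : ℕ) : cc t (k : ZMod N) = cc t ((Nat.gcd k N : ℕ) : ZMod N) := by
  obtain ⟨d, hd, u, hu, h⟩ := ZMod.eq_unit_mul_divisor (k : ZMod N)
  obtain ⟨w, rfl⟩ := hu
  have hdg : Nat.gcd k N = d := by
    have e : ((w : ZMod N).val * d : ℕ) ≡ k [MOD N] := by
      rw [← ZMod.natCast_eq_natCast_iff, h]; push_cast; simp
    rw [← e.gcd_eq]
    have hcop : Nat.Coprime (w : ZMod N).val N := ZMod.val_coe_unit_coprime w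
    obtain ⟨m, rfl⟩ := hd
    have hc2 : Nat.Coprime (w : ZMod (d * m)).val m := hcop.coprime_mul_left_right
    rw [mul_comm, Nat.gcd_mul_left, hc2.gcd_eq_one, mul_one]
  rw [h, cc_unit, hdg]

open ArithmeticFunction in
lemma exists_gamma (t : ZMod N) : ∃ γ : ℕ → ℂ,
    (∀ k : ℕ, cc t (k : ZMod N) = ∑ j ∈ N.divisors, if j ∣ k then γ j else 0) ∧
    (t ≠ 0 → ∑ j ∈ N.divisors, γ j / j = 0) := by
  set γ : ℕ → ℂ := fun n => ∑ x ∈ n.divisorsAntidiagonal, (ArithmeticFunction.moebius x.1 : ℂ) * cc t (x.2 : ZMod N)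
  have h1 : ∀ n : ℕ, n > 0 → ∑ i ∈ n.divisors, γ i = cc t (n : ZMod N) :=
    (ArithmeticFunction.sum_eq_iff_sum_mul_moebius_eq (f := γ) (g := fun n : ℕ => cc t (n : ZMod N))).mpr
      fun n _ => rfl
  have hN : 0 < N := NeZero.pos N
  have h2 : ∀ k : ℕ, cc t (k : ZMod N) = ∑ j ∈ N.divisors, if j ∣ k then γ j else 0 := by
    intro k
    rw [cc_gcd, ← h1 _ (Nat.gcd_pos_of_pos_right k hN), ← Finset.sum_filter]
    refine Finset.sum_congr ?_ fun _ _ => rfl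
    ext j
    rw [Finset.mem_filter, Nat.mem_divisors, Nat.mem_divisors, Nat.dvd_gcd_iff]
    have := (Nat.gcd_pos_of_pos_right k hN).ne'
    have := hN.ne'
    tauto
  refine ⟨γ, h2, fun ht => ?_⟩
  have h3 : ∑ k ∈ Finset.range N, cc t (k : ZMod N) = 0 := by
    have e : ∑ k ∈ Finset.range N, cc t (k : ZMod N) = ∑ x : ZMod N, cc t x := by
      refine Finset.sum_nbij' (fun k => (k : ZMod N)) (fun x => x.val) ?_ ?_ ?_ ?_ ?_
      · simp
      · intro x _; simpa using ZMod.val_lt x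
      · intro k hk; exact ZMod.val_cast_of_lt (by simpa using hk)
      · intro x _; simp
      · intro k _; rfl
    rw [e]
    simp only [cc]
    rw [Finset.sum_comm]
    refine Finset.sum_eq_zero fun u _ => ?_
    have := AddChar.sum_mulShift ((u : ZMod N) * t) (ZMod.isPrimitive_stdAddChar N)
    rw [if_neg (by rw [Units.mul_right_eq_zero]; exact ht)] at this
    rw [← Nat.cast_zero, ← this]
    refine Finset.sum_congr rfl fun x _ => ?_
    congr 1; ring
  have h4 : ∑ k ∈ Finset.range N, cc t (k : ZMod N) = N * ∑ j ∈ N.divisors, γ j / j := by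
    simp only [h2]
    rw [Finset.sum_comm, Finset.mul_sum]
    refine Finset.sum_congr rfl fun j hj => ?_
    rw [← Finset.sum_filter, Finset.sum_const, nsmul_eq_mul]
    obtain ⟨m, hm⟩ := Nat.dvd_of_mem_divisors hj
    have hj0 : 0 < j := Nat.pos_of_mem_divisors hj
    have hcard : ((Finset.range N).filter (fun k => j ∣ k)).card = m := by
      have : (Finset.range N).filter (fun k => j ∣ k) = (Finset.range m).image (fun i => j * i) := by
        ext k
        simp only [Finset.mem_filter, Finset.mem_range, Finset.mem_image]
        constructor
        · rintro ⟨h5, i, rfl⟩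
          exact ⟨i, by rw [hm] at h5; exact Nat.lt_of_mul_lt_mul_left h5, rfl⟩
        · rintro ⟨i, hi, rfl⟩
          exact ⟨by rw [hm]; exact Nat.mul_lt_mul_of_pos_left hi hj0, dvd_mul_right _ _⟩
      rw [this, Finset.card_image_of_injective _ (fun a b h => Nat.eq_of_mul_eq_mul_left hj0 h), Finset.card_range]
    rw [hcard]
    have : (N : ℂ) = j * m := by exact_mod_cast hm
    have hj0' : (j : ℂ) ≠ 0 := by exact_mod_cast hj0.ne'
    rw [this]; field_simp
  rw [h3] at h4
  have hN0 : (N : ℂ) ≠ 0 := by exact_mod_cast hN.ne'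
  rcases mul_eq_zero.mp h4.symm with h | h
  · exact absurd h hN0
  · exact h


lemma ee_val (t : ZMod N) : ee (((t.val : ℤ) : ℝ) / (N : ℝ) : ℝ) = ZMod.stdAddChar t := by
  have h := ZMod.stdAddChar_coe (N := N) (t.val : ℤ)
  have e : (((t.val : ℤ)) : ZMod N) = t := by simp
  rw [e] at h
  rw [h, ee]; congr 1; push_cast; ring

lemma cA_pow (v : ZMod N × ZMod N) (m : ℕ) {k : ℕ} (hk : k ≠ 0) :
    cA N v m ^ k = (if (m : ZMod N) = v.1 then 1 else 0) * (ZMod.stdAddChar (v.2 * (k : ZMod N)) : ℂ) := by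
  have e : m ≡ v.1.val [MOD N] ↔ (m : ZMod N) = v.1 := by
    rw [← ZMod.natCast_eq_natCast_iff]; simp
  rw [cA, indc, if_congr e rfl rfl, ee_val, mul_comm v.2, xi_nat]
  split_ifs
  · simp
  · simp [hk]

lemma cB_pow (v : ZMod N × ZMod N) (m : ℕ) {k : ℕ} (hk : k ≠ 0) :
    cB N v m ^ k = (if (m : ZMod N) = -v.1 then 1 else 0) * (ZMod.stdAddChar (-(v.2 * (k : ZMod N))) : ℂ) := by
  have e : m ≡ N - v.1.val [MOD N] ↔ (m : ZMod N) = -v.1 := by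
    rw [← ZMod.natCast_eq_natCast_iff, Nat.cast_sub (ZMod.val_lt v.1).le]; simp
  have e2 : ee (-(((v.2.val : ℤ) : ℝ) / (N : ℝ)) : ℝ) = ZMod.stdAddChar (-v.2) := by
    push_cast
    rw [ee_neg, AddChar.map_neg_eq_inv, ← ee_val]; push_cast; rfl
  rw [cB, indc, if_congr e rfl rfl, e2, mul_comm v.2, ← mul_neg, xi_nat]
  split_ifs
  · simp
  · simp [hk]

def psiv (v : ZMod N × ZMod N) (y : ZMod N) : ℂ :=
  (if y = v.1 then 1 else 0) + (if y = -v.1 then 1 else 0)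

lemma psi_neg (v : ZMod N × ZMod N) (y : ZMod N) : psiv v (-y) = psiv v y := by
  have e1 : -y = v.1 ↔ y = -v.1 := neg_eq_iff_eq_neg
  have e2 : -y = -v.1 ↔ y = v.1 := neg_inj
  rw [psiv, psiv, if_congr e1 rfl rfl, if_congr e2 rfl rfl, add_comm]

lemma divisor_swap (γ : ℕ → ℂ) (ψ : ℕ → ℂ) {M : ℕ} (hM : 0 < M) (s : Finset ℕ) (hs : ∀ j ∈ s, 0 < j) :
    ∑ m ∈ M.divisors, (m : ℂ) * (ψ m * ∑ j ∈ s, if j ∣ M / m then γ j else 0) =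
    ∑ m ∈ M.divisors, (m : ℂ) * ∑ j ∈ s, if j ∣ m then γ j / j * ψ (m / j) else 0 := by
  simp only [Finset.mul_sum]
  rw [Finset.sum_comm, Finset.sum_comm (s := M.divisors) (t := s)]
  refine Finset.sum_congr rfl fun j hj => ?_
  have hj0 := hs j hj
  have hj0' : (j : ℂ) ≠ 0 := by exact_mod_cast hj0.ne'
  simp only [mul_ite, mul_zero]
  rw [← Finset.sum_filter, ← Finset.sum_filter]
  refine Finset.sum_nbij' (fun m => j * m) (fun m => m / j) ?_ ?_ ?_ ?_ ?_
  · intro m hm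
    simp only [Finset.mem_filter, Nat.mem_divisors] at hm ⊢
    obtain ⟨⟨⟨e, he⟩, h2⟩, h3⟩ := hm
    have hm0 : 0 < m := by
      rcases Nat.eq_zero_or_pos m with h | h
      · subst h; simp at he; omega
      · exact h
    rw [he, Nat.mul_div_cancel_left _ hm0] at h3
    obtain ⟨e', rfl⟩ := h3
    exact ⟨⟨⟨e', by rw [he]; ring⟩, h2⟩, dvd_mul_right _ _⟩
  · intro m hm
    simp only [Finset.mem_filter, Nat.mem_divisors] at hm ⊢
    obtain ⟨⟨⟨e, he⟩, h2⟩, ⟨i, rfl⟩⟩ := hm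
    rw [Nat.mul_div_cancel_left _ hj0]
    have hi0 : 0 < i := by
      rcases Nat.eq_zero_or_pos i with h | h
      · subst h; simp at he; omega
      · exact h
    refine ⟨⟨⟨j * e, by rw [he]; ring⟩, h2⟩, ⟨e, ?_⟩⟩
    rw [he, show j * i * e = i * (j * e) by ring, Nat.mul_div_cancel_left _ hi0]
  · intro m _; exact Nat.mul_div_cancel_left _ hj0
  · intro m hm
    simp only [Finset.mem_filter] at hm
    exact Nat.mul_div_cancel' hm.2
  · intro m _
    rw [Nat.mul_div_cancel_left _ hj0]
    push_cast; field_simp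

lemma exists_b (κ : ZMod N × ZMod N → ℤ) (E : PowerSeries ℂ) (hE : E ∈ InS QR)
    (hEdef : E = ∑ v ∈ Finset.univ.erase (0 : ZMod N × ZMod N),
      (κ v : PowerSeries ℂ) * (Lc (cA N v) + Lc (cB N v))) :
    ∃ b : ℤ → ℂ, (∀ m i : ℤ, b (m + (N ^ 2 : ℕ) * i) = b m) ∧ (∀ m, b (-m) = b m) ∧ b 0 = 0 ∧
      ∀ M : ℕ, 0 < M → PowerSeries.coeff M E = ∑ m ∈ M.divisors, (m : ℂ) * b m := by
  have hN : 0 < N := NeZero.pos N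
  set S := Finset.univ.erase (0 : ZMod N × ZMod N) with hS
  choose γ hγ1 hγ2 using exists_gamma (N := N)
  set n : ℂ := (Fintype.card (ZMod N)ˣ : ℂ) with hn
  have hn0 : n ≠ 0 := by rw [hn]; exact_mod_cast Fintype.card_ne_zero
  refine ⟨fun m => n⁻¹ * ∑ v ∈ S, (κ v : ℂ) * ∑ j ∈ N.divisors,
    if (j : ℤ) ∣ m then γ v.2 j / j * psiv v ((m / j : ℤ) : ZMod N) else 0, ?_, ?_, ?_, ?_⟩
  · intro m i
    beta_reduce
    congr 1
    refine Finset.sum_congr rfl fun v _ => ?_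
    congr 1
    refine Finset.sum_congr rfl fun j hj => ?_
    obtain ⟨e, he⟩ := Nat.dvd_of_mem_divisors hj
    have hj0 : (j : ℤ) ≠ 0 := by exact_mod_cast (Nat.pos_of_mem_divisors hj).ne'
    have e1 : ((N ^ 2 : ℕ) : ℤ) * i = j * (N * e * i) := by
      have : (N : ℤ) = j * e := by exact_mod_cast he
      push_cast; rw [sq]; nth_rewrite 1 [this]; ring
    have e2 : (j : ℤ) ∣ m + (N ^ 2 : ℕ) * i ↔ (j : ℤ) ∣ m := by
      rw [e1]; exact Int.dvd_add_left (dvd_mul_right _ _)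
    rw [if_congr e2 rfl rfl]
    split_ifs with h
    · congr 2
      rw [e1, Int.add_mul_ediv_left _ _ hj0]; push_cast; simp
    · rfl
  · intro m
    beta_reduce
    congr 1
    refine Finset.sum_congr rfl fun v _ => ?_
    congr 1
    refine Finset.sum_congr rfl fun j hj => ?_
    rw [if_congr (dvd_neg (a := (j : ℤ))) rfl rfl]
    split_ifs with h
    · rw [Int.neg_ediv_of_dvd h]; push_cast; rw [psi_neg]
    · rfl
  · beta_reduce
    rw [Finset.sum_eq_zero, mul_zero]
    intro v hv
    by_cases h1 : v.1 = 0
    · have h2 : v.2 ≠ 0 := by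
        intro h2
        exact Finset.ne_of_mem_erase hv (Prod.ext h1 h2)
      have := hγ2 v.2 h2
      simp only [dvd_zero, if_true, Int.zero_ediv, ← Finset.sum_mul]
      rw [this]; simp
    · have : psiv v (((0 : ℤ)) : ZMod N) = 0 := by
        rw [psiv, if_neg, if_neg, add_zero]
        · intro h; apply h1; simpa using h.symm
        · intro h; apply h1; simpa using h.symm
      simp only [dvd_zero, if_true, Int.zero_ediv, this]
      simp
  · intro M hM
    have hdiv : ∀ m ∈ M.divisors, M / m ≠ 0 := by
      intro m hm
      have := Nat.div_pos (Nat.divisor_le hm) (Nat.pos_of_mem_divisors hm)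
      omega
    -- the coefficient
    have c1 : PowerSeries.coeff M E = ∑ v ∈ S, (κ v : ℂ) * ∑ m ∈ M.divisors, (m : ℂ) *
        ((if (m : ZMod N) = v.1 then 1 else 0) * (ZMod.stdAddChar (v.2 * ((M / m : ℕ) : ZMod N)) : ℂ) +
         (if (m : ZMod N) = -v.1 then 1 else 0) * (ZMod.stdAddChar (-(v.2 * ((M / m : ℕ) : ZMod N))) : ℂ)) := by
      rw [hEdef, map_sum]
      refine Finset.sum_congr rfl fun v _ => ?_
      have : (κ v : PowerSeries ℂ) = PowerSeries.C (κ v : ℂ) := by simp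
      rw [this, PowerSeries.coeff_C_mul, map_add, Lc, Lc, PowerSeries.coeff_mk, PowerSeries.coeff_mk,
        ← Finset.sum_add_distrib]
      congr 1
      refine Finset.sum_congr rfl fun m hm => ?_
      rw [cA_pow v m (hdiv m hm), cB_pow v m (hdiv m hm)]; ring
    obtain ⟨q, hq⟩ := hE M
    have c2 : ∀ u : (ZMod N)ˣ, PowerSeries.coeff M E = ∑ v ∈ S, (κ v : ℂ) * ∑ m ∈ M.divisors, (m : ℂ) *
        ((if (m : ZMod N) = v.1 then 1 else 0) * (ZMod.stdAddChar ((u : ZMod N) * (v.2 * ((M / m : ℕ) : ZMod N))) : ℂ) +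
         (if (m : ZMod N) = -v.1 then 1 else 0) * (ZMod.stdAddChar ((u : ZMod N) * -(v.2 * ((M / m : ℕ) : ZMod N))) : ℂ)) := by
      intro u
      have hi : ∀ P : Prop, [Decidable P] → GalP u (if P then 1 else 0) (if P then 1 else 0) := by
        intro P _
        split_ifs
        · simpa using GalP.ratCast u 1
        · simpa using GalP.ratCast u 0
      have g : GalP u (PowerSeries.coeff M E) (∑ v ∈ S, (κ v : ℂ) * ∑ m ∈ M.divisors, (m : ℂ) *
        ((if (m : ZMod N) = v.1 then 1 else 0) * (ZMod.stdAddChar ((u : ZMod N) * (v.2 * ((M / m : ℕ) : ZMod N))) : ℂ) +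
         (if (m : ZMod N) = -v.1 then 1 else 0) * (ZMod.stdAddChar ((u : ZMod N) * -(v.2 * ((M / m : ℕ) : ZMod N))) : ℂ))) := by
        rw [c1]
        refine GalP.sum _ fun v _ => GalP.mul (by simpa using GalP.ratCast u (κ v)) ?_
        refine GalP.sum _ fun m _ => GalP.mul (by simpa using GalP.ratCast u m) ?_
        exact GalP.add (GalP.mul (hi _) (GalP.xi u _)) (GalP.mul (hi _) (GalP.xi u _))
      have := g.eq_of_rat (q := q) (by rw [← hq]; simp)
      rw [this, ← hq]; simp
    have c3 : n * PowerSeries.coeff M E = ∑ v ∈ S, (κ v : ℂ) * ∑ m ∈ M.divisors, (m : ℂ) *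
        (psiv v m * cc v.2 (M / m : ℕ)) := by
      have : n * PowerSeries.coeff M E = ∑ u : (ZMod N)ˣ, PowerSeries.coeff M E := by
        rw [Finset.sum_const, nsmul_eq_mul, hn, Finset.card_univ]
      rw [this, Finset.sum_congr rfl fun u _ => c2 u, Finset.sum_comm]
      refine Finset.sum_congr rfl fun v _ => ?_
      rw [← Finset.mul_sum, Finset.sum_comm]
      congr 1
      refine Finset.sum_congr rfl fun m _ => ?_
      rw [← Finset.mul_sum, Finset.sum_add_distrib, ← Finset.mul_sum, ← Finset.mul_sum, cc_neg, psiv, add_mul]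
      rfl
    have c4 : n * PowerSeries.coeff M E = ∑ m ∈ M.divisors, (m : ℂ) * (∑ v ∈ S, (κ v : ℂ) * ∑ j ∈ N.divisors,
        if (j : ℤ) ∣ m then γ v.2 j / j * psiv v (((m : ℤ) / j : ℤ) : ZMod N) else 0) := by
      rw [c3]
      simp only [Finset.mul_sum (s := S)]
      rw [Finset.sum_comm (s := M.divisors)]
      refine Finset.sum_congr rfl fun v _ => ?_
      simp only [hγ1]
      rw [divisor_swap (γ v.2) (fun m => psiv v (m : ZMod N)) hM N.divisors (fun j hj => Nat.pos_of_mem_divisors hj),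
        Finset.mul_sum]
      refine Finset.sum_congr rfl fun m _ => ?_
      rw [mul_left_comm]
      congr 2
      refine Finset.sum_congr rfl fun j _ => ?_
      rw [if_congr (Int.natCast_dvd_natCast (m := j) (n := m)).symm rfl rfl]
      congr 3
      rw [← Int.natCast_div, Int.cast_natCast]
    apply mul_left_cancel₀ hn0
    rw [c4, Finset.mul_sum]
    refine Finset.sum_congr rfl fun m _ => ?_
    field_simp

end Gal

lemma divisor_ind_rat {b : ℕ → ℂ} {e : ℕ → ℂ}
    (h : ∀ M : ℕ, 0 < M → e M = ∑ m ∈ M.divisors, (m : ℂ) * b m) (he : ∀ M, e M ∈ QR) :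
    ∀ m : ℕ, 0 < m → b m ∈ QR := by
  intro m
  induction m using Nat.strong_induction_on with
  | _ m ih =>
    intro hm
    have h1 := h m hm
    rw [← Nat.insert_self_properDivisors hm.ne', Finset.sum_insert Nat.self_notMem_properDivisors] at h1
    have h2 : ∑ i ∈ m.properDivisors, (i : ℂ) * b i ∈ QR := by
      refine QR.sum_mem fun i hi => ?_
      rw [Nat.mem_properDivisors] at hi
      exact QR.mul_mem ⟨i, by simp⟩ (ih i hi.2 (Nat.pos_of_dvd_of_pos hi.1 hm))
    have hm0 : (m : ℂ) ≠ 0 := by exact_mod_cast hm.ne'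
    have h3 : b m = (((m : ℚ)⁻¹ : ℚ) : ℂ) * (e m - ∑ i ∈ m.properDivisors, (i : ℂ) * b i) := by
      rw [h1]; push_cast; field_simp; ring
    rw [h3]
    exact QR.mul_mem ⟨(m : ℚ)⁻¹, by simp⟩ (QR.sub_mem (he m) h2)

lemma divisor_ind_zero {N : ℕ} {b : ℕ → ℂ} {e : ℕ → ℂ}
    (h : ∀ M : ℕ, 0 < M → e M = ∑ m ∈ M.divisors, (m : ℂ) * b m) (he : ∀ M, ¬ N ∣ M → e M = 0) :
    ∀ m : ℕ, 0 < m → ¬ N ∣ m → b m = 0 := by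
  intro m
  induction m using Nat.strong_induction_on with
  | _ m ih =>
    intro hm hNm
    have h1 := h m hm
    rw [← Nat.insert_self_properDivisors hm.ne', Finset.sum_insert Nat.self_notMem_properDivisors,
      he m hNm, Finset.sum_eq_zero, add_zero] at h1
    · have hm0 : (m : ℂ) ≠ 0 := by exact_mod_cast hm.ne'
      rcases mul_eq_zero.mp h1.symm with h | h
      · exact absurd h hm0
      · exact h
    · intro i hi
      rw [Nat.mem_properDivisors] at hi
      rw [ih i hi.2 (Nat.pos_of_dvd_of_pos hi.1 hm) (fun hd => hNm (hd.trans hi.1)), mul_zero]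

lemma thd_expand {N : ℕ} (hN : N ≠ 0) (p : PowerSeries ℂ) :
    thd (PowerSeries.expand N hN p) = (N : PowerSeries ℂ) * PowerSeries.expand N hN (thd p) := by
  ext n
  have : (N : PowerSeries ℂ) = PowerSeries.C (N : ℂ) := by simp
  rw [this, PowerSeries.coeff_C_mul, coeff_thd]
  by_cases h : N ∣ n
  · obtain ⟨m, rfl⟩ := h
    rw [PowerSeries.coeff_expand_mul, PowerSeries.coeff_expand_mul, coeff_thd]; push_cast; ring
  · rw [PowerSeries.coeff_expand_of_not_dvd _ _ _ h, PowerSeries.coeff_expand_of_not_dvd _ _ _ h]; simp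

lemma thd_mem {R : Subring ℂ} {p : PowerSeries ℂ} (h : p ∈ InS R) : thd p ∈ InS R := by
  intro n
  rw [coeff_thd]
  exact R.mul_mem (natCast_mem R n) (h n)

lemma exponents {N : ℕ} [NeZero N] {p : PowerSeries ℂ} (hpQ : p ∈ InS QR)
    (hpc : PowerSeries.constantCoeff p = 1) {D : ℕ} (hD : 0 < D) {k : ZMod N × ZMod N → ℤ}
    (h : (D : PowerSeries ℂ) * thd (PowerSeries.expand N (NeZero.ne N) p) =
      PowerSeries.expand N (NeZero.ne N) p * -(∑ v ∈ Finset.univ.erase (0 : ZMod N × ZMod N),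
        (12 * N * k v : ℤ) * (Lc (cA N v) + Lc (cB N v)))) :
    ∃ (L : ℕ) (a : ℤ → ℚ), 0 < L ∧ (∀ m i : ℤ, a (m + L * i) = a m) ∧ (∀ m, a (-m) = a m) ∧ a 0 = 0 ∧
      thd p = p * -(PowerSeries.mk fun M => ∑ m ∈ M.divisors, (m : ℂ) * (a m : ℂ)) := by
  have hN : 0 < N := NeZero.pos N
  set E := ∑ v ∈ Finset.univ.erase (0 : ZMod N × ZMod N),
        ((12 * N * k v : ℤ) : PowerSeries ℂ) * (Lc (cA N v) + Lc (cB N v)) with hE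
  have hp0 : PowerSeries.constantCoeff p ≠ 0 := by rw [hpc]; exact one_ne_zero
  set E' : PowerSeries ℂ := -((D : PowerSeries ℂ) * (N : PowerSeries ℂ) * thd p * p⁻¹) with hE'
  have hE'Q : E' ∈ InS QR := by
    refine neg_mem (mul_mem (mul_mem (mul_mem (natCast_mem _ _) (natCast_mem _ _)) (thd_mem hpQ))
      (InS_inv hpQ hpc))
  have hEE : E = PowerSeries.expand N (NeZero.ne N) E' := by
    have h1 : PowerSeries.expand N (NeZero.ne N) p ≠ 0 :=
      ne_zero_of_const (by rw [constantCoeff_expand', hpc])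
    apply mul_left_cancel₀ h1
    rw [thd_expand] at h
    have h2 : PowerSeries.expand N (NeZero.ne N) p * PowerSeries.expand N (NeZero.ne N) E' =
        - ((D : PowerSeries ℂ) * (N : PowerSeries ℂ) * PowerSeries.expand N (NeZero.ne N) (thd p)) := by
      rw [← map_mul, hE']
      have : p * -((D : PowerSeries ℂ) * (N : PowerSeries ℂ) * thd p * p⁻¹) =
          -((D : PowerSeries ℂ) * (N : PowerSeries ℂ) * thd p) := by
        have := PowerSeries.mul_inv_cancel p hp0
        linear_combination (-((D : PowerSeries ℂ) * (N : PowerSeries ℂ) * thd p)) * this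
      rw [this, map_neg, map_mul, map_mul, map_natCast, map_natCast]
    rw [h2]
    linear_combination h
  have hEQ : E ∈ InS QR := by
    intro n
    rw [hEE]
    by_cases hd : N ∣ n
    · obtain ⟨m, rfl⟩ := hd
      rw [PowerSeries.coeff_expand_mul]; exact hE'Q m
    · rw [PowerSeries.coeff_expand_of_not_dvd _ _ _ hd]; exact zero_mem _
  obtain ⟨b, b1, b2, b3, b4⟩ := exists_b (fun v => 12 * N * k v) E hEQ hE
  have r1 := divisor_ind_rat (b := fun m : ℕ => b m) (e := fun M => PowerSeries.coeff M E) b4 hEQ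
  have r2 := divisor_ind_zero (N := N) (b := fun m : ℕ => b m) (e := fun M => PowerSeries.coeff M E) b4 (by
    intro M hM; beta_reduce; rw [hEE, PowerSeries.coeff_expand_of_not_dvd _ _ _ hM])
  have r3 : ∀ m : ℤ, b m ∈ QR := by
    intro m
    have : ∃ n : ℕ, 0 < n ∧ (n : ℤ) = m + (N ^ 2 : ℕ) * (m.natAbs + 1) := by
      have h5 : (0 : ℤ) < m + (N ^ 2 : ℕ) * (m.natAbs + 1) := by
        have : (1 : ℤ) ≤ (N ^ 2 : ℕ) := by exact_mod_cast Nat.one_le_pow _ _ hN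
        have h7 : -(m.natAbs : ℤ) ≤ m := by omega
        nlinarith [Int.natCast_nonneg m.natAbs]
      obtain ⟨n, hn⟩ := Int.eq_ofNat_of_zero_le h5.le
      exact ⟨n, by omega, hn.symm⟩
    obtain ⟨n, hn, hn2⟩ := this
    rw [← b1 m (m.natAbs + 1), ← hn2]
    exact r1 n hn
  choose a0 ha0 using r3
  have ha0' : ∀ m, (a0 m : ℂ) = b m := fun m => by rw [← ha0 m]; simp
  have ainj : ∀ m m', b m = b m' → a0 m = a0 m' := by
    intro m m' hb
    rw [← ha0', ← ha0'] at hb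
    exact_mod_cast hb
  refine ⟨N, fun m => a0 (N * m) / D, hN, ?_, ?_, ?_, ?_⟩
  · intro m i
    beta_reduce
    congr 1
    apply ainj
    rw [← b1 (N * m) i]; congr 1; push_cast; ring
  · intro m
    beta_reduce
    congr 1
    apply ainj
    rw [mul_neg, b2]
  · have : a0 0 = 0 := by
      have := ha0' 0
      rw [b3] at this
      exact_mod_cast this
    simp [this]
  · have key : E' = ((D : PowerSeries ℂ) * (N : PowerSeries ℂ)) * (PowerSeries.mk fun M => ∑ m ∈ M.divisors, (m : ℂ) * ((a0 (N * m) / D : ℚ) : ℂ)) := by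
      ext M
      have e0 : (D : PowerSeries ℂ) * (N : PowerSeries ℂ) = PowerSeries.C (D * N : ℂ) := by simp
      have e1 : PowerSeries.coeff M E' = PowerSeries.coeff (N * M) E := by
        rw [hEE, PowerSeries.coeff_expand_mul]
      rw [e0, PowerSeries.coeff_C_mul, PowerSeries.coeff_mk, e1]
      rcases Nat.eq_zero_or_pos M with rfl | hM
      · rw [← e1, hE']; simp [thd]
      rw [b4 _ (by positivity), Finset.mul_sum]
      have hD0 : (D : ℂ) ≠ 0 := by exact_mod_cast hD.ne'
      have e2 : ∑ m ∈ (N * M).divisors, (m : ℂ) * b m = ∑ m ∈ (N * M).divisors.filter (fun m => N ∣ m), (m : ℂ) * b m := by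
        rw [Finset.sum_filter]
        refine Finset.sum_congr rfl fun m hm => ?_
        split_ifs with hd
        · rfl
        · have h8 := r2 m (Nat.pos_of_mem_divisors hm) hd
          beta_reduce at h8
          rw [h8, mul_zero]
      rw [e2]
      symm
      refine Finset.sum_nbij' (fun m => N * m) (fun m => m / N) ?_ ?_ ?_ ?_ ?_
      · intro m hm
        rw [Nat.mem_divisors] at hm
        rw [Finset.mem_filter, Nat.mem_divisors]
        exact ⟨⟨Nat.mul_dvd_mul_left N hm.1, by positivity⟩, dvd_mul_right _ _⟩
      · intro m hm
        rw [Finset.mem_filter, Nat.mem_divisors] at hm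
        obtain ⟨⟨h5, h6⟩, ⟨i, rfl⟩⟩ := hm
        rw [Nat.mul_div_cancel_left _ hN, Nat.mem_divisors]
        exact ⟨Nat.dvd_of_mul_dvd_mul_left hN h5, hM.ne'⟩
      · intro m _; exact Nat.mul_div_cancel_left _ hN
      · intro m hm
        rw [Finset.mem_filter] at hm
        exact Nat.mul_div_cancel' hm.2
      · intro m _
        push_cast
        rw [ha0']
        field_simp
    have hDN : (D : PowerSeries ℂ) * (N : PowerSeries ℂ) ≠ 0 := by
      have e0 : (D : PowerSeries ℂ) * (N : PowerSeries ℂ) = PowerSeries.C (D * N : ℂ) := by simp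
      rw [e0]
      intro h0
      have h1 := congrArg PowerSeries.constantCoeff h0
      simp at h1
      omega
    apply mul_left_cancel₀ hDN
    have h9 : p * E' = -((D : PowerSeries ℂ) * (N : PowerSeries ℂ) * thd p) := by
      rw [hE']
      have := PowerSeries.mul_inv_cancel p hp0
      linear_combination (-((D : PowerSeries ℂ) * (N : PowerSeries ℂ) * thd p)) * this
    rw [key] at h9
    linear_combination h9

lemma decay {h : ℍ → ℂ} (hol : MDifferentiable 𝓘(ℂ) 𝓘(ℂ) h) (per : ∀ z, h ((1 : ℝ) +ᵥ z) = h z)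
    (bd : IsBoundedAtImInfty h) :
    ∃ c, (fun z => h z - c) =O[atImInfty] (fun z : ℍ => ee z) := by
  have hper : Function.Periodic (h ∘ ofComplex) (1 : ℝ) := by
    intro w
    by_cases hw : 0 < w.im
    · have hw' : 0 < (w + (1 : ℝ)).im := by simpa using hw
      simp only [Function.comp_apply, ofComplex_apply_of_im_pos hw', ofComplex_apply_of_im_pos hw]
      rw [← per ⟨w, hw⟩]
      congr 1
      ext
      simp [add_comm]
    · have hw0 : w.im ≤ 0 := not_lt.mp hw
      have hw' : (w + (1 : ℝ)).im ≤ 0 := by simpa using hw0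
      simp only [Function.comp_apply, ofComplex_apply_of_im_nonpos hw', ofComplex_apply_of_im_nonpos hw0]
  have := UpperHalfPlane.exp_decay_sub_atImInfty one_pos hper hol bd
  refine ⟨_, this.trans ?_⟩
  refine Asymptotics.IsBigO.of_bound 1 (Eventually.of_forall fun z => ?_)
  rw [norm_ee]
  simp

lemma one_vadd_eq (z : ℍ) : (1 : ℝ) +ᵥ z = ModularGroup.T • z := by
  rw [UpperHalfPlane.modular_T_smul]

lemma level_one {J : ℍ → ℂ} (Jhol : MDifferentiable 𝓘(ℂ) 𝓘(ℂ) J)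
    (Jinv : ∀ (A : SL(2, ℤ)) z, J (A • z) = J z) (Jord : HasOrd J (-1)) (k : ℕ) :
    ∀ g : ℍ → ℂ, MDifferentiable 𝓘(ℂ) 𝓘(ℂ) g → (∀ (A : SL(2, ℤ)) z, g (A • z) = g z) →
    IsBoundedAtImInfty (fun z : ℍ => g z * ee (k * z)) →
    g ∈ Submodule.span ℂ (Set.range fun (n : ℕ) (z : ℍ) => J z ^ n) := by
  induction k with
  | zero =>
    intro g hol inv bd
    have bd' : IsBoundedAtImInfty g := by
      have : (fun z : ℍ => g z * ee ((0 : ℕ) * z)) = g := by ext z; simp [ee_zero]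
      rwa [this] at bd
    obtain ⟨c, hc⟩ := const_of_bounded one_pos hol (fun A _ z => inv A z) (fun A => by
      have : (fun z : ℍ => g (A • z)) = g := funext (inv A)
      rwa [this])
    have : g = c • (fun z => J z ^ 0) := by ext z; simp [hc]
    rw [this]
    exact Submodule.smul_mem _ _ (Submodule.subset_span ⟨0, rfl⟩)
  | succ k ih =>
    intro g hol inv bd
    have eehol : MDifferentiable 𝓘(ℂ) 𝓘(ℂ) (fun z : ℍ => ee (((k + 1 : ℕ) : ℂ) * z)) := by
      apply hol_of_differentiableOn (F := fun z : ℂ => ee (((k + 1 : ℕ) : ℂ) * z))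
      exact (differentiable_ee.comp (differentiable_id.const_mul _)).differentiableOn
    have eeper : ∀ z : ℍ, ee (((k + 1 : ℕ) : ℂ) * (((1 : ℝ) +ᵥ z : ℍ) : ℂ)) = ee (((k + 1 : ℕ) : ℂ) * z) := by
      intro z
      rw [UpperHalfPlane.coe_vadd, Complex.ofReal_one, mul_add, ee_add, mul_one, ee_nat, one_mul]
    obtain ⟨c, hc⟩ := decay (hol_mul hol eehol) (fun z => by
      beta_reduce; rw [eeper, one_vadd_eq, inv]) bd
    have o2 : HasOrd (fun z : ℍ => J z ^ (k + 1) * ee (((k + 1 : ℕ) : ℂ) * z)) 0 := by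
      have := (Jord.pow (k + 1)).mul (HasOrd.ee_mul ((k + 1 : ℕ) : ℝ))
      have e : ((k + 1 : ℕ) : ℝ) * (-1) + ((k + 1 : ℕ) : ℝ) = 0 := by ring
      rw [e] at this
      exact this.congr fun z => by simp
    obtain ⟨c', hc'⟩ := decay (hol_mul (hol_pow Jhol (k + 1)) eehol) (fun z => by
      beta_reduce; rw [eeper, one_vadd_eq, Jinv]) (o2.bounded le_rfl)
    have hee : Tendsto (fun z : ℍ => ee z) atImInfty (𝓝 0) := by
      have := tendsto_ee_zero one_pos
      simpa using this
    have c'0 : c' ≠ 0 := by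
      obtain ⟨κ, hκ, t⟩ := o2
      have t2 := hc'.trans_tendsto hee
      have t3 : Tendsto (fun z : ℍ => J z ^ (k + 1) * ee (((k + 1 : ℕ) : ℂ) * z)) atImInfty (𝓝 c') := by
        have := t2.add_const c'
        simpa using this
      have t4 : Tendsto (fun z : ℍ => J z ^ (k + 1) * ee (((k + 1 : ℕ) : ℂ) * z)) atImInfty (𝓝 κ) := by
        refine t.congr fun z => ?_
        simp [ee_zero]
      rw [tendsto_nhds_unique t3 t4]; exact hκ
    set g2 : ℍ → ℂ := fun z => g z - c / c' * J z ^ (k + 1) with hg2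
    have m2 : g2 ∈ Submodule.span ℂ (Set.range fun (n : ℕ) (z : ℍ) => J z ^ n) := by
      apply ih
      · exact hol_sub hol (hol_mul (hol_const _) (hol_pow Jhol _))
      · intro A z; simp only [hg2, inv, Jinv]
      · have h1 := hc.sub (hc'.const_mul_left (c / c'))
        have h2 := h1.mul (Asymptotics.isBigO_refl (fun z : ℍ => ee (-z)) atImInfty)
        have h3 : (fun z : ℍ => g2 z * ee (k * z)) =O[atImInfty] (fun z : ℍ => ee z * ee (-z)) := by
          refine h2.congr_left fun z => ?_
          have e : ee (((k + 1 : ℕ) : ℂ) * z) = ee (k * z) * ee z := by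
            rw [← ee_add]; congr 1; push_cast; ring
          have e2 : ee z * ee (-z) = 1 := by rw [← ee_add, add_neg_cancel, ee_zero]
          rw [e, hg2]
          field_simp
          linear_combination (c' * g z * ee (k * z) - c * J z ^ (k + 1) * ee (k * z)) * e2
        refine h3.trans ?_
        refine Asymptotics.IsBigO.of_bound 1 (Eventually.of_forall fun z => ?_)
        rw [← ee_add, add_neg_cancel, ee_zero]; simp
    have : g = g2 + (c / c') • (fun z => J z ^ (k + 1)) := by
      ext z; simp [hg2]
    rw [this]
    exact Submodule.add_mem _ m2 (Submodule.smul_mem _ _ (Submodule.subset_span ⟨k + 1, rfl⟩))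

lemma bz_eq {N : ℕ} [NeZero N] {x y : ZMod N} (h : bz x = bz y) : x = y ∨ x = -y := by
  rw [bz, bz, bern_of_lt (ZMod.val_lt x), bern_of_lt (ZMod.val_lt y)] at h
  have hN : (N : ℝ) ≠ 0 := by exact_mod_cast NeZero.ne N
  have h2 : ((x.val : ℝ) - y.val) * (x.val + y.val - N) = 0 := by
    field_simp at h
    linear_combination h / 6
  rcases mul_eq_zero.mp h2 with h3 | h3
  · left
    apply ZMod.val_injective N
    exact_mod_cast sub_eq_zero.mp h3
  · right
    have h4 : x.val + y.val = N := by exact_mod_cast sub_eq_zero.mp h3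
    have h5 := congrArg (fun n : ℕ => (n : ZMod N)) h4
    simp only [Nat.cast_add, ZMod.natCast_val, ZMod.cast_id', id, CharP.cast_eq_zero] at h5
    exact eq_neg_of_add_eq_zero_left h5

lemma good_Gamma {N : ℕ} (hN : 2 ≤ N) {A : SL(2, ℤ)}
    (h : ∀ r t : ℤ, ∀ z : ℍ, U N r t ((A • z : ℍ) : ℂ) = U N r t z) :
    A ∈ CongruenceSubgroup.Gamma N ∨ -A ∈ CongruenceSubgroup.Gamma N := by
  have : NeZero N := ⟨by omega⟩
  have hN0 : 0 < N := by omega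
  have hNR : (N : ℝ) ≠ 0 := by exact_mod_cast NeZero.ne N
  have n1 : ¬ ((N : ℤ) ∣ 1) := fun hd => by
    have := Int.le_of_dvd one_pos hd
    omega
  have key : ∀ r t : ℤ, ¬ ((N : ℤ) ∣ r ∧ (N : ℤ) ∣ t) → ∀ B : SL(2, ℤ),
      bz (((r * (A * B) 0 0 + t * (A * B) 1 0 : ℤ)) : ZMod N) = bz ((r * B 0 0 + t * B 1 0 : ℤ) : ZMod N) := by
    intro r t hrt B
    have o1 := U_smul_ord hN0 hrt (A * B)
    have o2 := U_smul_ord hN0 hrt B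
    have o3 := o2.congr (h := fun z : ℍ => U N r t (((A * B) • z : ℍ) : ℂ)) (fun z => by
      rw [mul_smul, h])
    have := o1.unique o3
    rw [bz_intCast, bz_intCast]
    exact mul_left_cancel₀ (by positivity) this
  have k1 := key 1 0 (fun h => n1 h.1) 1
  have k2 := key 1 0 (fun h => n1 h.1) ModularGroup.S
  have k3 := key 0 1 (fun h => n1 h.2) 1
  have s0 := (mulS_entries A 0).1
  rw [s0] at k2
  simp [ModularGroup.coe_S] at k1 k2 k3
  have b0 : ((A 0 1 : ℤ) : ZMod N) = 0 := by simpa using bz_eq k2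
  have c0 : ((A 1 0 : ℤ) : ZMod N) = 0 := by simpa using bz_eq k3
  have d := SL_det_zmod N A
  rw [b0, zero_mul, sub_zero] at d
  rcases bz_eq k1 with a1 | a1
  · left
    rw [CongruenceSubgroup.Gamma_mem]
    refine ⟨a1, b0, c0, ?_⟩
    rw [a1, one_mul] at d; exact d
  · right
    rw [CongruenceSubgroup.Gamma_mem]
    rw [a1] at d
    simp only [Matrix.SpecialLinearGroup.coe_neg, Matrix.neg_apply, Int.cast_neg]
    refine ⟨by rw [a1, neg_neg], by rw [b0, neg_zero], by rw [c0, neg_zero], ?_⟩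
    linear_combination d

/-- `h` has an expansion in `q^{1/N}` with algebraic integer coefficients and finite pole order -/
def IsAR (N : ℕ) (h : ℍ → ℂ) : Prop :=
  ∃ (m : ℕ) (W : PowerSeries ℂ) (g : ℂ → ℂ), HP W g ∧ W ∈ InS OR ∧
    ∀ z : ℍ, h z * ee ((z : ℂ) / N) ^ m = g (ee ((z : ℂ) / N))

def AR (N : ℕ) : Subring (ℍ → ℂ) where
  carrier := {h | IsAR N h}
  mul_mem' {a b} ha hb := by
    obtain ⟨m, W, g, h1, h2, h3⟩ := ha
    obtain ⟨m', W', g', h1', h2', h3'⟩ := hb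
    refine ⟨m + m', W * W', _, h1.mul h1', mul_mem h2 h2', fun z => ?_⟩
    rw [← h3, ← h3', pow_add, Pi.mul_apply]; ring
  one_mem' := ⟨0, 1, _, HP.one, one_mem _, fun z => by simp⟩
  add_mem' {a b} ha hb := by
    obtain ⟨m, W, g, h1, h2, h3⟩ := ha
    obtain ⟨m', W', g', h1', h2', h3'⟩ := hb
    refine ⟨m + m', W * PowerSeries.X ^ m' + W' * PowerSeries.X ^ m, _,
      (h1.mul (HP.X.pow m')).add (h1'.mul (HP.X.pow m)),
      add_mem (mul_mem h2 (pow_mem InS_X _)) (mul_mem h2' (pow_mem InS_X _)), fun z => ?_⟩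
    beta_reduce
    rw [← h3, ← h3', pow_add, Pi.add_apply]; ring
  zero_mem' := ⟨0, PowerSeries.C 0, _, HP.C 0, InS_C (zero_mem _), fun z => by simp⟩
  neg_mem' {a} ha := by
    obtain ⟨m, W, g, h1, h2, h3⟩ := ha
    refine ⟨m, -W, _, h1.neg, neg_mem h2, fun z => ?_⟩
    rw [← h3]; simp

lemma mem_AR {N : ℕ} {h : ℍ → ℂ} : h ∈ AR N ↔ IsAR N h := Iff.rfl

lemma AR_rep_ne_zero {N : ℕ} {h : ℍ → ℂ} (hh : h ≠ 0) {m : ℕ} {W : PowerSeries ℂ} {g : ℂ → ℂ}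
    (hN : 0 < N) (h1 : HP W g) (h3 : ∀ z : ℍ, h z * ee ((z : ℂ) / N) ^ m = g (ee ((z : ℂ) / N))) : W ≠ 0 := by
  rintro rfl
  apply hh
  ext z
  have e := h3 z
  have hx : ‖ee ((z : ℂ) / N)‖ < 1 := by
    apply norm_ee_lt_one
    rw [Complex.div_natCast_im]
    have := z.im_pos
    have : (0 : ℝ) < N := by exact_mod_cast hN
    exact div_pos z.im_pos this
  have h4 := h1 _ hx
  simp only [map_zero, zero_mul] at h4
  rw [h4.unique hasSum_zero] at e
  exact (mul_eq_zero.mp e).resolve_right (pow_ne_zero _ (ee_ne_zero _))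

lemma AR_mul_ne_zero {N : ℕ} (hN : 0 < N) {h h' : ℍ → ℂ} (a : h ∈ AR N) (a' : h' ∈ AR N)
    (n : h ≠ 0) (n' : h' ≠ 0) : h * h' ≠ 0 := by
  obtain ⟨m, W, g, h1, h2, h3⟩ := a
  obtain ⟨m', W', g', h1', h2', h3'⟩ := a'
  intro e
  have w := AR_rep_ne_zero n hN h1 h3
  have w' := AR_rep_ne_zero n' hN h1' h3'
  apply mul_ne_zero w w'
  refine (h1.mul h1').unique_punctured (g' := fun _ => 0) (by simpa using HP.C 0) fun x hx0 hx => ?_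
  obtain ⟨z, hz⟩ := exists_ee_div_eq hN hx0 hx
  beta_reduce
  rw [← hz, ← h3, ← h3']
  have : h z * h' z = 0 := congrFun e z
  linear_combination ee (z / N) ^ m * ee (z / N) ^ m' * this

lemma AR_prod_ne_zero {N : ℕ} (hN : 0 < N) {ι : Type*} (s : Finset ι) {h : ι → ℍ → ℂ}
    (a : ∀ i ∈ s, h i ∈ AR N) (n : ∀ i ∈ s, h i ≠ 0) : ∏ i ∈ s, h i ≠ 0 := by
  classical
  induction s using Finset.induction_on with
  | empty => simp
  | insert i s hi ih =>
    rw [Finset.prod_insert hi]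
    have ha := fun j hj => a j (Finset.mem_insert_of_mem hj)
    exact AR_mul_ne_zero hN (a i (Finset.mem_insert_self i s)) ((AR N).prod_mem ha)
      (n i (Finset.mem_insert_self i s)) (ih ha fun j hj => n j (Finset.mem_insert_of_mem hj))

lemma InS_expand {R : Subring ℂ} {p : PowerSeries ℂ} (h : p ∈ InS R) (N : ℕ) (hN : N ≠ 0) :
    PowerSeries.expand N hN p ∈ InS R := by
  intro n
  rw [PowerSeries.coeff_expand]
  split_ifs
  · exact h _
  · exact zero_mem _

lemma AR_dvd {M N : ℕ} (hN : 0 < N) (hMN : M ∣ N) {h : ℍ → ℂ} (a : h ∈ AR M) : h ∈ AR N := by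
  obtain ⟨e, rfl⟩ := hMN
  obtain ⟨m, W, g, h1, h2, h3⟩ := a
  have he : e ≠ 0 := by rintro rfl; simp at hN
  have hM : M ≠ 0 := by rintro rfl; simp at hN
  refine ⟨e * m, _, _, h1.expand he, InS_expand h2 e he, fun z => ?_⟩
  have : ee ((z : ℂ) / (M * e : ℕ)) ^ e = ee ((z : ℂ) / M) := by
    rw [← ee_nat_mul]; congr 1
    have : (e : ℂ) ≠ 0 := by exact_mod_cast he
    have : (M : ℂ) ≠ 0 := by exact_mod_cast hM
    push_cast; field_simp
  beta_reduce
  rw [pow_mul, this, h3]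

lemma kap_pow_mem {N : ℕ} (hN : 0 < N) (r : ℕ) (t : ℤ) : kap N r t ^ (12 * N) ∈ OR := by
  rw [kap, mul_pow]
  refine mul_mem ?_ (pow_mem ?_ _)
  · rw [← ee_nat_mul]
    have := ee_root_mem hN (6 * t * (r - N))
    convert this using 2
    have : (N : ℂ) ≠ 0 := by norm_cast; omega
    push_cast
    field_simp
    ring
  · split_ifs
    · refine sub_mem (one_mem _) ?_
      exact ee_root_mem hN t
    · exact one_mem _

lemma U_mem_AR (N : ℕ) [NeZero N] (r t : ℤ) : (fun z : ℍ => U N r t z) ∈ AR N := by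
  have hN : 0 < N := NeZero.pos N
  have hNC : (N : ℂ) ≠ 0 := by norm_cast; omega
  set v : ZMod N × ZMod N := ((r : ZMod N), (t : ZMod N)) with hv
  have e : (fun z : ℍ => U N r t z) = fun z : ℍ => U N (v.1.val : ℤ) (v.2.val : ℤ) z := by
    ext z
    apply U_congr hN _ _ z.2 <;> simp [hv]
  rw [e]
  set j : ℤ := 6 * (v.1.val : ℤ) ^ 2 - 6 * v.1.val * N + N ^ 2 with hj
  have hVa : ∀ z : ℍ, ee (Va N v * z) = ee ((z : ℂ) / N) ^ j := by
    intro z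
    rw [← ee_int_mul]
    congr 1
    rw [Va, hj]
    push_cast
    field_simp
    ring
  refine ⟨j.natAbs, PowerSeries.C (kap N v.1.val (v.2.val : ℤ) ^ (12 * N)) *
      PowerSeries.X ^ (j + j.natAbs).toNat * Vp N v ^ (12 * N), _,
    ((HP.C _).mul (HP.X.pow _)).mul ((HP_Vp N v).pow _),
    mul_mem (mul_mem (InS_C (kap_pow_mem hN _ _)) (pow_mem InS_X _)) (pow_mem (Vp_mem N v) _), fun z => ?_⟩
  beta_reduce
  rw [U_Vexp, hVa]
  have h0 : 0 ≤ j + j.natAbs := by omega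
  have : ee ((z : ℂ) / N) ^ (j + j.natAbs).toNat = ee ((z : ℂ) / N) ^ j * ee ((z : ℂ) / N) ^ j.natAbs := by
    rw [← zpow_natCast, Int.toNat_of_nonneg h0, zpow_add₀ (ee_ne_zero _), zpow_natCast]
  rw [this]
  ring

/-- Hauptmodul -/
def JJ (z : ℍ) : ℂ := U 2 1 0 z + U 2 0 1 z + U 2 1 1 z

lemma JJ_hol : MDifferentiable 𝓘(ℂ) 𝓘(ℂ) JJ :=
  hol_add (hol_add (U_hol two_pos 1 0) (U_hol two_pos 0 1)) (U_hol two_pos 1 1)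

lemma JJ_AR {N : ℕ} (hN : 0 < N) (h2 : 2 ∣ N) : JJ ∈ AR N := by
  apply AR_dvd hN h2
  exact add_mem (add_mem (U_mem_AR 2 1 0) (U_mem_AR 2 0 1)) (U_mem_AR 2 1 1)

lemma JJ_S (z : ℍ) : JJ (ModularGroup.S • z) = JJ z := by
  simp only [JJ, U_smul, ModularGroup.coe_S]
  have e1 : U 2 0 (-1) z = U 2 0 1 z := U_congr two_pos rfl (by decide) z.2
  have e2 : U 2 1 (-1) z = U 2 1 1 z := U_congr two_pos rfl (by decide) z.2
  simp [e1, e2]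
  ring

lemma JJ_T (z : ℍ) : JJ (ModularGroup.T • z) = JJ z := by
  simp only [JJ, U_smul, ModularGroup.coe_T]
  have e1 : U 2 1 2 z = U 2 1 0 z := U_congr two_pos rfl (by decide) z.2
  simp [e1]
  ring

lemma JJ_inv (A : SL(2, ℤ)) : ∀ z, JJ (A • z) = JJ z := by
  refine ST_induction (P := fun A => ∀ z, JJ (A • z) = JJ z) (by simp) ?_ ?_ A
  · intro A
    constructor
    · intro h z
      have := h (ModularGroup.S⁻¹ • z)
      rw [mul_smul, smul_inv_smul, ← JJ_S (ModularGroup.S⁻¹ • z), smul_inv_smul] at this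
      exact this
    · intro h z
      rw [mul_smul, h, JJ_S]
  · intro A
    constructor
    · intro h z
      have := h (ModularGroup.T⁻¹ • z)
      rw [mul_smul, smul_inv_smul, ← JJ_T (ModularGroup.T⁻¹ • z), smul_inv_smul] at this
      exact this
    · intro h z
      rw [mul_smul, h, JJ_T]

lemma JJ_ord : HasOrd JJ (-1) := by
  have n1 : ¬ ((2 : ℕ) : ℤ) ∣ 1 := by decide
  have o1 := U_ord two_pos (r := 1) (t := 0) (fun h => n1 h.1)
  have o2 := U_ord two_pos (r := 0) (t := 1) (fun h => n1 h.2)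
  have b1 := bern_of_lt (show 1 < 2 by norm_num)
  have b0 := bern_of_lt (show 0 < 2 by norm_num)
  have e1 : 6 * ((2 : ℕ) : ℝ) * bern (((1 : ℤ) : ℝ) / (2 : ℕ)) = -1 := by
    have : ((1 : ℤ) : ℝ) / (2 : ℕ) = ((1 : ℕ) : ℝ) / (2 : ℕ) := by norm_num
    rw [this, b1]; norm_num
  have e0 : 6 * ((2 : ℕ) : ℝ) * bern (((0 : ℤ) : ℝ) / (2 : ℕ)) = 2 := by
    have : ((0 : ℤ) : ℝ) / (2 : ℕ) = ((0 : ℕ) : ℝ) / (2 : ℕ) := by norm_num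
    rw [this, b0]; norm_num
  rw [e1] at o1
  rw [e0] at o2
  obtain ⟨κ, hκ, t1⟩ := o1
  obtain ⟨μ, hμ, t2⟩ := o2
  refine ⟨κ + 0 + κ, by simpa using hκ, ?_⟩
  have t2' : Tendsto (fun z : ℍ => U 2 0 1 z * ee (-(((-1 : ℝ) : ℂ) * z))) atImInfty (𝓝 0) := by
    have := t2.mul (tendsto_ee_zero (show (0 : ℝ) < 3 by norm_num))
    rw [mul_zero] at this
    refine this.congr fun z => ?_
    rw [mul_assoc, ← ee_add]
    congr 2; push_cast; ring
  have t3 : Tendsto (fun z : ℍ => U 2 1 1 z * ee (-(((-1 : ℝ) : ℂ) * z))) atImInfty (𝓝 κ) := by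
    have := t1.comp (tendsto_T_smul 1)
    refine this.congr fun z => ?_
    simp only [Function.comp]
    have hT : (((1 : ℤ) : ℝ) +ᵥ z) = ModularGroup.T • z := by rw [← one_vadd_eq]; norm_num
    rw [hT, U_smul, ← hT]
    simp only [ModularGroup.coe_T, UpperHalfPlane.coe_vadd]
    have : ee (-(((-1 : ℝ) : ℂ) * ((((1 : ℤ) : ℝ) : ℂ) + (z : ℂ)))) = ee (-(((-1 : ℝ) : ℂ) * z)) := by
      have : (-(((-1 : ℝ) : ℂ) * ((((1 : ℤ) : ℝ) : ℂ) + (z : ℂ)))) = 1 + (-(((-1 : ℝ) : ℂ) * z)) := by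
        push_cast; ring
      rw [this, ee_add, ee_one, one_mul]
    rw [this]
    simp
  refine ((t1.add t2').add t3).congr fun z => ?_
  rw [JJ]; ring

lemma span_AR_mul {N : ℕ} {x y : ℍ → ℂ} (hx : x ∈ Submodule.span ℂ (AR N : Set (ℍ → ℂ)))
    (hy : y ∈ AR N) : x * y ∈ Submodule.span ℂ (AR N : Set (ℍ → ℂ)) := by
  induction hx using Submodule.span_induction with
  | mem x h => exact Submodule.subset_span (mul_mem h hy)
  | zero => rw [zero_mul]; exact zero_mem _
  | add a b _ _ ha hb => rw [add_mul]; exact add_mem ha hb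
  | smul c a _ ha => rw [smul_mul_assoc]; exact Submodule.smul_mem _ _ ha

lemma coset_eq {N : ℕ} {f : ℍ → ℂ} (inv : ∀ A ∈ CongruenceSubgroup.Gamma N, ∀ z : ℍ, f (A • z) = f z)
    {A B : SL(2, ℤ)} (h : (A : SL(2, ℤ) ⧸ CongruenceSubgroup.Gamma N) = B) (z : ℍ) :
    f (A • z) = f (B • z) := by
  have hn : (CongruenceSubgroup.Gamma N).Normal := CongruenceSubgroup.Gamma_normal N
  rw [QuotientGroup.eq] at h
  have h2 := hn.conj_mem _ h A
  have h3 : A * (A⁻¹ * B) * A⁻¹ = B * A⁻¹ := by group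
  rw [h3] at h2
  have := inv _ h2 (A • z)
  rw [← mul_smul, inv_mul_cancel_right] at this
  exact this.symm

lemma trace_mem {N : ℕ} (hN : 0 < N) (h2 : 2 ∣ N) [Fintype (SL(2, ℤ) ⧸ CongruenceSubgroup.Gamma N)]
    {f : ℍ → ℂ} (hol : MDifferentiable 𝓘(ℂ) 𝓘(ℂ) f)
    (inv : ∀ A ∈ CongruenceSubgroup.Gamma N, ∀ z : ℍ, f (A • z) = f z)
    (ord : ∀ A : SL(2, ℤ), ∃ α : ℝ, HasOrd (fun z => f (A • z)) α) :
    (fun z : ℍ => ∑ q : SL(2, ℤ) ⧸ CongruenceSubgroup.Gamma N, f (q.out • z)) ∈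
      Submodule.span ℂ (AR N : Set (ℍ → ℂ)) := by
  have hn : (CongruenceSubgroup.Gamma N).Normal := CongruenceSubgroup.Gamma_normal N
  choose α hα using ord
  set K : SL(2, ℤ) ⧸ CongruenceSubgroup.Gamma N → ℕ := fun q => ⌈|α q.out|⌉₊ with hK
  have h := level_one JJ_hol JJ_inv JJ_ord (∑ q, K q)
    (fun z : ℍ => ∑ q : SL(2, ℤ) ⧸ CongruenceSubgroup.Gamma N, f (q.out • z))
    (hol_sum _ fun q _ => hol_smul hol q.out) ?_ ?_
  · refine Submodule.span_mono ?_ h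
    rintro _ ⟨n, rfl⟩
    exact pow_mem (JJ_AR hN h2) n
  · intro B z
    beta_reduce
    rw [← Equiv.sum_comp (Equiv.mulRight (B : SL(2, ℤ) ⧸ CongruenceSubgroup.Gamma N))
      (fun q => f (q.out • z))]
    refine Finset.sum_congr rfl fun q _ => ?_
    rw [← mul_smul]
    apply coset_eq inv
    rw [QuotientGroup.mk_mul, QuotientGroup.out_eq', QuotientGroup.out_eq']
    rfl
  · have : (fun z : ℍ => (∑ q : SL(2, ℤ) ⧸ CongruenceSubgroup.Gamma N, f (q.out • z)) *
        ee ((∑ q, K q : ℕ) * z)) = ∑ q : SL(2, ℤ) ⧸ CongruenceSubgroup.Gamma N,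
          fun z : ℍ => f (q.out • z) * ee ((∑ q, K q : ℕ) * z) := by
      ext z
      rw [Finset.sum_apply, Finset.sum_mul]
    rw [this]
    refine Finset.sum_induction _ (fun g => IsBoundedAtImInfty g) (fun a b ha hb => ?_) ?_ ?_
    · exact BoundedAtFilter.add ha hb
    · exact (const_boundedAtFilter _ (0 : ℂ))
    · intro q _
      have o := (hα q.out).mul (HasOrd.ee_mul ((∑ q, K q : ℕ) : ℝ))
      have e : (0 : ℝ) ≤ α q.out + ((∑ q, K q : ℕ) : ℝ) := by
        have a1 : |α q.out| ≤ K q := Nat.le_ceil _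
        have a2 : (K q : ℝ) ≤ ((∑ q, K q : ℕ) : ℝ) := by
          exact_mod_cast Finset.single_le_sum (f := K) (fun _ _ => Nat.zero_le _) (Finset.mem_univ q)
        have a3 := neg_abs_le (α q.out)
        linarith
      have := o.bounded e
      convert this using 3
      simp

lemma trace_key {N : ℕ} (hN : 0 < N) (h2 : 2 ∣ N) {f : ℍ → ℂ} (hol : MDifferentiable 𝓘(ℂ) 𝓘(ℂ) f)
    (inv : ∀ A ∈ CongruenceSubgroup.Gamma N, ∀ z : ℍ, f (A • z) = f z)
    (ord : ∀ A : SL(2, ℤ), ∃ α : ℝ, HasOrd (fun z => f (A • z)) α) :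
    ∃ Den : ℍ → ℂ, Den ∈ AR N ∧ Den ≠ 0 ∧ f * Den ∈ Submodule.span ℂ (AR N : Set (ℍ → ℂ)) := by
  classical
  have : NeZero N := ⟨hN.ne'⟩
  have hN2 : 2 ≤ N := Nat.le_of_dvd hN h2
  have hn : (CongruenceSubgroup.Gamma N).Normal := CongruenceSubgroup.Gamma_normal N
  let _ : Fintype (SL(2, ℤ) ⧸ CongruenceSubgroup.Gamma N) := Fintype.ofFinite _
  set Q := SL(2, ℤ) ⧸ CongruenceSubgroup.Gamma N with hQ
  set good : Q → Prop := fun q => ∀ r t : ℤ, ∀ z : ℍ, U N r t ((q.out • z : ℍ) : ℂ) = U N r t z with hgood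
  have hex : ∀ q : Q, ∃ v : ℤ × ℤ, ¬ good q → ∃ z : ℍ, U N v.1 v.2 ((q.out • z : ℍ) : ℂ) ≠ U N v.1 v.2 z := by
    intro q
    by_cases hq : good q
    · exact ⟨0, fun h => absurd hq h⟩
    · simp only [hgood] at hq
      push Not at hq
      obtain ⟨r, t, z, hz⟩ := hq
      exact ⟨(r, t), fun _ => ⟨z, hz⟩⟩
  choose v hv using hex
  set bad := Finset.univ.filter (fun q : Q => ¬ good q) with hbad
  have hv0 : ∀ a ∈ bad, ¬ ((N : ℤ) ∣ (v a).1 ∧ (N : ℤ) ∣ (v a).2) := by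
    intro a ha hd
    obtain ⟨z, hz⟩ := hv a (Finset.mem_filter.mp ha).2
    apply hz
    rw [U_smul]
    have d1 : (((v a).1 : ℤ) : ZMod N) = 0 := (ZMod.intCast_zmod_eq_zero_iff_dvd _ N).mpr hd.1
    have d2 : (((v a).2 : ℤ) : ZMod N) = 0 := (ZMod.intCast_zmod_eq_zero_iff_dvd _ N).mpr hd.2
    apply U_congr hN _ _ z.2 <;> push_cast <;> simp [d1, d2]
  set u : Q → ℍ → ℂ := fun a z => U N (v a).1 (v a).2 z with hu
  have u_AR : ∀ a, u a ∈ AR N := fun a => U_mem_AR N _ _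
  have uA_AR : ∀ a (A : SL(2, ℤ)), (fun z => u a (A • z)) ∈ AR N := by
    intro a A
    have : (fun z => u a (A • z)) = fun z : ℍ => U N ((v a).1 * A 0 0 + (v a).2 * A 1 0)
        ((v a).1 * A 0 1 + (v a).2 * A 1 1) z := by
      ext z; exact U_smul _ _ A z
    rw [this]; exact U_mem_AR N _ _
  set den : Q → ℍ → ℂ := fun a => u a - fun z => u a (a.out • z) with hden
  have den_AR : ∀ a, den a ∈ AR N := fun a => sub_mem (u_AR a) (uA_AR a a.out)
  have den_ne : ∀ a ∈ bad, den a ≠ 0 := by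
    intro a ha h0
    obtain ⟨z, hz⟩ := hv a (Finset.mem_filter.mp ha).2
    have := congrFun h0 z
    simp only [hden, Pi.sub_apply, Pi.zero_apply] at this
    exact hz (sub_eq_zero.mp this).symm
  refine ⟨∏ a ∈ bad, den a, (AR N).prod_mem fun a _ => den_AR a,
    AR_prod_ne_zero hN bad (fun a _ => den_AR a) den_ne, ?_⟩
  -- the traces
  have tr : ∀ t ∈ bad.powerset, (fun z : ℍ => ∑ q : Q, (f (q.out • z) * ∏ a ∈ t, u a (q.out • z))) ∈
      Submodule.span ℂ (AR N : Set (ℍ → ℂ)) := by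
    intro t ht
    rw [Finset.mem_powerset] at ht
    refine trace_mem hN h2 (f := fun z => f z * ∏ a ∈ t, u a z) ?_ ?_ ?_
    · exact hol_mul hol (hol_prod _ fun a _ => U_hol hN _ _)
    · intro A hA z
      beta_reduce
      rw [inv A hA]
      congr 1
      exact Finset.prod_congr rfl fun a _ => U_Gamma hN _ _ hA z
    · intro A
      obtain ⟨α, hα⟩ := ord A
      exact ⟨_, hα.mul (HasOrd.prod t fun a ha => U_smul_ord hN (hv0 a (ht ha)) A)⟩
  have main : (((Finset.univ.filter good).card : ℂ)) • (f * ∏ a ∈ bad, den a) =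
      ∑ t ∈ bad.powerset, (fun z : ℍ => ∑ q : Q, (f (q.out • z) * ∏ a ∈ t, u a (q.out • z))) *
        ∏ a ∈ bad \ t, (-(fun z => u a (a.out • z))) := by
    ext z
    simp only [Pi.smul_apply, Pi.mul_apply, Finset.sum_apply, Finset.prod_apply, Pi.neg_apply, smul_eq_mul]
    have e1 : ∀ q : Q, f (q.out • z) * ∏ a ∈ bad, (u a (q.out • z) + -u a (a.out • z)) =
        if good q then f z * ∏ a ∈ bad, den a z else 0 := by
      intro q
      split_ifs with hq
      · have : f (q.out • z) = f z := by
          rcases good_Gamma hN2 hq with h | h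
          · exact inv _ h z
          · rw [← neg_smul_H]; exact inv _ h z
        rw [this]
        congr 1
        refine Finset.prod_congr rfl fun a _ => ?_
        have : u a (q.out • z) = u a z := hq _ _ z
        rw [this, ← sub_eq_add_neg]; rfl
      · rw [Finset.prod_eq_zero (i := q) (by simp [hbad, hq]) (by ring), mul_zero]
    have e2 : ∑ q : Q, f (q.out • z) * ∏ a ∈ bad, (u a (q.out • z) + -u a (a.out • z)) =
        ((Finset.univ.filter good).card : ℂ) * (f z * ∏ a ∈ bad, den a z) := by
      rw [Finset.sum_congr rfl fun q _ => e1 q, ← Finset.sum_filter, Finset.sum_const, nsmul_eq_mul]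
    rw [← e2]
    simp only [Finset.prod_add, Finset.mul_sum, Finset.sum_mul]
    rw [Finset.sum_comm]
    refine Finset.sum_congr rfl fun t _ => Finset.sum_congr rfl fun q _ => ?_
    rw [mul_assoc]
  have hcard : ((Finset.univ.filter good).card : ℂ) ≠ 0 := by
    rw [Nat.cast_ne_zero, Finset.card_ne_zero]
    refine ⟨((1 : SL(2, ℤ)) : Q), ?_⟩
    rw [Finset.mem_filter]
    refine ⟨Finset.mem_univ _, fun r t z => ?_⟩
    have := coset_eq (N := N) (f := fun z : ℍ => U N r t z) (fun A hA z => U_Gamma hN r t hA z)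
      (A := ((1 : SL(2, ℤ)) : Q).out) (B := 1) (QuotientGroup.out_eq' _) z
    simpa using this
  rw [← Submodule.smul_mem_iff _ hcard, main]
  refine Submodule.sum_mem _ fun t ht => ?_
  refine span_AR_mul (tr t ht) ((AR N).prod_mem fun a _ => neg_mem (uA_AR a a.out))

lemma span_InS_mul {x y : PowerSeries ℂ} (hx : x ∈ Submodule.span ℂ (InS OR : Set (PowerSeries ℂ)))
    (hy : y ∈ InS OR) : x * y ∈ Submodule.span ℂ (InS OR : Set (PowerSeries ℂ)) := by
  induction hx using Submodule.span_induction with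
  | mem x h => exact Submodule.subset_span (mul_mem h hy)
  | zero => rw [zero_mul]; exact zero_mem _
  | add a b _ _ ha hb => rw [add_mul]; exact add_mem ha hb
  | smul c a _ ha => rw [smul_mul_assoc]; exact Submodule.smul_mem _ _ ha

lemma span_rep {N : ℕ} {x : ℍ → ℂ} (hx : x ∈ Submodule.span ℂ (AR N : Set (ℍ → ℂ))) :
    ∃ (m : ℕ) (W : PowerSeries ℂ) (g : ℂ → ℂ), HP W g ∧
      W ∈ Submodule.span ℂ (InS OR : Set (PowerSeries ℂ)) ∧
      ∀ z : ℍ, x z * ee ((z : ℂ) / N) ^ m = g (ee ((z : ℂ) / N)) := by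
  induction hx using Submodule.span_induction with
  | mem x h =>
    obtain ⟨m, W, g, h1, h2, h3⟩ := h
    exact ⟨m, W, g, h1, Submodule.subset_span h2, h3⟩
  | zero =>
    exact ⟨0, PowerSeries.C 0, _, HP.C 0, by simp, fun z => by simp⟩
  | add a b _ _ ha hb =>
    obtain ⟨m, W, g, h1, h2, h3⟩ := ha
    obtain ⟨m', W', g', h1', h2', h3'⟩ := hb
    refine ⟨m + m', W * PowerSeries.X ^ m' + W' * PowerSeries.X ^ m, _,
      (h1.mul (HP.X.pow m')).add (h1'.mul (HP.X.pow m)),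
      add_mem (span_InS_mul h2 (pow_mem InS_X _)) (span_InS_mul h2' (pow_mem InS_X _)), fun z => ?_⟩
    rw [← h3, ← h3', pow_add, Pi.add_apply]; ring
  | smul c a _ ha =>
    obtain ⟨m, W, g, h1, h2, h3⟩ := ha
    refine ⟨m, PowerSeries.C c * W, _, (HP.C c).mul h1, ?_, fun z => ?_⟩
    · rw [← PowerSeries.smul_eq_C_mul]; exact Submodule.smul_mem _ _ h2
    · rw [← h3]; simp [mul_assoc]

lemma mem_OR {x : ℂ} : x ∈ OR ↔ IsIntegral ℤ x := Iff.rfl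

lemma OR_alg {x : ℂ} (h : x ∈ OR) : x ∈ algebraicClosure ℚ ℂ := by
  rw [mem_algebraicClosure_iff]
  exact ((mem_OR.mp h).tower_top (A := ℚ)).isAlgebraic

lemma alg_multiple {x : ℂ} (h : x ∈ algebraicClosure ℚ ℂ) : ∃ d : ℕ, 0 < d ∧ (d : ℂ) * x ∈ OR := by
  rw [mem_algebraicClosure_iff] at h
  have h2 : IsAlgebraic ℤ x := (IsFractionRing.isAlgebraic_iff ℤ ℚ ℂ).mpr h
  obtain ⟨y, hy, hi⟩ := h2.exists_integral_multiple
  refine ⟨y.natAbs, Int.natAbs_pos.mpr hy, ?_⟩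
  have hi' : (y : ℂ) * x ∈ OR := by rw [mem_OR]; simpa using hi
  rcases Int.natAbs_eq y with e | e
  · have : (y : ℂ) = (y.natAbs : ℂ) := by
      conv_lhs => rw [e]
      simp
    rwa [← this]
  · have : (y : ℂ) = -(y.natAbs : ℂ) := by
      conv_lhs => rw [e]
      simp
    rw [this, neg_mul] at hi'
    simpa using neg_mem hi'

lemma span_descent {W : PowerSeries ℂ} (hW : W ∈ Submodule.span ℂ (InS OR : Set (PowerSeries ℂ)))
    (halg : ∀ n, PowerSeries.coeff n W ∈ algebraicClosure ℚ ℂ) :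
    ∃ d : ℕ, 0 < d ∧ PowerSeries.C (d : ℂ) * W ∈ InS OR := by
  classical
  obtain ⟨n, c, w, hw⟩ := Submodule.mem_span_set'.mp hW
  set K := algebraicClosure ℚ ℂ with hK
  obtain ⟨φ, hφ⟩ := LinearMap.exists_leftInverse_of_injective (Algebra.linearMap K ℂ)
    (LinearMap.ker_eq_bot.mpr (algebraMap K ℂ).injective)
  have hφ' : ∀ k : K, φ (k : ℂ) = k := fun k => LinearMap.congr_fun hφ k
  have hex : ∀ i, ∃ d : ℕ, 0 < d ∧ (d : ℂ) * (φ (c i) : ℂ) ∈ OR := fun i => alg_multiple (φ (c i)).2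
  choose d hd hdi using hex
  refine ⟨∏ i, d i, Finset.prod_pos fun i _ => hd i, fun M => ?_⟩
  rw [PowerSeries.coeff_C_mul]
  have e : PowerSeries.coeff M W = ∑ i, (φ (c i) : ℂ) * PowerSeries.coeff M (w i : PowerSeries ℂ) := by
    have h1 : PowerSeries.coeff M W = ∑ i, c i * PowerSeries.coeff M (w i : PowerSeries ℂ) := by
      rw [← hw, map_sum]; simp
    have hwK : ∀ i, PowerSeries.coeff M (w i : PowerSeries ℂ) ∈ K := fun i => OR_alg ((w i).2 M)
    have h2 : φ (PowerSeries.coeff M W) = ∑ i, (⟨_, hwK i⟩ : K) * φ (c i) := by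
      rw [h1, map_sum]
      refine Finset.sum_congr rfl fun i _ => ?_
      rw [← smul_eq_mul (a := (⟨_, hwK i⟩ : K)), ← map_smul]
      congr 1
      rw [mul_comm]; rfl
    have h3 := hφ' ⟨_, halg M⟩
    have h4 : PowerSeries.coeff M W = ((φ (PowerSeries.coeff M W) : K) : ℂ) := by
      rw [show φ (PowerSeries.coeff M W) = ⟨_, halg M⟩ from h3]
    rw [h4, h2]
    push_cast
    exact Finset.sum_congr rfl fun i _ => mul_comm _ _
  rw [e, Finset.mul_sum]
  refine sum_mem fun i _ => ?_
  rw [← mul_assoc]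
  refine mul_mem ?_ ((w i).2 M)
  rw [← Finset.mul_prod_erase Finset.univ d (Finset.mem_univ i), mul_comm, Nat.cast_mul, ← mul_assoc,
    mul_comm (φ (c i) : ℂ)]
  exact mul_mem (hdi i) (natCast_mem _ _)

lemma rat_int {q : ℚ} (h : (q : ℂ) ∈ OR) : ∃ n : ℤ, q = n := by
  rw [mem_OR] at h
  have h2 : IsIntegral ℤ q := by
    have : (q : ℂ) = algebraMap ℚ ℂ q := by simp
    rw [this] at h
    exact (isIntegral_algebraMap_iff (algebraMap ℚ ℂ).injective).mp h
  obtain ⟨n, hn⟩ := IsIntegrallyClosed.isIntegral_iff.mp h2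
  exact ⟨n, by rw [← hn]; simp⟩

lemma rat_pow_int {q : ℚ} {m : ℕ} (hm : 0 < m) (h : ∀ n : ℕ, ∃ k : ℤ, (m : ℚ) * q ^ n = k) : ∃ n : ℤ, q = n := by
  by_cases hb : q.den = 1
  · exact ⟨q.num, (Rat.coe_int_num_of_den_eq_one hb).symm⟩
  exfalso
  have hden := q.den_pos
  have h2 : 2 ≤ q.den := by omega
  obtain ⟨k, hk⟩ := h m
  have hdvd : (q.den : ℤ) ^ m ∣ m := by
    have hq : q = q.num / q.den := (Rat.num_div_den q).symm
    have hd0 : (q.den : ℚ) ≠ 0 := by positivity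
    have e : (m : ℤ) * q.num ^ m = k * (q.den : ℤ) ^ m := by
      have : (m : ℚ) * (q.num : ℚ) ^ m = k * (q.den : ℚ) ^ m := by
        have hqd : q * q.den = q.num := Rat.mul_den_eq_num q
        rw [← hk, mul_assoc, ← mul_pow, hqd]
      exact_mod_cast this
    have hcop : IsCoprime ((q.den : ℤ) ^ m) (q.num ^ m) := by
      apply IsCoprime.pow
      rw [Int.isCoprime_iff_gcd_eq_one]
      have := q.reduced
      rw [Int.gcd_comm]
      simpa [Int.gcd] using this
    exact hcop.dvd_of_dvd_mul_right ⟨k, by rw [e]; ring⟩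
  have h3 := Int.le_of_dvd (by exact_mod_cast hm) hdvd
  have h4 : m < q.den ^ m := lt_of_lt_of_le (Nat.lt_two_pow_self) (Nat.pow_le_pow_left h2 m)
  have : q.den ^ m ≤ m := by exact_mod_cast h3
  omega

lemma integrality {F C : PowerSeries ℂ} (hF : F ∈ InS QR) (hC : C ∈ InS OR) (hC0 : C ≠ 0)
    (hCF : C * F ∈ InS OR) {D : ℕ} (hD : 0 < D) (hFD : F ^ D ∈ InS OR) : F ∈ InS ZR := by
  have h1 : ∀ j, C ^ D * F ^ j ∈ InS OR := by
    intro j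
    have e : C ^ D * F ^ j = C ^ (D - j % D) * (C * F) ^ (j % D) * (F ^ D) ^ (j / D) := by
      have hlt := Nat.mod_lt j hD
      rw [mul_pow, ← pow_mul]
      have e1 : C ^ D = C ^ (D - j % D) * C ^ (j % D) := by rw [← pow_add]; congr 1; omega
      have e2 : F ^ j = F ^ (j % D) * F ^ (D * (j / D)) := by rw [← pow_add, Nat.mod_add_div]
      rw [e1, e2]; ring
    rw [e]
    exact mul_mem (mul_mem (pow_mem hC _) (pow_mem hCF _)) (pow_mem hFD _)
  intro i
  induction i using Nat.strong_induction_on with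
  | _ i ih =>
    obtain ⟨q, hq⟩ := hF i
    set t : PowerSeries ℂ := ((PowerSeries.trunc i F : Polynomial ℂ) : PowerSeries ℂ) with ht
    have htc : ∀ n, PowerSeries.coeff n t = if n < i then PowerSeries.coeff n F else 0 := by
      intro n; rw [ht, Polynomial.coeff_coe, PowerSeries.coeff_trunc]
    have ZO : ZR ≤ OR := by
      rintro _ ⟨n, rfl⟩
      exact intCast_mem _ n
    have htO : t ∈ InS OR := by
      intro n
      rw [htc]
      split_ifs with hn
      · exact ZO (ih n hn)
      · exact zero_mem _
    have h2 : ∀ n, C ^ D * (F - t) ^ n ∈ InS OR := by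
      intro n
      rw [sub_eq_add_neg, add_pow, Finset.mul_sum]
      refine sum_mem fun j _ => ?_
      have : C ^ D * (F ^ j * (-t) ^ (n - j) * ((n.choose j : ℕ) : PowerSeries ℂ)) =
        (C ^ D * F ^ j) * (-t) ^ (n - j) * ((n.choose j : ℕ) : PowerSeries ℂ) := by ring
      rw [this]
      exact mul_mem (mul_mem (h1 j) (pow_mem (neg_mem htO) _)) (natCast_mem _ _)
    have hdv : (PowerSeries.X : PowerSeries ℂ) ^ i ∣ F - t := by
      rw [PowerSeries.X_pow_dvd_iff]
      intro n hn
      rw [map_sub, htc, if_pos hn, sub_self]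
    obtain ⟨G, hG⟩ := hdv
    have hGi : PowerSeries.constantCoeff G = q := by
      have := congrArg (PowerSeries.coeff i) hG
      rw [map_sub, htc, if_neg (lt_irrefl _), sub_zero, ← hq] at this
      have e2 := PowerSeries.coeff_X_pow_mul G i 0
      rw [zero_add] at e2
      rw [e2] at this
      rw [← PowerSeries.coeff_zero_eq_constantCoeff_apply, ← this]; simp
    have hCD : C ^ D ≠ 0 := pow_ne_zero _ hC0
    set k := (C ^ D).order.toNat
    set C' := PowerSeries.divXPowOrder (C ^ D) with hC'
    have hCk : C ^ D = PowerSeries.X ^ k * C' := PowerSeries.X_pow_order_mul_divXPowOrder.symm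
    have hc0 : PowerSeries.constantCoeff C' ≠ 0 := by
      rw [hC', Ne, PowerSeries.constantCoeff_divXPowOrder_eq_zero_iff]; exact hCD
    set c := PowerSeries.constantCoeff C' with hc
    have h3 : ∀ n, c * (q : ℂ) ^ n ∈ OR := by
      intro n
      have := h2 n (k + i * n)
      have e : C ^ D * (F - t) ^ n = PowerSeries.X ^ (k + i * n) * (C' * G ^ n) := by
        rw [hCk, hG, mul_pow, ← pow_mul]; ring
      rw [e] at this
      have e2 := PowerSeries.coeff_X_pow_mul (C' * G ^ n) (k + i * n) 0
      rw [zero_add] at e2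
      rw [e2, PowerSeries.coeff_zero_eq_constantCoeff_apply, map_mul, map_pow, hGi] at this
      exact this
    have hcK : c ∈ algebraicClosure ℚ ℂ := by
      have := h3 0
      rw [pow_zero, mul_one] at this
      exact OR_alg this
    obtain ⟨m, hm, hmc⟩ := alg_multiple (inv_mem hcK)
    have h4 : ∀ n : ℕ, ∃ l : ℤ, (m : ℚ) * q ^ n = l := by
      intro n
      apply rat_int
      have := mul_mem hmc (h3 n)
      have e : (m : ℂ) * c⁻¹ * (c * (q : ℂ) ^ n) = (((m : ℚ) * q ^ n : ℚ) : ℂ) := by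
        push_cast; field_simp
      rwa [e] at this
    obtain ⟨n, hn⟩ := rat_pow_int hm h4
    refine ⟨n, ?_⟩
    rw [← hq, hn]; simp

lemma sN_int {N : ℕ} {f : ℍ → ℂ} {s : ℚ} {p : PowerSeries ℂ} {g : ℂ → ℂ}
    (inv : ∀ A ∈ CongruenceSubgroup.Gamma N, ∀ z : ℍ, f (A • z) = f z)
    (hp : HP p g) (hc : PowerSeries.constantCoeff p = 1)
    (hf : ∀ z : ℍ, f z = ee (s * z) * g (ee z)) : ∃ n : ℤ, (s : ℝ) * N = n := by
  have h1 : HasOrd f (s : ℝ) := by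
    have h2 := (HasOrd.ee_mul (s : ℝ)).mul (hp.hasOrd one_pos (by rw [hc]; exact one_ne_zero))
    rw [add_zero] at h2
    refine h2.congr fun z => ?_
    rw [hf]
    simp
  have := h1.int_of_periodic (N : ℤ) (by
    intro z
    rw [← UpperHalfPlane.modular_T_zpow_smul]
    apply inv
    simpa using CongruenceSubgroup.ModularGroup_T_pow_mem_Gamma (N : ℤ) (N : ℤ) dvd_rfl)
  simpa using this

lemma QR_alg {x : ℂ} (h : x ∈ QR) : x ∈ algebraicClosure ℚ ℂ := by
  obtain ⟨q, rfl⟩ := h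
  exact (algebraicClosure ℚ ℂ).algebraMap_mem q

lemma InS_OR_le : InS OR ≤ InS (algebraicClosure ℚ ℂ).toSubring :=
  fun _ h n => OR_alg (h n)

lemma InS_QR_le : InS QR ≤ InS (algebraicClosure ℚ ℂ).toSubring :=
  fun _ h n => QR_alg (h n)

lemma p_int {N : ℕ} [NeZero N] (h2 : 2 ∣ N) {f : ℍ → ℂ} (hol : MDifferentiable 𝓘(ℂ) 𝓘(ℂ) f)
    (inv : ∀ A ∈ CongruenceSubgroup.Gamma N, ∀ z : ℍ, f (A • z) = f z)
    (ord : ∀ A : SL(2, ℤ), ∃ α : ℝ, HasOrd (fun z => f (A • z)) α)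
    {s : ℚ} {p : PowerSeries ℂ} {g : ℂ → ℂ}
    (hp : HP p g) (hpQ : p ∈ InS QR) (hc : PowerSeries.constantCoeff p = 1)
    (hf : ∀ z : ℍ, f z = ee (s * z) * g (ee z))
    {D : ℕ} (hD : 0 < D) (hFD : PowerSeries.expand N (NeZero.ne N) p ^ D ∈ InS OR) : p ∈ InS ZR := by
  have hN : 0 < N := NeZero.pos N
  have hN0 : (N : ℂ) ≠ 0 := by exact_mod_cast hN.ne'
  obtain ⟨n, hn⟩ := sN_int inv hp hc hf
  have hF := hp.expand (NeZero.ne N)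
  have hFQ := InS_expand hpQ N (NeZero.ne N)
  set F := PowerSeries.expand N (NeZero.ne N) p with hFdef
  obtain ⟨Den, ⟨m, Dp, dg, d1, d2, d3⟩, hDen, hspan⟩ := trace_key hN h2 hol inv ord
  have hDp := AR_rep_ne_zero hDen hN d1 d3
  obtain ⟨m', W, gW, w1, w2, w3⟩ := span_rep hspan
  have key : (PowerSeries.X : PowerSeries ℂ) ^ (n.toNat + m') * F * Dp =
      PowerSeries.X ^ ((-n).toNat + m) * W := by
    refine (((HP.X.pow (n.toNat + m')).mul hF).mul d1).unique_punctured
      ((HP.X.pow ((-n).toNat + m)).mul w1) fun x hx0 hx => ?_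
    obtain ⟨z, hz⟩ := exists_ee_div_eq hN hx0 hx
    have e1 : ee z = x ^ N := by
      rw [← hz, ← ee_nat_mul]; congr 1; field_simp
    have e2 : ee (s * z) = x ^ n := by
      rw [← hz, ← ee_int_mul]; congr 1
      have hn' : (s : ℂ) * N = n := by exact_mod_cast hn
      rw [← hn']; field_simp
    have e3 := hf z
    rw [e1, e2] at e3
    have e4 := d3 z
    have e5 := w3 z
    rw [hz] at e4 e5
    rw [Pi.mul_apply] at e5
    have e6 := zpow_toNat hx0 n
    rw [pow_add, pow_add, ← e6, ← e4, ← e5, e3]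
    ring
  have hXW : PowerSeries.X ^ ((-n).toNat + m) * W ∈ Submodule.span ℂ (InS OR : Set (PowerSeries ℂ)) :=
    by rw [mul_comm]; exact span_InS_mul w2 (pow_mem InS_X _)
  obtain ⟨d, hd0, hd⟩ := span_descent hXW (by
    rw [← key]
    exact mul_mem (mul_mem (pow_mem InS_X _) (InS_QR_le hFQ)) (InS_OR_le d2))
  have hFZ : F ∈ InS ZR := by
    refine integrality (C := PowerSeries.C (d : ℂ) * PowerSeries.X ^ (n.toNat + m') * Dp) hFQ
      (mul_mem (mul_mem (InS_C (natCast_mem _ _)) (pow_mem InS_X _)) d2)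
      (mul_ne_zero (mul_ne_zero ?_ (pow_ne_zero _ PowerSeries.X_ne_zero)) hDp) ?_ hD hFD
    · intro h
      have := congrArg PowerSeries.constantCoeff h
      simp at this
      omega
    · rw [← key] at hd
      convert hd using 1
      ring
  intro i
  have := hFZ (N * i)
  rwa [hFdef, PowerSeries.coeff_expand_mul] at this

def cj (j : ℕ) (k : ℕ) : ℂ := if k = j then 1 else 0

lemma coeff_Lc_cj (j M : ℕ) : PowerSeries.coeff M (Lc (cj j)) = if j ∈ M.divisors then (j : ℂ) else 0 := by
  rw [Lc, PowerSeries.coeff_mk, ← Finset.sum_ite_eq' M.divisors j (fun k => (k : ℂ))]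
  refine Finset.sum_congr rfl fun k hk => ?_
  have h1 : M / k ≠ 0 := by
    have h2 := Nat.dvd_of_mem_divisors hk
    have h3 : M ≠ 0 := (Nat.mem_divisors.mp hk).2
    exact (Nat.div_pos (Nat.le_of_dvd (by omega) h2) (Nat.pos_of_mem_divisors hk)).ne'
  rw [cj]
  split_ifs
  · simp
  · simp [h1]

lemma a_int {p : PowerSeries ℂ} (hp : p ∈ InS ZR) (hc : PowerSeries.constantCoeff p = 1) {a : ℤ → ℚ}
    (h : thd p = p * -(PowerSeries.mk fun M => ∑ m ∈ M.divisors, (m : ℂ) * (a m : ℂ))) :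
    ∀ m : ℕ, 0 < m → ∃ n : ℤ, a m = n := by
  intro m
  induction m using Nat.strong_induction_on with
  | _ m ih =>
  intro hm
  have hex : ∀ j : ℕ, ∃ n : ℤ, 0 < j → j < m → a j = n := by
    intro j
    by_cases hj : 0 < j ∧ j < m
    · obtain ⟨n, hn⟩ := ih j hj.2 hj.1
      exact ⟨n, fun _ _ => hn⟩
    · exact ⟨0, fun h1 h2 => absurd ⟨h1, h2⟩ hj⟩
  choose b hb using hex
  set S := Finset.Ico 1 m with hS
  have lA := LD.prod S (fun j _ => (LD_Ep (cj j)).pow (b j).toNat)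
  have lB := LD.prod S (fun j _ => (LD_Ep (cj j)).pow (-b j).toNat)
  have hEZ : ∀ j, Ep (cj j) ∈ InS ZR := fun j => InS_Ep fun k => by
    rw [cj]; split_ifs
    · exact one_mem _
    · exact zero_mem _
  set A := ∏ j ∈ S, Ep (cj j) ^ (b j).toNat with hA
  set B := ∏ j ∈ S, Ep (cj j) ^ (-b j).toNat with hB
  have hAc : PowerSeries.constantCoeff A = 1 := by simp [hA, constantCoeff_Ep]
  have hBc : PowerSeries.constantCoeff B = 1 := by simp [hB, constantCoeff_Ep]
  have hAZ : A ∈ InS ZR := prod_mem fun j _ => pow_mem (hEZ j) _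
  have hBZ : B ∈ InS ZR := prod_mem fun j _ => pow_mem (hEZ j) _
  have hA0 : PowerSeries.constantCoeff A ≠ 0 := by rw [hAc]; exact one_ne_zero
  have hu : p * B * A⁻¹ * A = p * B := by
    rw [mul_assoc, PowerSeries.inv_mul_cancel A hA0, mul_one]
  have huZ : p * B * A⁻¹ ∈ InS ZR := mul_mem (mul_mem hp hBZ) (InS_inv hAZ hAc)
  have huc : PowerSeries.constantCoeff (p * B * A⁻¹) = 1 := by
    simp [hc, hBc, hAc]
  set u := p * B * A⁻¹ with hudef
  have lp : LD p (-(PowerSeries.mk fun M => ∑ m ∈ M.divisors, (m : ℂ) * (a m : ℂ))) := h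
  have lu := lp.mul lB
  rw [← hu] at lu
  have lu2 := lA.cancel lu (ne_zero_of_const hAc)
  set l := (-(PowerSeries.mk fun M => ∑ m ∈ M.divisors, (m : ℂ) * (a m : ℂ)) +
    ∑ j ∈ S, ((-b j).toNat : PowerSeries ℂ) * -Lc (cj j)) -
    ∑ j ∈ S, ((b j).toNat : PowerSeries ℂ) * -Lc (cj j) with hl
  have hl' : ∀ M, PowerSeries.coeff M l = -(∑ m ∈ M.divisors, (m : ℂ) * (a m : ℂ)) +
      ∑ j ∈ S, if j ∈ M.divisors then (j : ℂ) * b j else 0 := by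
    intro M
    rw [hl, add_sub_assoc, ← Finset.sum_sub_distrib, map_add, map_neg, PowerSeries.coeff_mk, map_sum]
    congr 1
    refine Finset.sum_congr rfl fun j _ => ?_
    have e : ((-b j).toNat : PowerSeries ℂ) * -Lc (cj j) - ((b j).toNat : PowerSeries ℂ) * -Lc (cj j) =
        PowerSeries.C (b j : ℂ) * Lc (cj j) := by
      have e1 : (b j : ℂ) = (b j).toNat - (-b j).toNat := by
        have : b j = (b j).toNat - (-b j).toNat := by omega
        exact_mod_cast this
      have e2 : ∀ n : ℕ, (n : PowerSeries ℂ) = PowerSeries.C (n : ℂ) := fun n => by simp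
      rw [e1, map_sub, e2, e2]; ring
    rw [e, PowerSeries.coeff_C_mul, coeff_Lc_cj]
    split_ifs <;> ring
  have hz : ∀ M, M < m → PowerSeries.coeff M l = 0 := by
    intro M hM
    rw [hl', ← Finset.sum_filter]
    have : S.filter (· ∈ M.divisors) = M.divisors := by
      ext j
      simp only [Finset.mem_filter, hS, Finset.mem_Ico]
      constructor
      · exact fun h => h.2
      · intro hj
        have := Nat.pos_of_mem_divisors hj
        have := Nat.divisor_le hj
        exact ⟨⟨by omega, by omega⟩, hj⟩
    rw [this, neg_add_eq_zero]
    refine Finset.sum_congr rfl fun j hj => ?_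
    have h1 := Nat.pos_of_mem_divisors hj
    have h2 := Nat.divisor_le hj
    rw [hb j h1 (by omega)]
    push_cast; rfl
  have hm' : PowerSeries.coeff m l = -(m * a m) := by
    rw [hl', ← Finset.sum_filter]
    have : S.filter (· ∈ m.divisors) = m.divisors.erase m := by
      ext j
      simp only [Finset.mem_filter, hS, Finset.mem_Ico, Finset.mem_erase]
      constructor
      · exact fun h => ⟨by omega, h.2⟩
      · rintro ⟨hj1, hj⟩
        have := Nat.pos_of_mem_divisors hj
        have := Nat.divisor_le hj
        exact ⟨⟨by omega, by omega⟩, hj⟩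
    have hmm : m ∈ m.divisors := Nat.mem_divisors.mpr ⟨dvd_rfl, by omega⟩
    rw [this, ← Finset.add_sum_erase _ _ hmm]
    have e : ∑ j ∈ m.divisors.erase m, (j : ℂ) * b j = ∑ j ∈ m.divisors.erase m, (j : ℂ) * (a j : ℂ) := by
      refine Finset.sum_congr rfl fun j hj => ?_
      rw [Finset.mem_erase] at hj
      have h1 := Nat.pos_of_mem_divisors hj.2
      have h2 := Nat.divisor_le hj.2
      rw [hb j h1 (by omega)]
      push_cast; rfl
    rw [e]
    push_cast
    ring
  have h3 := congrArg (PowerSeries.coeff m) lu2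
  rw [coeff_thd, PowerSeries.coeff_mul m u l, Finset.sum_eq_single (0, m)] at h3
  · beta_reduce at h3
    rw [PowerSeries.coeff_zero_eq_constantCoeff_apply, huc, hm'] at h3
    obtain ⟨n, hn⟩ := huZ m
    have hm0 : (m : ℂ) ≠ 0 := by exact_mod_cast hm.ne'
    refine ⟨-n, ?_⟩
    have h4 : (a m : ℂ) = -(n : ℂ) := by
      have : (n : ℂ) = PowerSeries.coeff m u := by simpa using hn
      rw [this]
      apply mul_left_cancel₀ hm0
      linear_combination h3
    exact_mod_cast h4
  · rintro ⟨i, j⟩ hij hne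
    have hij' := Finset.HasAntidiagonal.mem_antidiagonal.mp hij
    simp only at hij'
    have : j < m := by
      rcases Nat.eq_zero_or_pos i with rfl | hi
      · exfalso; apply hne; simp at hij'; simp [hij']
      · omega
    simp [hz j this]
  · intro hh
    exact absurd (Finset.HasAntidiagonal.mem_antidiagonal.mpr (zero_add m)) hh

lemma ee_unit_zero {τ : ℝ} (h : IsModularUnit (fun z : ℍ => ee (τ * z))) : τ = 0 := by
  rw [isModularUnit_iff] at h
  obtain ⟨-, -, ⟨M, hM, inv⟩, -⟩ := h
  let A : SL(2, ℤ) := ⟨!![1, 0; (M : ℤ), 1], by simp [Matrix.det_fin_two]⟩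
  have hA : A ∈ CongruenceSubgroup.Gamma M := by
    rw [CongruenceSubgroup.Gamma_mem]; simp [A]
  have h1 := inv A hA UpperHalfPlane.I
  beta_reduce at h1
  have h2 := congrArg norm h1
  rw [norm_ee, norm_ee, Real.exp_eq_exp] at h2
  have h3 : ((A • UpperHalfPlane.I : ℍ) : ℂ).im = 1 / (1 + (M : ℝ) ^ 2) := by
    rw [UpperHalfPlane.coe_im, ModularGroup.im_smul_eq_div_normSq, ModularGroup.denom_apply]
    simp [A, Complex.normSq_apply]
    ring
  have h4 : ((UpperHalfPlane.I : ℍ) : ℂ).im = 1 := by simp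
  simp only [Complex.re_ofReal_mul, Complex.im_ofReal_mul, h3, h4] at h2
  have hM' : (0 : ℝ) < (M : ℝ) ^ 2 := by positivity
  have hpi := Real.pi_pos
  have h5 : 2 * π * τ * (1 - 1 / (1 + (M : ℝ) ^ 2)) = 0 := by linarith
  have h6 : (1 - 1 / (1 + (M : ℝ) ^ 2)) ≠ 0 := by
    rw [sub_ne_zero, ne_comm, ne_eq, div_eq_one_iff_eq (by positivity)]
    linarith
  rcases mul_eq_zero.mp h5 with h | h
  · rcases mul_eq_zero.mp h with h | h
    · linarith
    · exact h
  · exact absurd h h6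

def Qp (P r : ℕ) : PowerSeries ℂ := Ep (indc P r 1) * Ep (indc P (P - r) 1)
def Qg (P r : ℕ) (x : ℂ) : ℂ := EE (indc P r 1) x * EE (indc P (P - r) 1) x
def Ql (P r : ℕ) : PowerSeries ℂ := Lc (indc P r 1) + Lc (indc P (P - r) 1)

lemma indc_norm' (P r : ℕ) : ∀ m, ‖indc P r 1 m‖ ≤ 1 := indc_norm P r (by simp)

lemma HP_Qp (P r : ℕ) : HP (Qp P r) (Qg P r) := (HP_Ep (indc_norm' P r)).mul (HP_Ep (indc_norm' P (P - r)))

lemma Qp_const (P r : ℕ) : PowerSeries.constantCoeff (Qp P r) = 1 := by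
  simp [Qp, constantCoeff_Ep]

lemma Qg_ne_zero (P r : ℕ) {x : ℂ} (hx : ‖x‖ < 1) : Qg P r x ≠ 0 :=
  mul_ne_zero (EE_ne_zero (indc_norm' _ _) hx) (EE_ne_zero (indc_norm' _ _) hx)

lemma LD_Qp (P r : ℕ) : LD (Qp P r) (-Ql P r) := by
  have := (LD_Ep (indc P r 1)).mul (LD_Ep (indc P (P - r) 1))
  rw [← neg_add] at this
  exact this

lemma coeff_Lc_indc {P r : ℕ} (hr : r < P) (M : ℕ) :
    PowerSeries.coeff M (Lc (indc P r 1)) = ∑ m ∈ M.divisors, (m : ℂ) * if r = m % P then 1 else 0 := by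
  rw [Lc, PowerSeries.coeff_mk]
  refine Finset.sum_congr rfl fun k hk => ?_
  have h1 : M / k ≠ 0 := by
    have h2 := Nat.dvd_of_mem_divisors hk
    have h3 : M ≠ 0 := (Nat.mem_divisors.mp hk).2
    exact (Nat.div_pos (Nat.le_of_dvd (by omega) h2) (Nat.pos_of_mem_divisors hk)).ne'
  rw [indc]
  have e : (k ≡ r [MOD P]) ↔ r = k % P := by
    rw [Nat.ModEq, Nat.mod_eq_of_lt hr]; exact eq_comm
  by_cases h : r = k % P
  · have h' : k ≡ r [MOD P] := e.mpr h
    rw [if_pos h', if_pos h, one_pow]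
  · have h' : ¬ k ≡ r [MOD P] := fun hh => h (e.mp hh)
    rw [if_neg h', if_neg h, zero_pow h1]

lemma exp_sum {L : ℕ} (hL : 0 < L) {b : ℤ → ℤ} (hper : ∀ m i : ℤ, b (m + L * i) = b m)
    (heven : ∀ m, b (-m) = b m) (h0 : b 0 = 0) (m : ℕ) :
    ∑ r ∈ Finset.Ico 1 L, b r * ((if r = m % (2 * L) then 1 else 0) +
      if 2 * L - r = m % (2 * L) then 1 else 0) = b m := by
  set t := m % (2 * L) with ht
  have htl : t < 2 * L := Nat.mod_lt _ (by omega)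
  have hbm : b m = b t := by
    have e : (m : ℤ) = (t : ℤ) + L * (2 * (m / (2 * L) : ℕ)) := by
      have := Nat.mod_add_div m (2 * L)
      rw [← ht] at this
      have h' : (m : ℤ) = ((t + 2 * L * (m / (2 * L)) : ℕ) : ℤ) := by rw [this]
      rw [h']; push_cast; ring
    rw [e, hper]
  rw [hbm]
  have e1 : ∑ r ∈ Finset.Ico 1 L, b r * ((if r = t then 1 else 0) + if 2 * L - r = t then 1 else 0) =
      ∑ r ∈ Finset.Ico 1 L, (if r = t then b r else 0) + ∑ r ∈ Finset.Ico 1 L, if r = 2 * L - t then b r else 0 := by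
    rw [← Finset.sum_add_distrib]
    refine Finset.sum_congr rfl fun r hr => ?_
    rw [Finset.mem_Ico] at hr
    have e : (2 * L - r = t) ↔ (r = 2 * L - t) := by omega
    rw [mul_add]
    congr 1
    · split_ifs <;> simp
    · by_cases h : r = 2 * L - t
      · rw [if_pos h, if_pos (e.mpr h), mul_one]
      · rw [if_neg h, if_neg (fun hh => h (e.mp hh)), mul_zero]
  rw [e1, Finset.sum_ite_eq', Finset.sum_ite_eq']
  simp only [Finset.mem_Ico]
  rcases Nat.eq_zero_or_pos t with h | h
  · rw [h]; simp only [Nat.cast_zero, h0]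
    rw [if_neg (by omega), if_neg (by omega)]; rfl
  rcases lt_trichotomy t L with h' | h' | h'
  · rw [if_pos ⟨by omega, by omega⟩, if_neg (by omega), add_zero]
  · rw [if_neg (by omega), if_neg (by omega)]
    have := hper 0 1
    rw [zero_add, mul_one, h0] at this
    rw [h', this, add_zero]
  · rw [if_neg (by omega), if_pos ⟨by omega, by omega⟩, zero_add]
    have e2 : ((2 * L - t : ℕ) : ℤ) = -(t : ℤ) + L * 2 := by
      rw [Nat.cast_sub (by omega)]; push_cast; ring
    rw [e2, hper, heven]

lemma p_prod {p : PowerSeries ℂ} (hc : PowerSeries.constantCoeff p = 1) {L : ℕ} (hL : 0 < L) {b : ℤ → ℤ}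
    (hper : ∀ m i : ℤ, b (m + L * i) = b m)
    (heven : ∀ m, b (-m) = b m) (h0 : b 0 = 0)
    (h : thd p = p * -(PowerSeries.mk fun M => ∑ m ∈ M.divisors, (m : ℂ) * (b m : ℂ))) :
    p * ∏ r ∈ Finset.Ico 1 L, Qp (2 * L) r ^ (-b r).toNat = ∏ r ∈ Finset.Ico 1 L, Qp (2 * L) r ^ (b r).toNat := by
  set S := Finset.Ico 1 L with hS
  have lA := LD.prod S (fun (j : ℕ) _ => (LD_Qp (2 * L) j).pow (b j).toNat)
  have lB := LD.prod S (fun (j : ℕ) _ => (LD_Qp (2 * L) j).pow (-b j).toNat)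
  have lp : LD p (-(PowerSeries.mk fun M => ∑ m ∈ M.divisors, (m : ℂ) * (b m : ℂ))) := h
  have lu := lp.mul lB
  have key : ∑ j ∈ S, PowerSeries.C ((b j : ℤ) : ℂ) * Ql (2 * L) j =
      PowerSeries.mk fun M => ∑ m ∈ M.divisors, (m : ℂ) * (b m : ℂ) := by
    ext M
    rw [PowerSeries.coeff_mk, map_sum]
    have e : ∀ j ∈ S, PowerSeries.coeff M (PowerSeries.C ((b j : ℤ) : ℂ) * Ql (2 * L) j) =
        ∑ m ∈ M.divisors, (m : ℂ) * ((b j * ((if j = m % (2 * L) then 1 else 0) +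
          if 2 * L - j = m % (2 * L) then 1 else 0) : ℤ) : ℂ) := by
      intro j hj
      rw [hS, Finset.mem_Ico] at hj
      rw [PowerSeries.coeff_C_mul, Ql, map_add, coeff_Lc_indc (by omega), coeff_Lc_indc (by omega),
        ← Finset.sum_add_distrib, Finset.mul_sum]
      refine Finset.sum_congr rfl fun m _ => ?_
      push_cast
      ring
    rw [Finset.sum_congr rfl e, Finset.sum_comm]
    refine Finset.sum_congr rfl fun m _ => ?_
    rw [← Finset.mul_sum, ← Int.cast_sum, exp_sum hL hper heven h0]
  have e2 : ∀ n : ℕ, (n : PowerSeries ℂ) = PowerSeries.C (n : ℂ) := fun n => by simp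
  have el : (-(PowerSeries.mk fun M => ∑ m ∈ M.divisors, (m : ℂ) * (b m : ℂ)) +
      ∑ j ∈ S, ((-b j).toNat : PowerSeries ℂ) * -Ql (2 * L) j) =
      ∑ j ∈ S, ((b j).toNat : PowerSeries ℂ) * -Ql (2 * L) j := by
    rw [← key, ← Finset.sum_neg_distrib, ← Finset.sum_add_distrib]
    refine Finset.sum_congr rfl fun j _ => ?_
    have e1 : ((b j : ℤ) : ℂ) = (b j).toNat - (-b j).toNat := by
      have : b j = (b j).toNat - (-b j).toNat := by omega
      exact_mod_cast this
    rw [e1, map_sub, e2, e2]; ring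
  rw [el] at lu
  refine LD.unique lu lA ?_ ?_
  · simp [hc, Qp_const]
  · rw [map_sum]
    refine Finset.sum_eq_zero fun j _ => ?_
    rw [map_mul, map_neg, Ql, map_add]
    simp [Lc, ← PowerSeries.coeff_zero_eq_constantCoeff_apply]

lemma g_prod {p : PowerSeries ℂ} {g : ℂ → ℂ} (hp : HP p g) {L : ℕ} {b : ℤ → ℤ}
    (h : p * ∏ r ∈ Finset.Ico 1 L, Qp (2 * L) r ^ (-b r).toNat = ∏ r ∈ Finset.Ico 1 L, Qp (2 * L) r ^ (b r).toNat)
    {x : ℂ} (hx : ‖x‖ < 1) : g x = ∏ r ∈ Finset.Ico 1 L, Qg (2 * L) r x ^ b r := by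
  have h1 := hp.mul (HP.prod (Finset.Ico 1 L) fun (r : ℕ) _ => (HP_Qp (2 * L) r).pow (-b r).toNat)
  have h2 := HP.prod (Finset.Ico 1 L) fun (r : ℕ) _ => (HP_Qp (2 * L) r).pow (b r).toNat
  rw [h] at h1
  have h3 := (h1 x hx).unique (h2 x hx)
  have h4 : ∏ r ∈ Finset.Ico 1 L, Qg (2 * L) r x ^ (-b r).toNat ≠ 0 :=
    Finset.prod_ne_zero_iff.mpr fun r _ => pow_ne_zero _ (Qg_ne_zero _ _ hx)
  apply mul_right_cancel₀ h4
  beta_reduce at h3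
  rw [h3, ← Finset.prod_mul_distrib]
  refine Finset.prod_congr rfl fun r _ => ?_
  rw [zpow_toNat (Qg_ne_zero _ _ hx)]

lemma rl_Q {L : ℕ} {r : ℕ} (h1 : 1 ≤ r) (h2 : r < L) : ∃ t : ℝ, ∀ z : ℍ,
    rl ((2 * L : ℕ) : ℤ) (r : ℤ) z = ee (t * z) * (Qg (2 * L) r (ee z))⁻¹ := by
  obtain ⟨r', a1, a2, a3, a4⟩ := rl_eq (l := 2 * L) (r := (r : ℤ)) (by omega) (by
    intro h
    have := Int.le_of_dvd (by omega) h
    push_cast at this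
    omega)
  have e : r' = r := by
    have h : r' ≡ r [MOD (2 * L)] := (Int.natCast_modEq_iff).mp a3
    exact Nat.ModEq.eq_of_lt_of_lt h a2 (by omega)
  subst e
  refine ⟨-((2 * L : ℕ) * bern (r' / (2 * L : ℕ)) / 2), fun z => ?_⟩
  rw [a4 z, Qg, mul_inv, mul_assoc]

lemma ee_finprod {ι : Type*} (S : Finset ι) (t : ι → ℝ) (b : ι → ℤ) (z : ℂ) :
    ∏ i ∈ S, ee (t i * z) ^ b i = ee ((∑ i ∈ S, b i * t i : ℝ) * z) := by
  classical
  induction S using Finset.induction_on with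
  | empty => simp [ee_zero]
  | insert a S ha ih =>
    rw [Finset.prod_insert ha, Finset.sum_insert ha, ih, ← ee_int_mul, ← ee_add]
    congr 1; push_cast; ring

lemma backward {f : ℍ → ℂ} (hu : IsModularUnit f) (hq : RatQ f) :
    ∃ (k : ℕ) (r L m : Fin k → ℤ),
      (∀ i, 1 ≤ L i ∧ ¬ L i ∣ r i) ∧ ∀ z, f z = ∏ i, rl (L i) (r i) z ^ m i := by
  have hu' := hu
  rw [isModularUnit_iff] at hu'
  obtain ⟨hol, hne, ⟨N0, hN0, inv0⟩, ord⟩ := hu'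
  obtain ⟨s, p, g, hp, hpQ, hc, hg, hf⟩ := hq
  obtain ⟨N, hN, h2N, inv⟩ : ∃ N : ℕ, 0 < N ∧ 2 ∣ N ∧
      ∀ A ∈ CongruenceSubgroup.Gamma N, ∀ z : ℍ, f (A • z) = f z :=
    ⟨2 * N0, by omega, dvd_mul_right _ _, fun A hA => inv0 A (Gamma_mono (dvd_mul_left _ _) hA)⟩
  have : NeZero N := ⟨hN.ne'⟩
  obtain ⟨D, k, c, hD, hc0, hfD⟩ := unit_structure hol hne inv ord
  have hid := formal_identity hp hc hf hc0 hfD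
  have hpZ := p_int h2N hol inv ord hp hpQ hc hf hD (F_pow_mem hid)
  have hF0 : PowerSeries.expand N (NeZero.ne N) p ≠ 0 :=
    ne_zero_of_const (by rw [constantCoeff_expand', hc])
  obtain ⟨L, a, hL, hper, heven, ha0, hthd⟩ := exponents hpQ hc hD (F_thd hD hF0 hid)
  have haint := a_int hpZ hc hthd
  have hex : ∀ m : ℤ, ∃ n : ℤ, a m = n := by
    intro m
    rcases lt_trichotomy m 0 with h | h | h
    · obtain ⟨n, hn⟩ := haint m.natAbs (by omega)
      refine ⟨n, ?_⟩
      rw [← hn, ← heven]; congr 1; omega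
    · exact ⟨0, by rw [h, ha0]; simp⟩
    · obtain ⟨n, hn⟩ := haint m.natAbs (by omega)
      refine ⟨n, ?_⟩
      rw [← hn]; congr 1; omega
  choose b hb using hex
  have hper' : ∀ m i : ℤ, b (m + L * i) = b m := fun m i => by
    have := hper m i; rw [hb, hb] at this; exact_mod_cast this
  have heven' : ∀ m, b (-m) = b m := fun m => by
    have := heven m; rw [hb, hb] at this; exact_mod_cast this
  have h0' : b 0 = 0 := by rw [hb] at ha0; exact_mod_cast ha0
  have hthd' : thd p = p * -(PowerSeries.mk fun M => ∑ m ∈ M.divisors, (m : ℂ) * (b m : ℂ)) := by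
    rw [hthd]; congr 3; funext M
    refine Finset.sum_congr rfl fun m _ => ?_
    rw [hb]; push_cast; rfl
  have hpp := p_prod hc hL hper' heven' h0' hthd'
  have hex2 : ∀ r : ℕ, ∃ t : ℝ, r ∈ Finset.Ico 1 L → ∀ z : ℍ,
      rl ((2 * L : ℕ) : ℤ) (r : ℤ) z = ee (t * z) * (Qg (2 * L) r (ee z))⁻¹ := by
    intro r
    by_cases h : r ∈ Finset.Ico 1 L
    · obtain ⟨t, ht⟩ := rl_Q (Finset.mem_Ico.mp h).1 (Finset.mem_Ico.mp h).2
      exact ⟨t, fun _ => ht⟩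
    · exact ⟨0, fun h' => absurd h' h⟩
  choose t ht using hex2
  set S := Finset.Ico 1 L with hS
  have hndvd : ∀ r ∈ S, ¬ ((2 * L : ℕ) : ℤ) ∣ (r : ℤ) := by
    intro r hr h
    rw [hS, Finset.mem_Ico] at hr
    have := Int.le_of_dvd (by omega) h
    push_cast at this
    omega
  have hR : ∀ z : ℍ, ∏ r ∈ S, rl ((2 * L : ℕ) : ℤ) (r : ℤ) z ^ (-b r) =
      ee ((∑ r ∈ S, ((-b r : ℤ) : ℝ) * t r : ℝ) * z) * g (ee z) := by
    intro z
    rw [g_prod hp hpp (norm_ee_lt_one z.2), ← ee_finprod, ← Finset.prod_mul_distrib]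
    refine Finset.prod_congr rfl fun r hr => ?_
    rw [ht r hr z, mul_zpow, _root_.inv_zpow', neg_neg]
  have hRu : IsModularUnit (fun z => ∏ r ∈ S, rl ((2 * L : ℕ) : ℤ) (r : ℤ) z ^ (-b r)) :=
    IsModularUnit.prod S fun r hr => (rl_unit (by omega) (hndvd r hr)).zpow _
  set β : ℝ := ∑ r ∈ S, ((-b r : ℤ) : ℝ) * t r with hβ
  have hquot : IsModularUnit (fun z : ℍ => ee (((s : ℝ) - β : ℝ) * z)) := by
    have := hu.mul hRu.inv
    convert this using 2 with z
    rw [hR, hf, mul_inv]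
    have hgz := hg (ee z) (norm_ee_lt_one z.2)
    have e : ee (s * z) = ee (((s : ℝ) - β : ℝ) * z) * ee (β * z) := by
      rw [← ee_add]; congr 1; push_cast; ring
    rw [e]
    have := ee_ne_zero (β * z)
    generalize ee (β * z) = w at this
    field_simp
  have hτ := ee_unit_zero hquot
  have hfR : ∀ z, f z = ∏ r ∈ S, rl ((2 * L : ℕ) : ℤ) (r : ℤ) z ^ (-b r) := by
    intro z
    rw [hR, hf]
    have : (s : ℂ) = (β : ℂ) := by
      have : (s : ℝ) = β := by linarith
      rw [← this]; simp
    rw [this]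
  refine ⟨L - 1, fun i => ((1 + i : ℕ) : ℤ), fun _ => ((2 * L : ℕ) : ℤ), fun i => -b ((1 + i : ℕ) : ℤ), ?_, ?_⟩
  · intro i
    refine ⟨by beta_reduce; omega, hndvd _ ?_⟩
    have := i.2
    rw [hS, Finset.mem_Ico]; omega
  · intro z
    rw [hfR, hS, Finset.prod_Ico_eq_prod_range, Finset.prod_range]

/-- Theorem 1: a function lies in `ℚ* · E` (the group generated by all `[r]_l`) if and only if
it is a modular unit whose Fourier expansion, up to a fractional power of `q`, has rational
coefficients. -/
theorem sl2z_invariant_units_stmt1 (f : UpperHalfPlane → ℂ) :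
    (∃ γ : ℚ, γ ≠ 0 ∧ ∃ (k : ℕ) (r L m : Fin k → ℤ),
      (∀ i, 1 ≤ L i ∧ ¬ L i ∣ r i) ∧
      ∀ z, f z = (γ : ℂ) * ∏ i, rl (L i) (r i) z ^ m i) ↔
    (IsModularUnit f ∧ ∃ (s : ℚ) (c : ℕ → ℚ), ∀ z : UpperHalfPlane,
      f z * Complex.exp (-(2 * (π : ℂ) * Complex.I * (s : ℂ) * (z : ℂ))) =
        ∑' n : ℕ, (c n : ℂ) * Complex.exp (2 * (π : ℂ) * Complex.I * (n : ℂ) * (z : ℂ))) := by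
  refine ⟨forward, ?_⟩
  rintro ⟨hu, s, c, h⟩
  have hne := (isModularUnit_iff.mp hu).2.1
  obtain ⟨γ, hγ, hq⟩ := qexp_normal hne h
  have hγ' : (γ : ℂ) ≠ 0 := by exact_mod_cast hγ
  obtain ⟨k, r, L, m, h1, h2⟩ := backward ((IsModularUnit.const (inv_ne_zero hγ')).mul hu) hq
  refine ⟨γ, hγ, k, r, L, m, h1, fun z => ?_⟩
  rw [← h2 z, mul_inv_cancel_left₀ hγ']
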